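/- arXiv:1812.04883 — 6 statements merged into one kernel-verified Lean document; each statement's English description precedes it below -/
import Mathlib

section
/- Let X ⊆ ℝⁿ be a compact set, let U ⊇ X be open, and let f : U → ℝ be a real-analytic function for which there exists a nonzero polynomial P ∈ ℝ[x₁,…,xₙ,y] with P(x, f(x)) = 0 for all x ∈ U; let d = deg P. Assume that every x ∈ X with ∇f(x) = 0 satisfies f(x) = 0. Then there exists a constant C > 0 such that |∇f(x)| ≥ C·|f(x)|^(1 − 1/S(n,d)) for all x ∈ X. -/
section Counting

open Finset

/-- The exponents of total degree at most `B`. -/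
noncomputable def expsLE (n B : ℕ) : Finset (Fin n →₀ ℕ) :=
  (Finset.range (B + 1)).biUnion fun k => (Finset.univ : Finset (Fin n)).finsuppAntidiag k

theorem mem_expsLE {n B : ℕ} {β : Fin n →₀ ℕ} : β ∈ expsLE n B ↔ ∑ i, β i ≤ B := by
  simp [expsLE, mem_finsuppAntidiag]

theorem card_expsLE (n B : ℕ) : (expsLE n B).card = (B + n).choose n := by
  rw [expsLE, card_biUnion, ← Nat.sum_range_multichoose]
  · simp [card_finsuppAntidiag_nat_eq_multichoose]
  · intro i _ j _ hij
    rw [Function.onFun, Finset.disjoint_left]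
    intro β hi hj
    rw [mem_finsuppAntidiag] at hi hj
    exact hij (hi.1.symm.trans hj.1)

theorem choose_add_le (m d n : ℕ) :
    (m + d).choose (n + 1) ≤ m.choose (n + 1) + d * (m + d).choose n := by
  induction d with
  | zero => simp
  | succ d ih =>
    have h1 : (m + (d + 1)).choose (n + 1) = (m + d).choose n + (m + d).choose (n + 1) :=
      Nat.choose_succ_succ _ _
    have h2 : (m + d).choose n ≤ (m + (d + 1)).choose n := Nat.choose_le_choose n (by omega)
    nlinarith

theorem exists_choose_lt (n d E Δ : ℕ) (hΔ : d * E ^ n ≤ Δ) :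
    ∃ B, d * (E * (B + Δ) + n + 1).choose n < (Δ + 1) * (B + n).choose n := by
  have hlim : Filter.Tendsto (fun B : ℕ => d * ((E * ((B : ℝ) + Δ) + 1 + n) / ((B : ℝ) + 1)) ^ n)
      Filter.atTop (nhds (d * (E : ℝ) ^ n)) := by
    refine Filter.Tendsto.const_mul _ (Filter.Tendsto.pow ?_ n)
    have h1 : ∀ B : ℕ, (E * ((B : ℝ) + Δ) + 1 + n) / ((B : ℝ) + 1) =
        E + (E * (Δ : ℝ) + 1 + n - E) * (1 / ((B : ℝ) + 1)) := by
      intro B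
      field_simp
      ring
    simp_rw [h1]
    simpa using (tendsto_one_div_add_atTop_nhds_zero_nat (𝕜 := ℝ)).const_mul
      (E * (Δ : ℝ) + 1 + n - E) |>.const_add (E : ℝ)
  have hlt : (d * (E : ℝ) ^ n) < Δ + 1 := by
    have : ((d * E ^ n : ℕ) : ℝ) ≤ Δ := by exact_mod_cast hΔ
    push_cast at this
    linarith
  obtain ⟨B, hB⟩ := (hlim.eventually_lt_const hlt).exists
  refine ⟨B, ?_⟩
  have hB1 : (0 : ℝ) < (B : ℝ) + 1 := by positivity
  rw [div_pow, ← mul_div_assoc, div_lt_iff₀ (by positivity)] at hB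
  have hB2 : d * (E * (B + Δ) + 1 + n) ^ n < (Δ + 1) * (B + 1) ^ n := by exact_mod_cast hB
  have h3 := Nat.ascFactorial_le_pow_add (E * (B + Δ) + 1) n
  have h4 := Nat.pow_succ_le_ascFactorial (B + 1) n
  rw [Nat.ascFactorial_eq_factorial_mul_choose] at h3 h4
  have h5 : n.factorial * (d * (E * (B + Δ) + n + 1).choose n) <
      n.factorial * ((Δ + 1) * (B + n).choose n) := by
    calc n.factorial * (d * (E * (B + Δ) + n + 1).choose n)
        = d * (n.factorial * (E * (B + Δ) + 1 + n).choose n) := by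
          rw [add_right_comm]; ring
      _ ≤ d * (E * (B + Δ) + 1 + n) ^ n := by gcongr
      _ < (Δ + 1) * (B + 1) ^ n := hB2
      _ ≤ (Δ + 1) * (n.factorial * (B + n).choose n) := by gcongr
      _ = _ := by ring
  exact lt_of_mul_lt_mul_left h5 (Nat.zero_le _)

open MvPolynomial in
/-- Modulo a polynomial of degree `d`, any `n + 1` rational functions with common denominator `W` and
degree at most `E` satisfy a nontrivial relation, of degree at most `Δ` in the last of them
provided that `d * E ^ n ≤ Δ`. -/
theorem exists_relation {R : Type*} [CommRing R] [IsDomain R] (F : Type*) [Field F] {n d E Δ : ℕ}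
    (P : MvPolynomial (Fin (n + 1)) R) (hP : P ≠ 0) (hd : P.totalDegree ≤ d)
    (N : Fin n → MvPolynomial (Fin (n + 1)) R) (M W : MvPolynomial (Fin (n + 1)) R)
    (hN : ∀ i, (N i).totalDegree ≤ E) (hM : M.totalDegree ≤ E) (hW : W.totalDegree ≤ E)
    (hE : 1 ≤ E) (hΔ : d * E ^ n ≤ Δ) :
    ∃ A : MvPolynomial (Fin n) (Polynomial R), A ≠ 0 ∧
      (∀ c : Fin n → R, (eval (fun i => Polynomial.C (c i)) A).natDegree ≤ Δ) ∧
      ∀ φ : MvPolynomial (Fin (n + 1)) R →+* F, φ P = 0 → φ W ≠ 0 →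
        A.eval₂ (Polynomial.eval₂RingHom (φ.comp C) (φ M / φ W)) (fun i => φ (N i) / φ W) = 0 := by
  obtain ⟨B, hB⟩ := exists_choose_lt n d E Δ hΔ
  set D := E * (B + Δ) with hD
  have hdD : d ≤ D := by
    have h1 : d * 1 ≤ d * E ^ n := by gcongr; exact Nat.one_le_pow _ _ hE
    have h2 : 1 * (0 + Δ) ≤ D := by rw [hD]; gcongr; omega
    omega
  let I := (expsLE n B) × Fin (Δ + 1)
  let T : I → MvPolynomial (Fin (n + 1)) R := fun i =>
    (∏ j, N j ^ (i.1.1 j)) * W ^ (B - ∑ j, i.1.1 j) * M ^ (i.2 : ℕ) * W ^ (Δ - i.2)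
  let v : I ⊕ (expsLE (n + 1) (D - d)) → MvPolynomial (Fin (n + 1)) R :=
    Sum.elim T fun s => P * monomial s.1 1
  have hpow : ∀ (Q : MvPolynomial (Fin (n + 1)) R) (k : ℕ), Q.totalDegree ≤ E →
      (Q ^ k).totalDegree ≤ E * k := fun Q k h => by
    rw [mul_comm]
    exact (totalDegree_pow _ _).trans (by gcongr)
  have hT : ∀ i, (T i).totalDegree ≤ D := by
    rintro ⟨⟨β, hβ⟩, l⟩
    rw [mem_expsLE] at hβ
    have h1 : (∏ j, N j ^ (β j)).totalDegree ≤ E * ∑ j, β j := by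
      refine (totalDegree_finsetProd _ _).trans ?_
      rw [mul_sum]
      exact sum_le_sum fun j _ => hpow _ _ (hN j)
    have hl := l.2
    calc _ ≤ E * ∑ j, β j + E * (B - ∑ j, β j) + E * l + E * (Δ - l) := by
          refine (totalDegree_mul _ _).trans (add_le_add ((totalDegree_mul _ _).trans
            (add_le_add ((totalDegree_mul _ _).trans (add_le_add h1 (hpow _ _ hW)))
            (hpow _ _ hM))) (hpow _ _ hW))
      _ = D := by
          rw [hD, ← mul_add, ← mul_add, ← mul_add]
          congr 1
          omega
  have hv : ∀ i, (v i).totalDegree ≤ D := by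
    rintro (i | ⟨s, hs⟩)
    · exact hT i
    · rw [mem_expsLE] at hs
      have h1 : (monomial s (1 : R)).totalDegree ≤ D - d := by
        rw [totalDegree_monomial _ one_ne_zero, Finsupp.sum_fintype _ _ (by simp)]
        exact hs
      exact (totalDegree_mul _ _).trans ((add_le_add hd h1).trans (by omega))
  let Φ : (I ⊕ (expsLE (n + 1) (D - d)) → R) →ₗ[R] MvPolynomial (Fin (n + 1)) R :=
    Fintype.linearCombination R v
  have hΦ : ∀ u, Φ u = ∑ i, u i • v i := fun u => Fintype.linearCombination_apply R v u
  have hΦdeg : ∀ u, (Φ u).totalDegree ≤ D := by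
    intro u
    rw [hΦ]
    exact totalDegree_finsetSum_le fun i _ => (totalDegree_smul_le _ _).trans (hv i)
  let Ψ : (I ⊕ (expsLE (n + 1) (D - d)) → R) →ₗ[R] (expsLE (n + 1) D → R) :=
    (LinearMap.pi fun s => lcoeff R s.1) ∘ₗ Φ
  have hninj : ¬ Function.Injective Ψ := by
    intro hinj
    have h1 := card_le_of_injective R Ψ hinj
    rw [Fintype.card_sum, Fintype.card_prod, Fintype.card_coe, Fintype.card_coe, Fintype.card_coe,
      Fintype.card_fin, card_expsLE, card_expsLE, card_expsLE] at h1
    have h2 := choose_add_le (D - d + (n + 1)) d n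
    rw [show D - d + (n + 1) + d = D + (n + 1) by omega] at h2
    rw [add_assoc] at hB
    nlinarith
  obtain ⟨u, hu, hu0⟩ : ∃ u, Ψ u = 0 ∧ u ≠ 0 := by
    rw [injective_iff_map_eq_zero] at hninj
    push Not at hninj
    exact hninj
  have hΦu : Φ u = 0 := by
    ext s
    rw [coeff_zero]
    by_cases hs : s ∈ expsLE (n + 1) D
    · exact congrFun hu ⟨s, hs⟩
    · refine coeff_eq_zero_of_totalDegree_lt ((hΦdeg u).trans_lt ?_)
      rw [mem_expsLE, not_le] at hs
      refine hs.trans_le (le_of_eq ?_)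
      exact (sum_subset (subset_univ _) (by simp)).symm
  have hrel : ∑ i, u (Sum.inl i) • T i + P * ∑ s : expsLE (n + 1) (D - d),
      monomial s.1 (u (Sum.inr s)) = 0 := by
    rw [← hΦu, hΦ, Fintype.sum_sum_type, mul_sum]
    congr 1
    refine sum_congr rfl fun s _ => ?_
    simp only [v, Sum.elim_inr]
    rw [← mul_smul_comm, smul_monomial, smul_eq_mul, mul_one]
  have hne : ∃ i, u (Sum.inl i) ≠ 0 := by
    by_contra! hcon
    simp only [hcon, zero_smul, sum_const_zero, zero_add, mul_eq_zero, hP, false_or] at hrel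
    apply hu0
    ext (i | s)
    · exact hcon i
    · have := congrArg (coeff s.1) hrel
      rw [coeff_sum, sum_eq_single s] at this
      · simpa using this
      · intro s' _ hs'
        rw [coeff_monomial, if_neg (fun h => hs' (Subtype.ext h))]
      · simp
  let A : MvPolynomial (Fin n) (Polynomial R) :=
    ∑ i : I, monomial i.1.1 (Polynomial.monomial i.2 (u (Sum.inl i)))
  refine ⟨A, ?_, ?_, ?_⟩
  · obtain ⟨i, hi⟩ := hne
    intro hA
    have h1 := congrArg (fun Q => (coeff i.1.1 Q).coeff i.2) hA
    simp only [A, coeff_sum, coeff_monomial, coeff_zero, Polynomial.coeff_zero,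
      Polynomial.finsetSum_coeff] at h1
    rw [sum_eq_single i] at h1
    · simp at h1
      exact hi h1
    · intro j _ hj
      split_ifs with h
      · rw [Polynomial.coeff_monomial, if_neg]
        exact fun h' => hj (Prod.ext (Subtype.ext h) (Fin.ext h'))
      · simp
    · simp
  · intro c
    simp only [A, map_sum, eval_monomial]
    refine Polynomial.natDegree_sum_le_of_forall_le _ _ fun i _ => ?_
    rw [Finsupp.prod]
    simp_rw [← map_pow]
    rw [← map_prod]
    refine (Polynomial.natDegree_mul_C_le _ _).trans ((Polynomial.natDegree_monomial_le _).trans ?_)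
    have := i.2.2
    omega
  · intro φ hφP hφW
    have h1 := congrArg φ hrel
    simp only [map_add, map_mul, hφP, zero_mul, add_zero, map_sum, map_zero, smul_eq_C_mul] at h1
    simp only [A, eval₂_sum, eval₂_monomial]
    have h2 : ∀ i : I, (Polynomial.eval₂RingHom (φ.comp C) (φ M / φ W))
        (Polynomial.monomial i.2 (u (Sum.inl i))) *
        (i.1.1.prod fun j e => (φ (N j) / φ W) ^ e) =
        (φ (C (u (Sum.inl i))) * φ (T i)) / φ W ^ (B + Δ) := by
      rintro ⟨⟨β, hβ⟩, l⟩
      rw [mem_expsLE] at hβ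
      have hl : (l : ℕ) ≤ Δ := by have := l.2; omega
      rw [Finsupp.prod_fintype _ _ (by simp)]
      simp only [Polynomial.coe_eval₂RingHom, Polynomial.eval₂_monomial, RingHom.comp_apply, T,
        map_mul, map_prod, map_pow, div_pow, prod_div_distrib, prod_pow_eq_pow_sum]
      have e1 : φ W ^ (B + Δ) = φ W ^ (∑ j, β j) * φ W ^ (B - ∑ j, β j) * φ W ^ (l : ℕ) *
          φ W ^ (Δ - l) := by
        rw [← pow_add, ← pow_add, ← pow_add]
        congr 1
        omega
      rw [e1]
      field_simp
    rw [sum_congr rfl fun i _ => h2 i, ← sum_div, h1, zero_div]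

end Counting

theorem norm_gradient_eq {n : ℕ} (f : EuclideanSpace ℝ (Fin n) → ℝ)
    (x : EuclideanSpace ℝ (Fin n)) : ‖gradient f x‖ = ‖fderiv ℝ f x‖ := by
  rw [gradient, LinearIsometryEquiv.norm_map]

section Graph

open MvPolynomial Metric Topology
open Filter hiding map

variable {n : ℕ}

theorem totalDegree_pderiv_le {σ R : Type*} [CommSemiring R] (i : σ) (P : MvPolynomial σ R) :
    (pderiv i P).totalDegree ≤ P.totalDegree - 1 := by
  classical
  refine Finset.sup_le fun s hs => ?_
  rw [mem_support_iff, coeff_pderiv] at hs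
  have h := le_totalDegree (mem_support_iff.2 (left_ne_zero_of_mul hs))
  rw [Finsupp.sum_add_index' (fun _ => rfl) (fun _ _ _ => rfl), Finsupp.sum_single_index rfl] at h
  omega

theorem exists_pderiv_ne_zero {σ R : Type*} [CommRing R] [IsDomain R] [CharZero R]
    {P : MvPolynomial σ R} (hP : P.totalDegree ≠ 0) : ∃ i, pderiv i P ≠ 0 := by
  classical
  by_contra! h
  refine hP ((totalDegree_eq_zero_iff (p := P)).2 fun m hm i => ?_)
  by_contra hi
  have h1 := congrArg (coeff (m - Finsupp.single i 1)) (h i)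
  rw [coeff_pderiv, coeff_zero] at h1
  have h2 : m - Finsupp.single i 1 + Finsupp.single i 1 = m :=
    tsub_add_cancel_of_le (by simpa [Nat.one_le_iff_ne_zero] using hi)
  rw [h2] at h1
  rw [mem_support_iff] at hm
  exact (mul_eq_zero.1 h1).elim hm (Nat.cast_add_one_ne_zero _)

/-- The point of the graph of `f` above `x`. -/
def graphPoint (f : EuclideanSpace ℝ (Fin n) → ℝ) (x : EuclideanSpace ℝ (Fin n)) :
    Fin (n + 1) → ℝ :=
  Fin.snoc (fun i => x i) (f x)

/-- The partial derivative of `f` in the `i`-th coordinate. -/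
noncomputable def partialDeriv (i : Fin n) (f : EuclideanSpace ℝ (Fin n) → ℝ)
    (x : EuclideanSpace ℝ (Fin n)) : ℝ :=
  fderiv ℝ f x (EuclideanSpace.single i 1)

theorem hasFDerivAt_eval {E σ : Type*} [NormedAddCommGroup E] [NormedSpace ℝ E] [Fintype σ]
    {g : E → σ → ℝ} {g' : σ → E →L[ℝ] ℝ} {x : E} (hg : ∀ j, HasFDerivAt (fun x => g x j) (g' j) x)
    (Q : MvPolynomial σ ℝ) :
    HasFDerivAt (fun x => eval (g x) Q) (∑ j, eval (g x) (pderiv j Q) • g' j) x := by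
  classical
  induction Q using MvPolynomial.induction_on with
  | C a => simpa using hasFDerivAt_const a x
  | add p q hp hq =>
    refine ((hp.add hq).congr_fderiv ?_).congr_of_eventuallyEq (.of_forall fun y => ?_)
    · simp [add_smul, Finset.sum_add_distrib]
    · exact map_add _ _ _
  | mul_X p i hp =>
    refine ((hp.mul (hg i)).congr_fderiv ?_).congr_of_eventuallyEq (.of_forall fun y => ?_)
    · simp only [Derivation.leibniz, pderiv_X, smul_eq_mul, map_add, map_mul, eval_X, add_smul,
        Finset.sum_add_distrib, Finset.smul_sum, smul_smul]
      congr 1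
      rw [Finset.sum_eq_single i]
      · simp
      · intro j _ hj
        simp [hj.symm]
      · simp
    · simp

variable {f : EuclideanSpace ℝ (Fin n) → ℝ} {x : EuclideanSpace ℝ (Fin n)}

theorem partialDeriv_eval_graphPoint (hf : DifferentiableAt ℝ f x) (i : Fin n)
    (Q : MvPolynomial (Fin (n + 1)) ℝ) :
    partialDeriv i (fun x => eval (graphPoint f x) Q) x =
      eval (graphPoint f x) (pderiv i.castSucc Q) +
        eval (graphPoint f x) (pderiv (Fin.last n) Q) * partialDeriv i f x := by
  have h := hasFDerivAt_eval (g := graphPoint f) (x := x)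
    (g' := Fin.snoc (fun i => EuclideanSpace.proj i) (fderiv ℝ f x)) (fun j => by
      refine Fin.lastCases ?_ (fun i => ?_) j
      · simpa [graphPoint] using hf.hasFDerivAt
      · simpa [graphPoint] using (EuclideanSpace.proj (𝕜 := ℝ) i).hasFDerivAt) Q
  rw [partialDeriv, h.fderiv, Fin.sum_univ_castSucc]
  simp [partialDeriv]

theorem analyticAt_eval_graphPoint (hf : AnalyticAt ℝ f x) (Q : MvPolynomial (Fin (n + 1)) ℝ) :
    AnalyticAt ℝ (fun x => eval (graphPoint f x) Q) x := by
  have h : ∀ j, AnalyticAt ℝ (fun x => graphPoint f x j) x := fun j => by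
    refine Fin.lastCases ?_ (fun i => ?_) j
    · simpa [graphPoint] using hf
    · simpa [graphPoint] using (EuclideanSpace.proj (𝕜 := ℝ) i).analyticAt x
  simpa [MvPolynomial.coe_aeval_eq_eval] using AnalyticAt.aeval_mvPolynomial h Q

theorem AnalyticAt.partialDeriv (hf : AnalyticAt ℝ f x) (i : Fin n) :
    AnalyticAt ℝ (partialDeriv i f) x :=
  (ContinuousLinearMap.apply ℝ ℝ (EuclideanSpace.single i (1 : ℝ))).analyticAt _ |>.comp hf.fderiv

/-- On a ball, a function which is algebraic of degree at most `d` is a root of a polynomial of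
degree at most `d` whose derivative with respect to the last variable is generically nonzero. -/
theorem exists_generic_polynomial {a : EuclideanSpace ℝ (Fin n)} {r : ℝ}
    (hf : AnalyticOnNhd ℝ f (ball a r)) (P : MvPolynomial (Fin (n + 1)) ℝ) (hP : P ≠ 0)
    (hPf : ∀ x ∈ ball a r, eval (graphPoint f x) P = 0) :
    ∃ P' : MvPolynomial (Fin (n + 1)) ℝ, P' ≠ 0 ∧ P'.totalDegree ≤ P.totalDegree ∧
      (∀ x ∈ ball a r, eval (graphPoint f x) P' = 0) ∧
      ∀ x ∈ ball a r, x ∈ closure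
        {x ∈ ball a r | eval (graphPoint f x) (pderiv (Fin.last n) P') ≠ 0} := by
  induction hk : P.totalDegree using Nat.strong_induction_on generalizing P with
  | _ k ih =>
  subst hk
  by_cases hdense : ∀ x ∈ ball a r, x ∈ closure
        {x ∈ ball a r | eval (graphPoint f x) (pderiv (Fin.last n) P) ≠ 0}
  · exact ⟨P, hP, le_rfl, hPf, hdense⟩
  push Not at hdense
  obtain ⟨x₀, hx₀, hx₀c⟩ := hdense
  have hlast : ∀ x ∈ ball a r, eval (graphPoint f x) (pderiv (Fin.last n) P) = 0 := by
    have h1 : ∀ᶠ x in 𝓝 x₀, eval (graphPoint f x) (pderiv (Fin.last n) P) = 0 := by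
      rw [mem_closure_iff_frequently, not_frequently] at hx₀c
      filter_upwards [hx₀c, isOpen_ball.mem_nhds hx₀] with x hx hxb
      by_contra h
      exact hx ⟨hxb, h⟩
    exact AnalyticOnNhd.eqOn_zero_of_preconnected_of_eventuallyEq_zero
      (fun x hx => analyticAt_eval_graphPoint (hf x hx) _)
      (convex_ball a r).isPreconnected hx₀ h1
  have hall : ∀ i, ∀ x ∈ ball a r, eval (graphPoint f x) (pderiv i P) = 0 := by
    intro i
    refine Fin.lastCases hlast (fun i x hx => ?_) i
    have h1 := partialDeriv_eval_graphPoint (hf x hx).differentiableAt i P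
    rw [hlast x hx, zero_mul, add_zero] at h1
    rw [← h1, partialDeriv]
    have h2 : (fun x => eval (graphPoint f x) P) =ᶠ[𝓝 x] fun _ => 0 := by
      filter_upwards [isOpen_ball.mem_nhds hx] with y hy using hPf y hy
    rw [h2.fderiv_eq]
    simp
  have hdeg : P.totalDegree ≠ 0 := by
    intro h0
    rw [totalDegree_eq_zero_iff_eq_C] at h0
    have h1 := hPf x₀ hx₀
    rw [h0, eval_C] at h1
    rw [h1, C_0] at h0
    exact hP h0
  obtain ⟨i, hi⟩ := exists_pderiv_ne_zero hdeg
  have hlt : (pderiv i P).totalDegree < P.totalDegree :=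
    (totalDegree_pderiv_le i P).trans_lt (by omega)
  obtain ⟨P', h1, h2, h3⟩ := ih _ hlt _ hi (hall i) rfl
  exact ⟨P', h1, h2.trans hlt.le, h3⟩

/-- The gradient of the function `x ↦ (‖∇f‖² + (f - t)² / t²) / t² + 1 / (r² - ‖x - a‖²)`. -/
noncomputable def penaltyGradient (f : EuclideanSpace ℝ (Fin n) → ℝ)
    (a : EuclideanSpace ℝ (Fin n)) (r t : ℝ) (i : Fin n) (x : EuclideanSpace ℝ (Fin n)) : ℝ :=
  2 * (∑ j, partialDeriv j f x * partialDeriv i (partialDeriv j f) x) / t ^ 2 +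
    2 * (f x - t) * partialDeriv i f x / t ^ 4 + 2 * (x i - a i) / (r ^ 2 - ‖x - a‖ ^ 2) ^ 2

/-- The function `x ↦ ‖∇f‖² + (f - t)² / t² + t² / (r² - ‖x - a‖²)`. -/
noncomputable def penalty (f : EuclideanSpace ℝ (Fin n) → ℝ)
    (a : EuclideanSpace ℝ (Fin n)) (r t : ℝ) (x : EuclideanSpace ℝ (Fin n)) : ℝ :=
  ∑ j, partialDeriv j f x ^ 2 + (f x - t) ^ 2 / t ^ 2 + t ^ 2 / (r ^ 2 - ‖x - a‖ ^ 2)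

section Implicit

variable {a : EuclideanSpace ℝ (Fin n)} {r : ℝ} {P : MvPolynomial (Fin (n + 1)) ℝ}

theorem partialDeriv_eq_of_eqOn {g h : EuclideanSpace ℝ (Fin n) → ℝ}
    (hgh : ∀ x ∈ ball a r, g x = h x) (i : Fin n) (hx : x ∈ ball a r) :
    partialDeriv i g x = partialDeriv i h x := by
  have h2 : g =ᶠ[𝓝 x] h := by
    filter_upwards [isOpen_ball.mem_nhds hx] with y hy using hgh y hy
  rw [partialDeriv, partialDeriv, h2.fderiv_eq]

theorem eval_pderiv_add_eq_zero (hf : AnalyticOnNhd ℝ f (ball a r))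
    (hPf : ∀ x ∈ ball a r, eval (graphPoint f x) P = 0) (i : Fin n) (hx : x ∈ ball a r) :
    eval (graphPoint f x) (pderiv i.castSucc P) +
      eval (graphPoint f x) (pderiv (Fin.last n) P) * partialDeriv i f x = 0 := by
  rw [← partialDeriv_eval_graphPoint (hf x hx).differentiableAt i P,
    partialDeriv_eq_of_eqOn (h := fun _ => 0) hPf i hx]
  simp [partialDeriv]

theorem eval_pderiv_pderiv_add_eq_zero (hf : AnalyticOnNhd ℝ f (ball a r))
    (hPf : ∀ x ∈ ball a r, eval (graphPoint f x) P = 0) (i j : Fin n) (hx : x ∈ ball a r) :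
    eval (graphPoint f x) (pderiv i.castSucc (pderiv j.castSucc P)) +
      eval (graphPoint f x) (pderiv (Fin.last n) (pderiv j.castSucc P)) * partialDeriv i f x +
      ((eval (graphPoint f x) (pderiv i.castSucc (pderiv (Fin.last n) P)) +
      eval (graphPoint f x) (pderiv (Fin.last n) (pderiv (Fin.last n) P)) * partialDeriv i f x) *
        partialDeriv j f x +
      eval (graphPoint f x) (pderiv (Fin.last n) P) * partialDeriv i (partialDeriv j f) x) = 0 := by
  have hd := (hf x hx).differentiableAt
  have h0 := partialDeriv_eq_of_eqOn (h := fun _ => 0)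
    (fun y hy => eval_pderiv_add_eq_zero hf hPf j hy) i hx
  rw [← partialDeriv_eval_graphPoint hd, ← partialDeriv_eval_graphPoint hd]
  have e1 := (analyticAt_eval_graphPoint (hf x hx) (pderiv j.castSucc P)).differentiableAt
  have e2 := (analyticAt_eval_graphPoint (hf x hx) (pderiv (Fin.last n) P)).differentiableAt
  have e3 := ((hf x hx).partialDeriv j).differentiableAt
  have h1 := (e1.hasFDerivAt.add (e2.hasFDerivAt.mul e3.hasFDerivAt)).fderiv
  have h2 : partialDeriv i (fun _ => (0 : ℝ)) x = 0 := by simp [partialDeriv]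
  rw [h2, partialDeriv] at h0
  erw [h1] at h0
  rw [← h0]
  simp [partialDeriv]
  ring

end Implicit

section Numerators

variable (P : MvPolynomial (Fin (n + 1)) ℝ) (a : EuclideanSpace ℝ (Fin n)) (r : ℝ)

/-- The numerator of a second order partial derivative of a root `y` of `P`. -/
noncomputable def hessianNum (i j : Fin n) : MvPolynomial (Fin (n + 1)) ℝ :=
  -(pderiv i.castSucc (pderiv j.castSucc P) * pderiv (Fin.last n) P ^ 2 -
    pderiv (Fin.last n) (pderiv j.castSucc P) * pderiv i.castSucc P * pderiv (Fin.last n) P -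
    pderiv i.castSucc (pderiv (Fin.last n) P) * pderiv j.castSucc P * pderiv (Fin.last n) P +
    pderiv (Fin.last n) (pderiv (Fin.last n) P) * pderiv i.castSucc P * pderiv j.castSucc P)

/-- The polynomial `r² - ‖x - a‖²`. -/
noncomputable def ballPoly : MvPolynomial (Fin (n + 1)) ℝ :=
  C (r ^ 2) - ∑ i : Fin n, (X i.castSucc - C (a i)) ^ 2

/-- The common denominator of `penalty` and `penaltyGradient`. -/
noncomputable def penaltyDen : MvPolynomial (Fin (n + 1)) (Polynomial ℝ) :=
  C (Polynomial.X ^ 4) * map Polynomial.C (pderiv (Fin.last n) P ^ 4 * ballPoly a r ^ 2)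

/-- The numerator of `penaltyGradient`. -/
noncomputable def penaltyGradientNum (i : Fin n) :
    MvPolynomial (Fin (n + 1)) (Polynomial ℝ) :=
  C (2 * Polynomial.X ^ 2) * map Polynomial.C
      (ballPoly a r ^ 2 * ∑ j, -pderiv j.castSucc P * hessianNum P i j) +
    C 2 * (X (Fin.last n) - C Polynomial.X) * map Polynomial.C
      (-pderiv i.castSucc P * pderiv (Fin.last n) P ^ 3 * ballPoly a r ^ 2) +
    C (2 * Polynomial.X ^ 4) * map Polynomial.C
      ((X i.castSucc - C (a i)) * pderiv (Fin.last n) P ^ 4)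

/-- The numerator of `penalty`. -/
noncomputable def penaltyNum : MvPolynomial (Fin (n + 1)) (Polynomial ℝ) :=
  C (Polynomial.X ^ 4) * map Polynomial.C
      (ballPoly a r ^ 2 * pderiv (Fin.last n) P ^ 2 * ∑ j : Fin n, pderiv j.castSucc P ^ 2) +
    C (Polynomial.X ^ 2) * (X (Fin.last n) - C Polynomial.X) ^ 2 * map Polynomial.C
      (pderiv (Fin.last n) P ^ 4 * ballPoly a r ^ 2) +
    C (Polynomial.X ^ 6) * map Polynomial.C (pderiv (Fin.last n) P ^ 4 * ballPoly a r)

section Degree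

variable {σ R : Type*} [CommRing R] {A B : MvPolynomial σ R} {k l m : ℕ}

theorem totalDegree_mul_le_of_le (hA : A.totalDegree ≤ k) (hB : B.totalDegree ≤ l) :
    (A * B).totalDegree ≤ k + l :=
  (totalDegree_mul _ _).trans (add_le_add hA hB)

theorem totalDegree_add_le_of_le (hA : A.totalDegree ≤ k) (hB : B.totalDegree ≤ k) :
    (A + B).totalDegree ≤ k :=
  (totalDegree_add _ _).trans (max_le hA hB)

theorem totalDegree_sub_le_of_le (hA : A.totalDegree ≤ k) (hB : B.totalDegree ≤ k) :
    (A - B).totalDegree ≤ k :=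
  (totalDegree_sub _ _).trans (max_le hA hB)

theorem totalDegree_pow_le_of_le (hA : A.totalDegree ≤ k) (l : ℕ) :
    (A ^ l).totalDegree ≤ l * k :=
  (totalDegree_pow _ _).trans (by gcongr)

theorem totalDegree_C_mul_map_le {S : Type*} [CommRing S] {φ : R →+* S} {c : S}
    (hA : A.totalDegree ≤ k) : (C c * map φ A).totalDegree ≤ k :=
  by
  have h : (map φ A).totalDegree ≤ k := (Finset.sup_mono (support_map_subset φ A)).trans hA
  exact (totalDegree_mul _ _).trans (by simpa using h)

end Degree

variable {P} {d : ℕ}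

theorem totalDegree_pderiv_le_of_le {Q : MvPolynomial (Fin (n + 1)) ℝ} {e : ℕ}
    (hQ : Q.totalDegree ≤ e) (i : Fin (n + 1)) : (pderiv i Q).totalDegree ≤ e :=
  (totalDegree_pderiv_le i Q).trans (by omega)

theorem totalDegree_hessianNum_le (hd : P.totalDegree ≤ d) (i j : Fin n) :
    (hessianNum P i j).totalDegree ≤ 3 * (d - 1) := by
  have h (i) : (pderiv i P).totalDegree ≤ d - 1 := (totalDegree_pderiv_le i P).trans (by omega)
  have h2 (i j) : (pderiv i (pderiv j P)).totalDegree ≤ d - 1 :=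
    totalDegree_pderiv_le_of_le (h j) i
  have h3 (A B C : MvPolynomial (Fin (n + 1)) ℝ) (hA : A.totalDegree ≤ d - 1)
      (hB : B.totalDegree ≤ d - 1) (hC : C.totalDegree ≤ d - 1) :
      (A * B * C).totalDegree ≤ 3 * (d - 1) :=
    (totalDegree_mul_le_of_le (totalDegree_mul_le_of_le hA hB) hC).trans (by omega)
  rw [hessianNum, totalDegree_neg, pow_two, ← mul_assoc]
  exact totalDegree_add_le_of_le (totalDegree_sub_le_of_le (totalDegree_sub_le_of_le
    (h3 _ _ _ (h2 _ _) (h _) (h _)) (h3 _ _ _ (h2 _ _) (h _) (h _)))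
    (h3 _ _ _ (h2 _ _) (h _) (h _))) (h3 _ _ _ (h2 _ _) (h _) (h _))

theorem totalDegree_X_sub_C_le {σ R : Type*} [CommRing R] [Nontrivial R] (i : σ) (c : R) :
    (X i - C c : MvPolynomial σ R).totalDegree ≤ 1 :=
  totalDegree_sub_le_of_le (totalDegree_X i).le (by simp)

theorem totalDegree_ballPoly_le : (ballPoly a r).totalDegree ≤ 2 :=
  totalDegree_sub_le_of_le ((totalDegree_C _).le.trans (by simp)) <| totalDegree_finsetSum_le fun i _ =>
    totalDegree_pow_le_of_le (totalDegree_X_sub_C_le _ _) 2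

theorem totalDegree_penaltyDen_le (hd : P.totalDegree ≤ d) :
    (penaltyDen P a r).totalDegree ≤ 4 * (d - 1) + 4 := by
  have h (i) : (pderiv i P).totalDegree ≤ d - 1 := (totalDegree_pderiv_le i P).trans (by omega)
  exact totalDegree_C_mul_map_le (totalDegree_mul_le_of_le (totalDegree_pow_le_of_le (h _) 4)
    (totalDegree_pow_le_of_le (totalDegree_ballPoly_le a r) 2))

theorem totalDegree_penaltyGradientNum_le (hd : P.totalDegree ≤ d) (i : Fin n) :
    (penaltyGradientNum P a r i).totalDegree ≤ 4 * (d - 1) + 5 := by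
  have h (i) : (pderiv i P).totalDegree ≤ d - 1 := (totalDegree_pderiv_le i P).trans (by omega)
  have hn (i) : (-pderiv i P).totalDegree ≤ d - 1 := by rw [totalDegree_neg]; exact h i
  have hb := totalDegree_pow_le_of_le (totalDegree_ballPoly_le a r) 2
  refine totalDegree_add_le_of_le (totalDegree_add_le_of_le ?_ ?_) ?_
  · refine totalDegree_C_mul_map_le ((totalDegree_mul_le_of_le hb (totalDegree_finsetSum_le
      fun j _ => totalDegree_mul_le_of_le (hn j.castSucc)
        (totalDegree_hessianNum_le hd i j))).trans ?_)
    omega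
  · rw [mul_assoc, mul_comm (X _ - _), ← mul_assoc]
    refine (totalDegree_mul_le_of_le (totalDegree_C_mul_map_le (totalDegree_mul_le_of_le
      (totalDegree_mul_le_of_le (hn _) (totalDegree_pow_le_of_le (h _) 3)) hb))
      (totalDegree_X_sub_C_le _ _)).trans ?_
    omega
  · refine totalDegree_C_mul_map_le ((totalDegree_mul_le_of_le (totalDegree_X_sub_C_le _ _)
      (totalDegree_pow_le_of_le (h _) 4)).trans ?_)
    omega

theorem totalDegree_penaltyNum_le (hd : P.totalDegree ≤ d) :
    (penaltyNum P a r).totalDegree ≤ 4 * (d - 1) + 6 := by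
  have h (i) : (pderiv i P).totalDegree ≤ d - 1 := (totalDegree_pderiv_le i P).trans (by omega)
  have hb := totalDegree_ballPoly_le a r
  have hb2 := totalDegree_pow_le_of_le hb 2
  refine totalDegree_add_le_of_le (totalDegree_add_le_of_le ?_ ?_) ?_
  · refine totalDegree_C_mul_map_le ((totalDegree_mul_le_of_le (totalDegree_mul_le_of_le hb2
      (totalDegree_pow_le_of_le (h _) 2)) (totalDegree_finsetSum_le fun j _ =>
        totalDegree_pow_le_of_le (h _) 2)).trans ?_)
    omega
  · rw [mul_assoc, mul_comm ((X _ - _) ^ 2), ← mul_assoc]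
    refine (totalDegree_mul_le_of_le (totalDegree_C_mul_map_le (totalDegree_mul_le_of_le
      (totalDegree_pow_le_of_le (h _) 4) hb2))
      (totalDegree_pow_le_of_le (totalDegree_X_sub_C_le _ _) 2)).trans ?_
    omega
  · refine totalDegree_C_mul_map_le ((totalDegree_mul_le_of_le
      (totalDegree_pow_le_of_le (h _) 4) hb).trans ?_)
    omega

/-- Evaluation at the point `(t, x, f x)`. -/
noncomputable def graphEval (f : EuclideanSpace ℝ (Fin n) → ℝ) (t : ℝ)
    (x : EuclideanSpace ℝ (Fin n)) : MvPolynomial (Fin (n + 1)) (Polynomial ℝ) →+* ℝ :=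
  eval₂Hom (Polynomial.evalRingHom t) (graphPoint f x)

theorem graphEval_C (t : ℝ) (q : Polynomial ℝ) : graphEval f t x (C q) = q.eval t := by
  simp [graphEval]

theorem graphEval_map (t : ℝ) (Q : MvPolynomial (Fin (n + 1)) ℝ) :
    graphEval f t x (map Polynomial.C Q) = eval (graphPoint f x) Q := by
  rw [graphEval, coe_eval₂Hom, eval₂_map, eval]
  congr 1
  ext q
  simp

theorem graphEval_X_castSucc (t : ℝ) (i : Fin n) : graphEval f t x (X i.castSucc) = x i := by
  simp [graphEval, graphPoint]

theorem graphEval_X_last (t : ℝ) : graphEval f t x (X (Fin.last n)) = f x := by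
  simp [graphEval, graphPoint]

theorem eval_ballPoly : eval (graphPoint f x) (ballPoly a r) = r ^ 2 - ‖x - a‖ ^ 2 := by
  rw [ballPoly, EuclideanSpace.real_norm_sq_eq]
  simp [graphPoint]

theorem ball_sub_pos {a x : EuclideanSpace ℝ (Fin n)} {r : ℝ} (hx : x ∈ ball a r) :
    0 < r ^ 2 - ‖x - a‖ ^ 2 := by
  rw [mem_ball_iff_norm] at hx
  nlinarith [norm_nonneg (x - a)]

variable {a r}

theorem graphEval_penaltyDen (t : ℝ) : graphEval f t x (penaltyDen P a r) =
    t ^ 4 * (eval (graphPoint f x) (pderiv (Fin.last n) P) ^ 4 * (r ^ 2 - ‖x - a‖ ^ 2) ^ 2) := by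
  simp [penaltyDen, graphEval_C, graphEval_map, eval_ballPoly, -map_mul, map_mul (graphEval f t x),
    map_mul (eval _)]

theorem graphEval_penaltyNum (hf : AnalyticOnNhd ℝ f (ball a r))
    (hPf : ∀ x ∈ ball a r, eval (graphPoint f x) P = 0) {t : ℝ} (ht : t ≠ 0) (hx : x ∈ ball a r) :
    penalty f a r t x * graphEval f t x (penaltyDen P a r) =
      graphEval f t x (penaltyNum P a r) := by
  have hρ := (ball_sub_pos hx).ne'
  have h1 (j : Fin n) : eval (graphPoint f x) (pderiv j.castSucc P) =
      -(eval (graphPoint f x) (pderiv (Fin.last n) P) * partialDeriv j f x) :=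
    eq_neg_of_add_eq_zero_left (eval_pderiv_add_eq_zero hf hPf j hx)
  rw [graphEval_penaltyDen, penaltyNum, penalty]
  simp only [map_add (graphEval f t x), map_mul (graphEval f t x), map_pow (graphEval f t x),
    map_sub (graphEval f t x), graphEval_C, graphEval_map, map_mul (eval (graphPoint f x)),
    map_pow (eval (graphPoint f x)), map_sum (eval (graphPoint f x)), eval_ballPoly,
    graphEval_X_last, h1, Polynomial.eval_pow, Polynomial.eval_X, neg_sq, mul_pow,
    ← Finset.mul_sum]
  field_simp

theorem graphEval_penaltyGradientNum (hf : AnalyticOnNhd ℝ f (ball a r))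
    (hPf : ∀ x ∈ ball a r, eval (graphPoint f x) P = 0) {t : ℝ} (ht : t ≠ 0) (hx : x ∈ ball a r)
    (i : Fin n) :
    penaltyGradient f a r t i x * graphEval f t x (penaltyDen P a r) =
      graphEval f t x (penaltyGradientNum P a r i) := by
  have hρ := (ball_sub_pos hx).ne'
  have h1 (j : Fin n) : eval (graphPoint f x) (pderiv j.castSucc P) =
      -(eval (graphPoint f x) (pderiv (Fin.last n) P) * partialDeriv j f x) :=
    eq_neg_of_add_eq_zero_left (eval_pderiv_add_eq_zero hf hPf j hx)
  have h2 (j : Fin n) : eval (graphPoint f x) (hessianNum P i j) =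
      eval (graphPoint f x) (pderiv (Fin.last n) P) ^ 3 *
        partialDeriv i (partialDeriv j f) x := by
    have := eval_pderiv_pderiv_add_eq_zero hf hPf i j hx
    simp only [hessianNum, map_neg, map_add, map_sub, map_mul, map_pow, h1]
    linear_combination (-eval (graphPoint f x) (pderiv (Fin.last n) P) ^ 2) * this
  have h3 : ∑ j, - -(eval (graphPoint f x) (pderiv (Fin.last n) P) * partialDeriv j f x) *
      (eval (graphPoint f x) (pderiv (Fin.last n) P) ^ 3 * partialDeriv i (partialDeriv j f) x) =
      eval (graphPoint f x) (pderiv (Fin.last n) P) ^ 4 *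
        ∑ j, partialDeriv j f x * partialDeriv i (partialDeriv j f) x := by
    rw [Finset.mul_sum]
    exact Finset.sum_congr rfl fun j _ => by ring
  rw [graphEval_penaltyDen, penaltyGradientNum, penaltyGradient]
  simp only [map_add (graphEval f t x), map_mul (graphEval f t x),
    map_sub (graphEval f t x), graphEval_C, graphEval_map, map_mul (eval (graphPoint f x)),
    map_pow (eval (graphPoint f x)), map_sum (eval (graphPoint f x)), eval_ballPoly, map_neg,
    graphEval_X_last, h1, h2, h3, Polynomial.eval_pow, Polynomial.eval_X, Polynomial.eval_mul,
    Polynomial.eval_ofNat, map_sub (eval (graphPoint f x)), eval_C, eval_X]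
  rw [show graphPoint f x i.castSucc = x i by simp [graphPoint]]
  field_simp

end Numerators

section Penalty

open Polynomial in
theorem continuousAt_eval₂_evalEvalRingHom {E ι : Type*} [TopologicalSpace E]
    (A : MvPolynomial ι ℝ[X][X]) (t : ℝ) {m : E → ℝ} {g : ι → E → ℝ} {x : E}
    (hm : ContinuousAt m x) (hg : ∀ i, ContinuousAt (g i) x) :
    ContinuousAt (fun x => A.eval₂ (evalEvalRingHom t (m x)) fun i => g i x) x := by
  simp only [MvPolynomial.eval₂_eq, coe_evalEvalRingHom, ← map_evalRingHom_eval]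
  refine tendsto_finsetSum _ fun s _ => Tendsto.mul ?_ ?_
  · exact ContinuousAt.comp (f := m) (Polynomial.continuous _).continuousAt hm
  · exact tendsto_finsetProd _ fun i _ => (hg i).pow _

variable {a : EuclideanSpace ℝ (Fin n)} {r : ℝ} {P : MvPolynomial (Fin (n + 1)) ℝ} {d : ℕ}

theorem continuousAt_penalty (hf : AnalyticOnNhd ℝ f (ball a r)) (t : ℝ) (hx : x ∈ ball a r) :
    ContinuousAt (penalty f a r t) x := by
  have hρ := (ball_sub_pos hx).ne'
  have h1 (j : Fin n) := ((hf x hx).partialDeriv j).continuousAt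
  have h2 := (hf x hx).continuousAt
  unfold penalty
  refine ((tendsto_finsetSum _ fun j _ => (h1 j).pow 2).add
    (((h2.sub continuousAt_const).pow 2).div_const _)).add ?_
  exact continuousAt_const.div (by fun_prop) hρ

theorem continuousAt_penaltyGradient (hf : AnalyticOnNhd ℝ f (ball a r)) (t : ℝ)
    (hx : x ∈ ball a r) (i : Fin n) : ContinuousAt (penaltyGradient f a r t i) x := by
  have hρ := (ball_sub_pos hx).ne'
  have h1 (j : Fin n) := ((hf x hx).partialDeriv j).continuousAt
  have h3 (j : Fin n) := (((hf x hx).partialDeriv j).partialDeriv i).continuousAt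
  have h2 := (hf x hx).continuousAt
  unfold penaltyGradient
  refine (((Tendsto.const_mul 2 (tendsto_finsetSum _ fun j _ => (h1 j).mul (h3 j))).div_const
    _).add ((((h2.sub continuousAt_const).const_mul 2).mul (h1 i)).div_const _)).add ?_
  exact ContinuousAt.div (by fun_prop) (by fun_prop) (pow_ne_zero 2 hρ)

theorem mul_pow_le (hd : 2 ≤ d) :
    d * (4 * d + 2) ^ n ≤ (2 * d - 1) ^ (3 * n + 1) := by
  obtain ⟨k, rfl⟩ := Nat.exists_eq_add_of_le hd
  have h1 : 2 * (2 + k) - 1 = 2 * k + 3 := by omega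
  rw [h1, pow_succ, pow_mul, mul_comm]
  refine Nat.mul_le_mul (Nat.pow_le_pow_left ?_ _) (by omega)
  nlinarith [sq_nonneg k, Nat.zero_le (k ^ 3)]

open Polynomial in
theorem exists_penalty_relation (hf : AnalyticOnNhd ℝ f (ball a r)) (hP : P ≠ 0) (hd : 2 ≤ d)
    (hPd : P.totalDegree ≤ d) (hPf : ∀ x ∈ ball a r, eval (graphPoint f x) P = 0)
    (hdense : ∀ x ∈ ball a r, x ∈ closure
        {x ∈ ball a r | eval (graphPoint f x) (pderiv (Fin.last n) P) ≠ 0})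
    {M : MvPolynomial (Fin (n + 1)) ℝ[X]} (hM : M.totalDegree ≤ 4 * d + 2)
    {m : ℝ → EuclideanSpace ℝ (Fin n) → ℝ}
    (hmc : ∀ t, ∀ x ∈ ball a r, ContinuousAt (m t) x)
    (hmM : ∀ t ≠ 0, ∀ x ∈ ball a r,
      m t x * graphEval f t x (penaltyDen P a r) = graphEval f t x M) :
    ∃ A : MvPolynomial (Fin n) ℝ[X][X], A ≠ 0 ∧
      (∀ c : Fin n → ℝ[X], (MvPolynomial.eval (fun i => Polynomial.C (c i)) A).natDegree ≤
        (2 * d - 1) ^ (3 * n + 1)) ∧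
      ∀ t ≠ 0, ∀ x ∈ ball a r, A.eval₂ (evalEvalRingHom t (m t x))
        (fun i => penaltyGradient f a r t i x) = 0 := by
  obtain ⟨A, hA, hAd, hrel⟩ := exists_relation ℝ (MvPolynomial.map (Polynomial.C) P)
    (fun h => hP (MvPolynomial.map_injective _ Polynomial.C_injective (h.trans (map_zero _).symm)))
    ((Finset.sup_mono (MvPolynomial.support_map_subset _ P)).trans hPd) (penaltyGradientNum P a r) M
    (penaltyDen P a r)
    (fun i => (totalDegree_penaltyGradientNum_le a r hPd i).trans (by omega)) hM
    ((totalDegree_penaltyDen_le a r hPd).trans (by omega)) (by omega) (mul_pow_le hd)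
  refine ⟨A, hA, hAd, fun t ht x hx => ?_⟩
  have hcont := continuousAt_eval₂_evalEvalRingHom A t (hmc t x hx)
    fun i => continuousAt_penaltyGradient hf t hx i
  have hmem := hcont.continuousWithinAt.mem_closure_image (hdense x hx)
  have hsub : (fun x => A.eval₂ (evalEvalRingHom t (m t x)) fun i => penaltyGradient f a r t i x) ''
      {x ∈ ball a r | MvPolynomial.eval (graphPoint f x) (pderiv (Fin.last n) P) ≠ 0} ⊆ {0} := by
    rintro _ ⟨y, ⟨hy, hy0⟩, rfl⟩
    have hW : graphEval f t y (penaltyDen P a r) ≠ 0 := by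
      rw [graphEval_penaltyDen]
      exact mul_ne_zero (pow_ne_zero _ ht)
        (mul_ne_zero (pow_ne_zero _ hy0) (pow_ne_zero _ (ball_sub_pos hy).ne'))
    have h1 := hrel (graphEval f t y) ((graphEval_map t P).trans (hPf y hy)) hW
    have e1 : (graphEval f t y).comp C = evalRingHom t := by
      ext q <;> simp [graphEval_C]
    have e2 := (eq_div_iff hW).2 (hmM t ht y hy)
    have e3 (i) := (eq_div_iff hW).2 (graphEval_penaltyGradientNum hf hPf ht hy i)
    rw [e1, ← e2, ← evalEvalRingHom_eq] at h1
    simp only [← e3] at h1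
    exact h1
  simpa using closure_mono hsub hmem

open Polynomial in
theorem eval_evalEval_of_eval₂ {A : MvPolynomial (Fin n) ℝ[X][X]} {t s : ℝ} {c : Fin n → ℝ} :
    (MvPolynomial.eval (fun i => Polynomial.C (Polynomial.C (c i))) A).evalEval t s =
      A.eval₂ (evalEvalRingHom t s) c := by
  rw [← coe_evalEvalRingHom, MvPolynomial.eval, coe_eval₂Hom, MvPolynomial.eval₂_comp_left]
  congr 1
  ext i
  simp

/-- Finitely many nonzero polynomials have a common real non-root. -/
theorem exists_forall_eval_ne_zero {ι κ R : Type*} [Finite ι] [Fintype κ] [CommRing R] [IsDomain R]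
    {φ : ℝ → R} (hφ : Function.Injective φ) (A : κ → MvPolynomial ι R) (hA : ∀ k, A k ≠ 0) :
    ∃ c : ι → ℝ, ∀ k, eval (fun i => φ (c i)) (A k) ≠ 0 := by
  by_contra! h
  refine Finset.prod_ne_zero_iff.2 (fun k (_ : k ∈ Finset.univ) => hA k) ?_
  refine MvPolynomial.funext_set (fun _ => Set.range φ)
    (fun _ => Set.infinite_range_of_injective hφ) fun y hy => ?_
  choose c hc using fun i => hy i trivial
  obtain ⟨k, hk⟩ := h c
  rw [funext hc] at hk
  rw [map_prod, map_zero]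
  exact Finset.prod_eq_zero (Finset.mem_univ k) hk

theorem exists_forall_add_barrier_le {g : EuclideanSpace ℝ (Fin n) → ℝ} (hr : 0 < r)
    (hg : ContinuousOn g (ball a r)) {K : ℝ} (hK : ∀ x ∈ ball a r, K ≤ g x) :
    ∃ z ∈ ball a r, ∀ x ∈ ball a r,
      g z + 1 / (r ^ 2 - ‖z - a‖ ^ 2) ≤ g x + 1 / (r ^ 2 - ‖x - a‖ ^ 2) := by
  set B := |g a - K| + 1 / r ^ 2 with hB
  have hBr : 1 / r ^ 2 ≤ B := le_add_of_nonneg_left (abs_nonneg _)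
  have hB0 : 0 < B := lt_of_lt_of_le (by positivity) hBr
  set S := {x : EuclideanSpace ℝ (Fin n) | 1 / B ≤ r ^ 2 - ‖x - a‖ ^ 2} with hS
  have hSb : S ⊆ ball a r := by
    intro x hx
    have h1 : 0 < 1 / B := by positivity
    rw [mem_ball_iff_norm]
    refine lt_of_pow_lt_pow_left₀ 2 hr.le ?_
    have := h1.trans_le hx
    linarith
  have hScl : IsClosed S := isClosed_le continuous_const (by fun_prop)
  have hSc : IsCompact S := isCompact_of_isClosed_isBounded hScl (isBounded_ball.subset hSb)
  have haS : a ∈ S := by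
    have : 1 / B ≤ r ^ 2 := by
      rw [div_le_iff₀ hB0]
      rw [div_le_iff₀ (by positivity)] at hBr
      linarith
    simpa [hS] using this
  have hcont : ContinuousOn (fun x => g x + 1 / (r ^ 2 - ‖x - a‖ ^ 2)) S :=
    (hg.mono hSb).add (ContinuousOn.div (by fun_prop) (by fun_prop)
      fun x hx => (ball_sub_pos (hSb hx)).ne')
  obtain ⟨z, hz, hmin⟩ := hSc.exists_isMinOn ⟨a, haS⟩ hcont
  refine ⟨z, hSb hz, fun x hx => ?_⟩
  by_cases hxS : x ∈ S
  · exact hmin hxS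
  · refine (hmin haS).trans ?_
    rw [hS, Set.mem_ofPred_eq, not_le, lt_div_iff₀ hB0, mul_comm, ← lt_div_iff₀ (ball_sub_pos hx)]
      at hxS
    have h1 := hK x hx
    have h2 := le_abs_self (g a - K)
    simp only [sub_self, norm_zero, ne_eq, OfNat.ofNat_ne_zero, not_false_eq_true, zero_pow,
      sub_zero]
    linarith

theorem partialDeriv_penalty (hf : AnalyticOnNhd ℝ f (ball a r)) {t : ℝ} (ht : t ≠ 0)
    (c : EuclideanSpace ℝ (Fin n)) (hx : x ∈ ball a r) (i : Fin n) :
    partialDeriv i (fun x => penalty f a r t x / t ^ 2 - inner ℝ c x) x =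
      penaltyGradient f a r t i x - c i := by
  have hρ := (ball_sub_pos hx).ne'
  have h1 (j : Fin n) := ((hf x hx).partialDeriv j).differentiableAt.hasFDerivAt
  have h2 := (hf x hx).differentiableAt.hasFDerivAt
  have h3 : HasFDerivAt (fun x => r ^ 2 - ‖x - a‖ ^ 2) (-(2 • innerSL ℝ (x - a))) x := by
    simpa using (((hasFDerivAt_id x).sub_const a).norm_sq).const_sub (r ^ 2)
  have h4 := (HasFDerivAt.fun_sum fun j (_ : j ∈ Finset.univ) => (h1 j).pow 2)
  have h5 := ((h2.sub_const t).pow 2).mul_const (t ^ 2)⁻¹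
  have h6 := (((hasDerivAt_inv hρ).comp_hasFDerivAt x h3).const_mul (t ^ 2))
  have h7 := (((h4.add h5).add h6).mul_const (t ^ 2)⁻¹).sub (innerSL ℝ c).hasFDerivAt
  have h8 : (fun x => penalty f a r t x / t ^ 2 - inner ℝ c x) =ᶠ[𝓝 x] _ :=
    .of_forall fun y => rfl
  rw [partialDeriv, (h7.congr_of_eventuallyEq h8).fderiv]
  have h9 (g : EuclideanSpace ℝ (Fin n) → ℝ) :
      fderiv ℝ g x (EuclideanSpace.single i 1) = partialDeriv i g x := rfl
  simp [penaltyGradient, h9, EuclideanSpace.inner_single_right, mul_assoc, ← Finset.mul_sum]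
  field_simp

theorem exists_critical_point (hr : 0 < r) (hf : AnalyticOnNhd ℝ f (ball a r)) {t : ℝ}
    (ht : t ≠ 0) (c : EuclideanSpace ℝ (Fin n)) :
    ∃ z ∈ ball a r, (∀ i, penaltyGradient f a r t i z = c i) ∧
      ∀ x ∈ ball a r, penalty f a r t z / t ^ 2 - inner ℝ c z ≤
        penalty f a r t x / t ^ 2 - inner ℝ c x := by
  have hsplit : ∀ x, penalty f a r t x / t ^ 2 - inner ℝ c x =
      ((∑ j, partialDeriv j f x ^ 2 + (f x - t) ^ 2 / t ^ 2) / t ^ 2 - inner ℝ c x) +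
        1 / (r ^ 2 - ‖x - a‖ ^ 2) := by
    intro x
    rw [penalty, add_div _ (t ^ 2 / _), div_right_comm (t ^ 2), div_self (pow_ne_zero 2 ht)]
    ring
  obtain ⟨z, hz, hmin⟩ := exists_forall_add_barrier_le (a := a)
    (g := fun x => (∑ j, partialDeriv j f x ^ 2 + (f x - t) ^ 2 / t ^ 2) / t ^ 2 - inner ℝ c x)
    hr (K := -(‖c‖ * (‖a‖ + r))) (fun x hx => by
      have h1 (j : Fin n) := ((hf x hx).partialDeriv j).continuousAt
      have h2 := (hf x hx).continuousAt
      refine ContinuousAt.continuousWithinAt ?_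
      refine (((tendsto_finsetSum _ fun j _ => (h1 j).pow 2).add
        (((h2.sub continuousAt_const).pow 2).div_const _)).div_const _).sub ?_
      exact (innerSL ℝ c).continuous.continuousAt) (fun x hx => by
      have h1 : inner ℝ c x ≤ ‖c‖ * (‖a‖ + r) := by
        refine (real_inner_le_norm c x).trans ?_
        gcongr
        rw [mem_ball_iff_norm] at hx
        have := norm_le_norm_add_norm_sub' x a
        linarith
      have h2 : 0 ≤ (∑ j, partialDeriv j f x ^ 2 + (f x - t) ^ 2 / t ^ 2) / t ^ 2 := by
        have := Finset.sum_nonneg fun j (_ : j ∈ Finset.univ) => sq_nonneg (partialDeriv j f x)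
        positivity
      linarith)
  simp only [← hsplit] at hmin
  refine ⟨z, hz, fun i => ?_, hmin⟩
  have hloc : IsLocalMin (fun x => penalty f a r t x / t ^ 2 - inner ℝ c x) z := by
    filter_upwards [isOpen_ball.mem_nhds hz] with x hx using hmin x hx
  rw [← sub_eq_zero, ← partialDeriv_penalty hf ht c hz, partialDeriv, hloc.fderiv_eq_zero]
  rfl

theorem sum_partialDeriv_sq : ∑ j, partialDeriv j f x ^ 2 = ‖fderiv ℝ f x‖ ^ 2 := by
  rw [← norm_gradient_eq, EuclideanSpace.real_norm_sq_eq]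
  refine Finset.sum_congr rfl fun j _ => ?_
  congr 1
  rw [partialDeriv, ← InnerProductSpace.toDual_symm_apply, real_inner_comm,
    EuclideanSpace.inner_single_left]
  simp [gradient]

end Penalty

end Graph

section ValuationLemmas

open ArchimedeanClass Polynomial

variable {K : Type*} [Field K] [LinearOrder K] [IsStrictOrderedRing K]

theorem mk_zpow_pos {t : K} (ht : 0 < mk t) {i : ℤ} (hi : 0 < i) :
    0 < mk (t ^ i) := by
  lift i to ℕ using hi.le
  rw [zpow_natCast, mk_pow]
  exact nsmul_pos ht (by omega)

theorem mk_eq_zero_of_pow {a : K} {n : ℕ} (hn : n ≠ 0) (h : mk (a ^ n) = 0) : mk a = 0 := by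
  rw [mk_pow] at h
  rcases lt_trichotomy (mk a) 0 with h1 | h1 | h1
  · have h2 : 0 < mk (a⁻¹ ^ n) := by
      rw [mk_pow]
      refine nsmul_pos ?_ (by omega)
      have ha : a ≠ 0 := by rintro rfl; simp at h1
      by_contra h3
      push Not at h3
      have h4 : mk a + mk a⁻¹ = 0 := by rw [← mk_mul, mul_inv_cancel₀ ha, mk_one]
      have h5 : mk a + mk a⁻¹ ≤ mk a + 0 := by gcongr
      rw [h4, add_zero] at h5
      exact absurd h1 (not_lt.2 h5)
    have ha : a ≠ 0 := by rintro rfl; simp at h1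
    have h4 : mk (a^n) + mk (a⁻¹^n) = 0 := by
      rw [← mk_mul, ← mul_pow, mul_inv_cancel₀ ha, one_pow, mk_one]
    rw [mk_pow, h, zero_add] at h4
    exact absurd h4 h2.ne'
  · exact h1
  · exact absurd h (nsmul_pos h1 (by omega)).ne'

theorem exists_mk_eq_of_sum_eq_zero {ι : Type*} [DecidableEq ι] (s : Finset ι) (a : ι → K)
    (h : ∑ i ∈ s, a i = 0) (hne : ∃ i ∈ s, a i ≠ 0) :
    ∃ i ∈ s, ∃ j ∈ s, i ≠ j ∧ a i ≠ 0 ∧ a j ≠ 0 ∧ mk (a i) = mk (a j) := by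
  obtain ⟨k, hk, hk0⟩ := hne
  obtain ⟨i, hi, hmin⟩ := s.exists_min_image (fun i => mk (a i)) ⟨k, hk⟩
  have hi0 : a i ≠ 0 := by
    intro h0
    have := hmin k hk
    simp [h0] at this
    exact hk0 this
  by_contra! hcon
  have hlt : ∀ j ∈ s.erase i, mk (a i) < addValuation K (a j) := by
    intro j hj
    obtain ⟨hji, hj⟩ := Finset.mem_erase.1 hj
    rw [addValuation_apply]
    refine lt_of_le_of_ne (hmin j hj) ?_
    by_cases hj0 : a j = 0
    · simpa [hj0] using hi0
    · exact hcon i hi j hj (Ne.symm hji) hi0 hj0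
  have h1 := (addValuation K).map_lt_sum (by simpa using hi0) hlt
  rw [addValuation_apply] at h1
  have h2 : ∑ j ∈ s.erase i, a j = - a i := by
    rw [← Finset.add_sum_erase s a hi] at h
    linear_combination h
  rw [h2, mk_neg] at h1
  exact lt_irrefl _ h1

/-- A Newton polygon argument: a root of a polynomial whose coefficients have the size of an
integral power of `t` has a power with the same property. -/
theorem exists_mk_pow_eq_zpow {t : K} (ht0 : t ≠ 0) {Δ : ℕ} {a : ℕ → K} {x : K}
    (hx : x ≠ 0) (ha : ∀ j ≤ Δ, a j ≠ 0 → ∃ i : ℤ, mk (a j) = mk (t ^ i))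
    (hne : ∃ j ≤ Δ, a j ≠ 0) (hsum : ∑ j ∈ Finset.range (Δ + 1), a j * x ^ j = 0) :
    ∃ j, 1 ≤ j ∧ j ≤ Δ ∧ ∃ i : ℤ, mk (x ^ j) = mk (t ^ i) := by
  obtain ⟨k, hk, hk0⟩ := hne
  obtain ⟨i, hi, j, hj, hij, hi0, hj0, hmk⟩ := exists_mk_eq_of_sum_eq_zero _ _ hsum
    ⟨k, by simpa [Nat.lt_succ_iff] using hk, mul_ne_zero hk0 (pow_ne_zero _ hx)⟩
  have main : ∀ i ∈ Finset.range (Δ + 1), ∀ j ∈ Finset.range (Δ + 1), i < j → a i ≠ 0 → a j ≠ 0 →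
      mk (a i * x ^ i) = mk (a j * x ^ j) →
      ∃ j, 1 ≤ j ∧ j ≤ Δ ∧ ∃ i : ℤ, mk (x ^ j) = mk (t ^ i) := by
    intro i hi j hj hlt hi0 hj0 h
    simp only [Finset.mem_range] at hi hj
    obtain ⟨p, hp⟩ := ha i (by omega) hi0
    obtain ⟨q, hq⟩ := ha j (by omega) hj0
    refine ⟨j - i, by omega, by omega, p - q, ?_⟩
    have hxj : x ^ j = x ^ (j - i) * x ^ i := by rw [← pow_add]; congr 1; omega
    have htp : t ^ p = t ^ q * t ^ (p - q) := by rw [← zpow_add₀ ht0]; congr 1; ring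
    rw [mk_mul, mk_mul, hp, hq, hxj, htp, mk_mul, mk_mul] at h
    have h1 : mk (t ^ q) + mk (x ^ i) ≠ ⊤ := by
      rw [← mk_mul, Ne, mk_eq_top_iff]
      exact mul_ne_zero (zpow_ne_zero q ht0) (pow_ne_zero i hx)
    refine (add_left_cancel_of_ne_top h1 ?_).symm
    rw [add_right_comm, h, add_assoc, add_comm (mk (x ^ i))]
  rcases lt_or_gt_of_ne hij with hlt | hlt
  · exact main i hi j hj hlt (left_ne_zero_of_mul hi0) (left_ne_zero_of_mul hj0) hmk
  · exact main j hj i hi hlt (left_ne_zero_of_mul hj0) (left_ne_zero_of_mul hi0) hmk.symm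

variable [Algebra ℝ K]

theorem mk_algebraMap_real {r : ℝ} (hr : r ≠ 0) : mk (algebraMap ℝ K r) = 0 := by
  have hmono : Monotone (algebraMap ℝ K) := by
    intro a b hab
    have h : algebraMap ℝ K b - algebraMap ℝ K a = (algebraMap ℝ K (Real.sqrt (b - a))) ^ 2 := by
      rw [← map_pow, Real.sq_sqrt (sub_nonneg.2 hab), map_sub]
    nlinarith [sq_nonneg (algebraMap ℝ K (Real.sqrt (b - a)))]
  exact mk_map_of_archimedean' (⟨algebraMap ℝ K, hmono⟩ : ℝ →+*o K) hr

theorem mk_algebraMap_real_nonneg (r : ℝ) : 0 ≤ mk (algebraMap ℝ K r) := by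
  rcases eq_or_ne r 0 with rfl | hr
  · simp
  · exact (mk_algebraMap_real hr).ge

theorem exists_mk_sub_real_pos {y : K} (hy : 0 ≤ mk y) :
    ∃ r : ℝ, 0 < mk (y - algebraMap ℝ K r) := by
  have hmono : Monotone (algebraMap ℝ K) := by
    intro a b hab
    have h : algebraMap ℝ K b - algebraMap ℝ K a = (algebraMap ℝ K (Real.sqrt (b - a))) ^ 2 := by
      rw [← map_pow, Real.sq_sqrt (sub_nonneg.2 hab), map_sub]
    nlinarith [sq_nonneg (algebraMap ℝ K (Real.sqrt (b - a)))]
  exact ⟨stdPart y, mk_sub_stdPart_pos (⟨algebraMap ℝ K, hmono⟩ : ℝ →+*o K) hy⟩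

theorem mk_aeval_nonneg {t : K} (ht : 0 ≤ mk t) (p : ℝ[X]) : 0 ≤ mk (aeval t p) := by
  induction p using Polynomial.induction_on' with
  | add p q hp hq => rw [map_add]; exact (le_min hp hq).trans (min_le_mk_add _ _)
  | monomial n a =>
    rw [aeval_monomial, mk_mul, mk_pow]
    exact add_nonneg (mk_algebraMap_real_nonneg a) (nsmul_nonneg ht n)

theorem exists_mk_aeval_eq {t : K} (ht : 0 < mk t) {p : ℝ[X]} (hp : p ≠ 0) :
    ∃ n : ℕ, mk (aeval t p) = mk (t ^ n) := by
  obtain ⟨q, hq, hdvd⟩ := Polynomial.exists_eq_pow_rootMultiplicity_mul_and_not_dvd p hp 0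
  refine ⟨rootMultiplicity 0 p, ?_⟩
  set m := rootMultiplicity 0 p
  rw [hq]
  simp only [C_0, sub_zero, map_mul, map_pow, aeval_X, mk_mul] at hdvd ⊢
  rw [X_dvd_iff] at hdvd
  have h0 : mk (aeval t q) = 0 := by
    rw [← divX_mul_X_add q, map_add, map_mul, aeval_X, aeval_C]
    rw [mk_add_eq_mk_right, mk_algebraMap_real hdvd]
    rw [mk_algebraMap_real hdvd, mk_mul]
    exact ht.trans_le (le_add_of_nonneg_left (mk_aeval_nonneg ht.le _))
  rw [h0, add_zero]

theorem aeval_ne_zero_of_mk_pos {t : K} (ht0 : t ≠ 0) (ht : 0 < mk t) {p : ℝ[X]} (hp : p ≠ 0) :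
    aeval t p ≠ 0 := by
  obtain ⟨n, hn⟩ := exists_mk_aeval_eq ht hp
  intro h
  rw [h, mk_zero, eq_comm, mk_eq_top_iff] at hn
  exact pow_ne_zero n ht0 hn

open IntermediateField in
theorem exists_mk_eq_of_mem_adjoin {t : K} (ht0 : t ≠ 0) (ht : 0 < mk t) {y : K} (hy0 : y ≠ 0)
    (hy : y ∈ IntermediateField.adjoin ℝ {t}) : ∃ i : ℤ, mk y = mk (t ^ i) := by
  obtain ⟨p, q, rfl⟩ := (IntermediateField.mem_adjoin_simple_iff ℝ y).1 hy
  obtain ⟨hp, hq⟩ := div_ne_zero_iff.1 hy0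
  obtain ⟨m, hm⟩ := exists_mk_aeval_eq ht (p := p) (by rintro rfl; simp at hp)
  obtain ⟨n, hn⟩ := exists_mk_aeval_eq ht (p := q) (by rintro rfl; simp at hq)
  refine ⟨m - n, ?_⟩
  rw [mk_div, hm, hn, ← mk_div, zpow_sub₀ ht0, zpow_natCast, zpow_natCast]

/-- If the values of `F` are integral multiples of that of `t`, then the values of a finite
extension of `F` have bounded denominators. -/
theorem exists_mk_pow_eq_of_finiteDimensional {t : K} (ht0 : t ≠ 0) {F : IntermediateField ℝ K}
    (hF : ∀ y ∈ F, y ≠ 0 → ∃ i : ℤ, mk y = mk (t ^ i))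
    (L : IntermediateField F K) [FiniteDimensional F L] :
    ∃ N : ℕ, N ≠ 0 ∧ ∀ y ∈ L, y ≠ 0 → ∃ i : ℤ, mk (y ^ N) = mk (t ^ i) := by
  set m := Module.finrank F L
  refine ⟨m.factorial, Nat.factorial_ne_zero _, fun y hy hy0 => ?_⟩
  set y' : L := ⟨y, hy⟩
  have hint : IsIntegral F y' := IsIntegral.of_finite F y'
  have : Module.Free F L := Module.Free.of_divisionRing F L
  have hdeg : (minpoly F y').natDegree ≤ m := minpoly.natDegree_le y'
  have hroot : aeval y (minpoly F y') = 0 := by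
    have := congrArg (algebraMap L K) (minpoly.aeval F y')
    rw [map_zero, ← aeval_algebraMap_apply] at this
    exact this
  obtain ⟨j, hj1, hjm, i, hi⟩ := exists_mk_pow_eq_zpow (t := t) ht0 (Δ := m) (x := y)
    (a := fun j => algebraMap F K ((minpoly F y').coeff j)) hy0
    (fun j _ hj => hF _ (SetLike.coe_mem _) hj)
    ⟨(minpoly F y').natDegree, hdeg, by
      simp [minpoly.monic hint]⟩
    (by
      rw [aeval_eq_sum_range' (Nat.lt_succ_of_le hdeg)] at hroot
      simpa [Algebra.smul_def] using hroot)
  obtain ⟨c, hc⟩ := Nat.dvd_factorial (by omega) hjm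
  refine ⟨i * c, ?_⟩
  rw [hc, pow_mul, mk_pow, hi, ← mk_pow, zpow_mul, zpow_natCast]

/-- In a finite extension of `ℝ(t)`, the value group is generated by a positive element, and every
bounded element is a polynomial in a uniformizer to any prescribed precision. -/
theorem exists_uniformizer {t : K} (ht0 : t ≠ 0) (ht : 0 < mk t)
    (L : IntermediateField (IntermediateField.adjoin ℝ {t}) K)
    [FiniteDimensional (IntermediateField.adjoin ℝ {t}) L] :
    ∃ π : K, π ∈ L ∧ π ≠ 0 ∧ 0 < mk π ∧ ∀ y ∈ L, y ≠ 0 → ∃ m : ℤ, mk y = mk (π ^ m) := by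
  obtain ⟨N, hN, hval⟩ := exists_mk_pow_eq_of_finiteDimensional ht0
    (fun y hy hy0 => exists_mk_eq_of_mem_adjoin ht0 ht hy0 hy) L
  have htL : t ∈ L :=
    L.algebraMap_mem ⟨t, IntermediateField.subset_adjoin ℝ _ (Set.mem_singleton t)⟩
  have hex : ∃ w : ℕ, 0 < w ∧ ∃ y ∈ L, y ≠ 0 ∧ mk (y ^ N) = mk (t ^ w) :=
    ⟨N, by omega, t, htL, ht0, rfl⟩
  classical
  obtain ⟨hw, π, hπL, hπ0, hπ⟩ := Nat.find_spec hex
  set w := Nat.find hex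
  have hπpos : 0 < mk π := by
    by_contra hcon
    push Not at hcon
    have h1 : mk (π ^ N) ≤ 0 := by rw [mk_pow]; exact nsmul_nonpos hcon N
    rw [hπ, mk_pow] at h1
    exact absurd h1 (not_le.2 (nsmul_pos ht (by omega)))
  refine ⟨π, hπL, hπ0, hπpos, fun y hy hy0 => ?_⟩
  obtain ⟨i, hi⟩ := hval y hy hy0
  refine ⟨i / w, ?_⟩
  set u := y * π ^ (-(i / w)) with hu
  have huL : u ∈ L := L.mul_mem hy (zpow_mem hπL _)
  have hu0 : u ≠ 0 := mul_ne_zero hy0 (zpow_ne_zero _ hπ0)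
  have hyu : y = u * π ^ (i / w) := by
    rw [hu, mul_assoc, ← zpow_add₀ hπ0]; simp
  have hmod : 0 ≤ i % w := Int.emod_nonneg _ (by omega)
  have hmod' : i % w < w := Int.emod_lt_of_pos _ (by omega)
  obtain ⟨r, hr⟩ := Int.eq_ofNat_of_zero_le hmod
  have huN : mk (u ^ N) = mk (t ^ r) := by
    have h1 : mk ((π ^ (-(i / w))) ^ N) = mk (t ^ (-(w * (i / w)))) := by
      have : (π ^ (-(i / w))) ^ N = (π ^ N) ^ (-(i / w)) := by
        rw [← zpow_natCast, ← zpow_natCast, ← zpow_mul, ← zpow_mul, mul_comm]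
      have h2 : t ^ (-(w * (i / w))) = (t ^ w) ^ (-(i / w)) := by
        rw [← zpow_natCast, ← zpow_mul]; congr 1; ring
      rw [this, mk_zpow, hπ, ← mk_zpow, h2]
    rw [hu, mul_pow, mk_mul, hi, h1, ← mk_mul, ← zpow_add₀ ht0, ← zpow_natCast, ← hr]
    congr 2
    have := Int.emod_add_mul_ediv i w
    linarith
  have hr0 : r = 0 := by
    by_contra hr0
    exact Nat.find_min hex (m := r) (by omega) ⟨by omega, u, huL, hu0, huN⟩
  have hu1 : mk u = 0 := mk_eq_zero_of_pow hN (by rw [huN, hr0]; simp)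
  rw [hyu, mk_mul, hu1, zero_add]

theorem exists_polynomial_approx (L : Subfield K) (hL : ∀ r : ℝ, algebraMap ℝ K r ∈ L)
    {π : K} (hπL : π ∈ L) (hπ0 : π ≠ 0) (hπ : 0 < mk π)
    (hgen : ∀ y ∈ L, y ≠ 0 → ∃ m : ℤ, mk y = mk (π ^ m)) (M : ℕ) :
    ∀ y ∈ L, 0 ≤ mk y → ∃ p : ℝ[X], mk (π ^ M) ≤ mk (y - aeval π p) := by
  induction M with
  | zero => exact fun y _ hy => ⟨0, by simpa using hy⟩
  | succ M ih =>
    intro y hyL hy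
    obtain ⟨r, hr⟩ := exists_mk_sub_real_pos hy
    have hpos : mk π ≤ mk (y - algebraMap ℝ K r) := by
      rcases eq_or_ne (y - algebraMap ℝ K r) 0 with h0 | h0
      · simp [h0]
      · obtain ⟨m, hm⟩ := hgen _ (L.sub_mem hyL (hL r)) h0
        rw [hm] at hr ⊢
        have hm1 : 0 < m := by
          by_contra hcon
          have h1 : 0 ≤ mk (π ^ (-m)) := by
            rcases (show -m = 0 ∨ 0 < -m by omega) with h | h
            · simp [h]
            · exact (mk_zpow_pos hπ h).le
          have h2 : mk (π ^ m) + mk (π ^ (-m)) = 0 := by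
            rw [← mk_mul, ← zpow_add₀ hπ0]; simp
          have h3 : mk (π ^ m) + 0 ≤ mk (π ^ m) + mk (π ^ (-m)) := by gcongr
          rw [h2, add_zero] at h3
          exact absurd hr (not_lt.2 h3)
        have h4 : π ^ m = π * π ^ (m - 1) := by
          rw [mul_comm, ← zpow_add_one₀ hπ0]; congr 1; ring
        rw [h4, mk_mul]
        refine le_add_of_nonneg_right ?_
        rcases (show m - 1 = 0 ∨ 0 < m - 1 by omega) with h | h
        · simp [h]
        · exact (mk_zpow_pos hπ h).le
    set y' := (y - algebraMap ℝ K r) / π with hy'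
    have hyy : y - algebraMap ℝ K r = π * y' := by rw [hy']; field_simp
    have hy'0 : 0 ≤ mk y' := by
      by_contra hcon
      push Not at hcon
      rw [hyy, mk_mul] at hpos
      have h5 : mk π + mk y' ≤ mk π + 0 := by gcongr
      have h6 : mk π + mk y' = mk π + 0 := le_antisymm h5 (by simpa using hpos)
      have h7 := add_left_cancel_of_ne_top (by rw [Ne, mk_eq_top_iff]; exact hπ0) h6
      exact hcon.ne h7
    obtain ⟨p, hp⟩ := ih y' (L.div_mem (L.sub_mem hyL (hL r)) hπL) hy'0
    refine ⟨C r + X * p, ?_⟩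
    have h8 : y - aeval π (C r + X * p) = π * (y' - aeval π p) := by
      rw [map_add, aeval_C, map_mul, aeval_X, ← sub_sub, hyy, mul_sub]
    rw [h8, pow_succ', mk_mul, mk_mul]
    gcongr

theorem exists_polynomial_arc {ι : Type*} [Finite ι] {t : K} (ht0 : t ≠ 0) (ht : 0 < mk t)
    (z : ι → K) (hz : ∀ i, 0 ≤ mk (z i))
    (hrel : ∀ i, ∃ Q : ℝ[X][X], Q ≠ 0 ∧ Q.eval₂ (aeval t).toRingHom (z i) = 0) :
    ∃ π : K, π ≠ 0 ∧ 0 < mk π ∧ ∃ e : ℕ, e ≠ 0 ∧ mk t = mk (π ^ e) ∧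
      ∀ i, ∃ p : ℝ[X], mk (π ^ (e + 1)) ≤ mk (z i - aeval π p) := by
  have hint : ∀ x ∈ Set.range z, IsIntegral (IntermediateField.adjoin ℝ {t}) x := by
    rintro _ ⟨i, rfl⟩
    obtain ⟨Q, hQ, hQz⟩ := hrel i
    rw [← isAlgebraic_iff_isIntegral]
    set F := IntermediateField.adjoin ℝ {t}
    set t' : F := ⟨t, IntermediateField.subset_adjoin ℝ _ (Set.mem_singleton t)⟩
    have hcomp : ∀ p : ℝ[X], algebraMap F K (aeval t' p) = aeval t p := by
      intro p
      rw [← aeval_algebraMap_apply]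
      rfl
    refine ⟨Q.map (aeval t').toRingHom, ?_, ?_⟩
    · rwa [Ne, Polynomial.map_eq_zero_iff]
      rw [injective_iff_map_eq_zero]
      intro p hp
      by_contra hp0
      refine aeval_ne_zero_of_mk_pos ht0 ht hp0 ?_
      rw [← hcomp]
      exact (congrArg (algebraMap F K) hp).trans (map_zero _)
    · rw [aeval_def, eval₂_map, ← hQz]
      congr 1
      ext p
      · simp [t', F]
      · simp [t', F]
  have := IntermediateField.finiteDimensional_adjoin hint
  obtain ⟨π, hπL, hπ0, hπ, hgen⟩ := exists_uniformizer ht0 ht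
    (IntermediateField.adjoin (IntermediateField.adjoin ℝ {t}) (Set.range z))
  set L := IntermediateField.adjoin (IntermediateField.adjoin ℝ {t}) (Set.range z)
  have htL : t ∈ L :=
    L.algebraMap_mem ⟨t, IntermediateField.subset_adjoin ℝ _ (Set.mem_singleton t)⟩
  obtain ⟨e, he⟩ := hgen t htL ht0
  have he0 : 0 < e := by
    by_contra hcon
    have h1 : 0 ≤ mk (π ^ (-e)) := by
      rcases (show -e = 0 ∨ 0 < -e by omega) with h | h
      · simp [h]
      · exact (mk_zpow_pos hπ h).le
    have h2 : mk (π ^ e) + mk (π ^ (-e)) = 0 := by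
      rw [← mk_mul, ← zpow_add₀ hπ0]; simp
    have h3 : mk (π ^ e) + 0 ≤ mk (π ^ e) + mk (π ^ (-e)) := by gcongr
    rw [h2, add_zero, ← he] at h3
    exact absurd ht (not_lt.2 h3)
  lift e to ℕ using he0.le
  rw [zpow_natCast] at he
  refine ⟨π, hπ0, hπ, e, by omega, he, fun i => ?_⟩
  refine exists_polynomial_approx L.toSubfield (fun r => ?_) hπL hπ0 hπ hgen (e + 1) (z i)
    (IntermediateField.subset_adjoin _ _ ⟨i, rfl⟩) (hz i)
  exact L.algebraMap_mem (algebraMap ℝ _ r)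

end ValuationLemmas

section Hyperreal

open ArchimedeanClass Polynomial
open Hyperreal
open Filter hiding mk
open Topology

/-- The ring homomorphism from real sequences to hyperreals. -/
noncomputable def ofSeqHom : (ℕ → ℝ) →+* ℝ* := Germ.coeRingHom (hyperfilter ℕ : Filter ℕ)

theorem ofSeqHom_apply (a : ℕ → ℝ) : ofSeqHom a = ofSeq a := rfl

noncomputable instance hyperrealAlgebra : Algebra ℝ ℝ* :=
  RingHom.toAlgebra (coeRingHom : ℝ →+* ℝ*)

theorem hyperreal_algebraMap_eq (r : ℝ) : algebraMap ℝ ℝ* r = ofSeq (fun _ => r) := rfl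

theorem ofSeq_eq_ofSeq_iff {a b : ℕ → ℝ} : ofSeq a = ofSeq b ↔ a =ᶠ[hyperfilter ℕ] b :=
  Germ.coe_eq

theorem ofSeq_ne_zero {a : ℕ → ℝ} (h : ∀ k, a k ≠ 0) : ofSeq a ≠ 0 := by
  intro h0
  have h1 : ofSeq a = ofSeq (fun _ => (0 : ℝ)) := h0
  obtain ⟨k, hk⟩ := (ofSeq_eq_ofSeq_iff.1 h1).exists
  exact h k hk

theorem abs_ofSeq (a : ℕ → ℝ) : |ofSeq a| = ofSeq (fun k => |a k|) := by
  rcases le_total 0 (ofSeq a) with h | h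
  · rw [abs_of_nonneg h]
    refine ofSeq_eq_ofSeq_iff.2 ?_
    filter_upwards [ofSeq_le_ofSeq.1 (show ofSeq (fun _ => 0) ≤ ofSeq a from h)] with k hk
    exact (abs_of_nonneg hk).symm
  · rw [abs_of_nonpos h]
    refine (map_neg ofSeqHom a).symm.trans (ofSeq_eq_ofSeq_iff.2 ?_)
    filter_upwards [ofSeq_le_ofSeq.1 (show ofSeq a ≤ ofSeq (fun _ => 0) from h)] with k hk
    exact (abs_of_nonpos hk).symm

theorem mk_ofSeq_le_iff {a b : ℕ → ℝ} : mk (ofSeq a) ≤ mk (ofSeq b) ↔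
    ∃ n : ℕ, ∀ᶠ k in hyperfilter ℕ, |b k| ≤ n * |a k| := by
  rw [mk_le_mk]
  refine exists_congr fun n => ?_
  rw [nsmul_eq_mul, abs_ofSeq, abs_ofSeq]
  have h : (n : ℝ*) * ofSeq (fun k => |a k|) = ofSeq (fun k => n * |a k|) := by
    rw [← map_natCast ofSeqHom n, ← ofSeqHom_apply, ← map_mul]
    rfl
  rw [h, ofSeq_le_ofSeq]

theorem mk_ofSeq_lt_iff {a b : ℕ → ℝ} : mk (ofSeq a) < mk (ofSeq b) ↔
    ∀ n : ℕ, ∀ᶠ k in hyperfilter ℕ, n * |b k| < |a k| := by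
  rw [mk_lt_mk]
  refine forall_congr' fun n => ?_
  rw [nsmul_eq_mul, abs_ofSeq, abs_ofSeq]
  have h : (n : ℝ*) * ofSeq (fun k => |b k|) = ofSeq (fun k => n * |b k|) := by
    rw [← map_natCast ofSeqHom n, ← ofSeqHom_apply, ← map_mul]
    rfl
  rw [h, ofSeq_lt_ofSeq]

theorem aeval_ofSeq (s : ℕ → ℝ) (p : ℝ[X]) :
    aeval (ofSeq s) p = ofSeq (fun k => p.eval (s k)) := by
  have h : (aeval (ofSeq s)).toRingHom =
      ofSeqHom.comp (RingHom.pi fun k => evalRingHom (s k)) := by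
    ext r
    · simp [hyperreal_algebraMap_eq]
      exact congrArg ofSeq (funext fun k => by simp)
    · simp
      exact congrArg ofSeq (funext fun k => by simp)
  exact congrArg (fun g : ℝ[X] →+* ℝ* => g p) h

theorem eval₂_ofSeq (t z : ℕ → ℝ) (Q : ℝ[X][X]) :
    Q.eval₂ (aeval (ofSeq t)).toRingHom (ofSeq z) = ofSeq (fun k => Q.evalEval (t k) (z k)) := by
  have h : eval₂RingHom (aeval (ofSeq t)).toRingHom (ofSeq z) =
      ofSeqHom.comp (RingHom.pi fun k => evalEvalRingHom (t k) (z k)) := by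
    refine Polynomial.ringHom_ext (fun p => ?_) ?_
    · simp [aeval_ofSeq]
      exact congrArg ofSeq (funext fun k => by simp)
    · simp
      exact congrArg ofSeq (funext fun k => by simp)
  exact congrArg (fun g : ℝ[X][X] →+* ℝ* => g Q) h

theorem mk_ofSeq_pos_iff {s : ℕ → ℝ} :
    0 < mk (ofSeq s) ↔ Tendsto s (hyperfilter ℕ) (𝓝 0) := by
  constructor
  · intro h
    rw [← mk_one, ← map_one ofSeqHom, ofSeqHom_apply, mk_ofSeq_lt_iff] at h
    rw [Metric.tendsto_nhds]
    intro δ hδ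
    obtain ⟨n, hn⟩ := exists_nat_gt (1 / δ)
    filter_upwards [h n] with k hk
    rw [div_lt_iff₀ hδ] at hn
    simp only [Pi.one_apply, abs_one, dist_zero_right, Real.norm_eq_abs] at hk ⊢
    by_contra! hcon
    have : (n : ℝ) * δ ≤ n * |s k| := by gcongr
    linarith
  · intro h
    exact archimedeanClassMk_pos_of_tendsto (tendsto_ofSeq.2 h)

/-- Along an ultrafilter, solutions of nontrivial polynomial equations over `ℝ[t]`, `t → 0`,
are parametrized by polynomials up to an error of order higher than `t`. -/
theorem exists_arc {ι : Type*} [Finite ι] {t : ℕ → ℝ} {z : ι → ℕ → ℝ} (ht0 : ∀ k, t k ≠ 0)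
    (ht : Tendsto t (hyperfilter ℕ) (𝓝 0))
    (hz : ∀ i, ∃ B : ℕ, ∀ᶠ k in hyperfilter ℕ, |z i k| ≤ B)
    (hrel : ∀ i, ∃ Q : ℝ[X][X], Q ≠ 0 ∧ ∀ k, Q.evalEval (t k) (z i k) = 0) :
    ∃ (s : ℕ → ℝ) (e : ℕ) (p : ι → ℝ[X]) (c : ℕ), Tendsto s (hyperfilter ℕ) (𝓝 0) ∧ e ≠ 0 ∧
      (∀ᶠ k in hyperfilter ℕ, s k ≠ 0) ∧
      (∀ᶠ k in hyperfilter ℕ, |t k| ≤ c * |s k| ^ e) ∧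
      (∀ᶠ k in hyperfilter ℕ, |s k| ^ e ≤ c * |t k|) ∧
      ∀ i, ∀ᶠ k in hyperfilter ℕ, |z i k - (p i).eval (s k)| ≤ c * |s k| ^ (e + 1) := by
  obtain ⟨π, hπ0, hπ, e, he, hte, hp⟩ := exists_polynomial_arc (ofSeq_ne_zero ht0)
    (mk_ofSeq_pos_iff.2 ht) (fun i => ofSeq (z i))
    (fun i => by
      obtain ⟨B, hB⟩ := hz i
      rw [← mk_one, ← map_one ofSeqHom, ofSeqHom_apply, mk_ofSeq_le_iff]
      exact ⟨B, by simpa using hB⟩)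
    (fun i => by
      obtain ⟨Q, hQ, hQz⟩ := hrel i
      refine ⟨Q, hQ, ?_⟩
      rw [eval₂_ofSeq]
      simp only [hQz]
      rfl)
  obtain ⟨s, rfl⟩ := ofSeq_surjective π
  choose p hp using hp
  have hpow : ∀ m : ℕ, ofSeq s ^ m = ofSeq (fun k => s k ^ m) := fun m =>
    (map_pow ofSeqHom s m).symm
  rw [hpow] at hte
  obtain ⟨c1, hc1⟩ := mk_ofSeq_le_iff.1 hte.le
  obtain ⟨c2, hc2⟩ := mk_ofSeq_le_iff.1 hte.ge
  have hp' : ∀ i, ∃ n : ℕ, ∀ᶠ k in hyperfilter ℕ,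
      |z i k - (p i).eval (s k)| ≤ n * |s k ^ (e + 1)| := by
    intro i
    have := hp i
    rw [hpow, aeval_ofSeq] at this
    exact mk_ofSeq_le_iff.1 this
  choose n hn using hp'
  obtain ⟨b, hb⟩ := Set.Finite.bddAbove (Set.finite_range n)
  refine ⟨s, e, p, max b (max c1 c2), mk_ofSeq_pos_iff.1 hπ, he, ?_, ?_, ?_, ?_⟩
  · by_contra hcon
    rw [Ultrafilter.frequently_iff_eventually.symm.not, not_frequently] at hcon
    refine hπ0 (show ofSeq s = ofSeq (fun _ => 0) from ofSeq_eq_ofSeq_iff.2 ?_)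
    filter_upwards [hcon] with k hk
    simpa using hk
  · filter_upwards [hc2] with k hk
    rw [abs_pow] at hk
    refine hk.trans ?_
    gcongr
    exact le_max_of_le_right (le_max_right _ _)
  · filter_upwards [hc1] with k hk
    rw [abs_pow] at hk
    refine hk.trans ?_
    gcongr
    exact le_max_of_le_right (le_max_left _ _)
  · intro i
    filter_upwards [hn i] with k hk
    rw [abs_pow] at hk
    refine hk.trans ?_
    gcongr
    exact le_max_of_le_left (hb ⟨i, rfl⟩)

theorem le_mul_sq_of_relation {Δ : ℕ} {t σ : ℕ → ℝ} (ht0 : ∀ k, t k ≠ 0) (hσ0 : ∀ k, σ k ≠ 0)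
    (ht : Tendsto t (hyperfilter ℕ) (𝓝 0)) {Q : ℝ[X][X]} (hQ : Q ≠ 0) (hdeg : Q.natDegree ≤ Δ)
    (hrel : ∀ k, Q.evalEval (t k) (σ k) = 0)
    (hsmall : ∀ n : ℕ, ∀ᶠ k in hyperfilter ℕ, n * |σ k| ^ Δ < |t k| ^ (2 * Δ - 1)) :
    ∃ c : ℕ, ∀ᶠ k in hyperfilter ℕ, |σ k| ≤ c * t k ^ 2 := by
  have hT0 := ofSeq_ne_zero ht0
  have hS0 := ofSeq_ne_zero hσ0
  have hT := mk_ofSeq_pos_iff.2 ht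
  have hpow : ∀ (s : ℕ → ℝ) (m : ℕ), ofSeq s ^ m = ofSeq (fun k => s k ^ m) := fun s m =>
    (map_pow ofSeqHom s m).symm
  obtain ⟨j, hj1, hjΔ, i, hi⟩ := exists_mk_pow_eq_zpow hT0 (Δ := Δ)
    (a := fun j => aeval (ofSeq t) (Q.coeff j)) hS0
    (fun j _ hj => by
      obtain ⟨n, hn⟩ := exists_mk_aeval_eq hT (p := Q.coeff j) (fun h => hj (by simp [h]))
      exact ⟨n, by simpa using hn⟩)
    ⟨Q.natDegree, hdeg, aeval_ne_zero_of_mk_pos hT0 hT (by simpa using hQ)⟩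
    (by
      have := eval₂_ofSeq t σ Q
      simp only [hrel] at this
      rw [eval₂_eq_sum_range' _ (Nat.lt_succ_of_le hdeg)] at this
      exact this)
  have hlt : mk (ofSeq t ^ (2 * Δ - 1)) < mk (ofSeq σ ^ Δ) := by
    rw [hpow, hpow, mk_ofSeq_lt_iff]
    simpa only [abs_pow] using hsmall
  by_contra hcon
  have hcon' : ¬ mk (ofSeq t ^ 2) ≤ mk (ofSeq σ) := by
    rw [hpow, mk_ofSeq_le_iff]
    simpa using hcon
  push Not at hcon'
  have hmono : ∀ a b : ℤ, mk (ofSeq t ^ a) < mk (ofSeq t ^ b) → a < b := by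
    intro a b hab
    by_contra! hba
    rcases hba.eq_or_lt with h | h
    · rw [h] at hab; exact lt_irrefl _ hab
    · have h1 := mk_zpow_pos hT (show 0 < a - b by omega)
      have h2 : mk (ofSeq t ^ a) = mk (ofSeq t ^ b) + mk (ofSeq t ^ (a - b)) := by
        rw [← mk_mul, ← zpow_add₀ hT0]; congr 2; ring
      rw [h2] at hab
      exact absurd (le_add_of_nonneg_right h1.le) (not_le.2 hab)
  have hstrict : ∀ (x y : ℝ*) (m : ℕ), m ≠ 0 → mk x < mk y → mk (x ^ m) < mk (y ^ m) := by
    intro x y m hm hxy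
    rw [mk_lt_mk] at hxy ⊢
    intro n
    rw [abs_pow, abs_pow, nsmul_eq_mul]
    rcases Nat.eq_zero_or_pos n with rfl | hn
    · have := hxy 0
      simp only [zero_smul] at this
      simpa using pow_pos this m
    · have h1 := hxy n
      rw [nsmul_eq_mul] at h1
      have h2 : ((n : ℝ*) * |y|) ^ m < |x| ^ m := by gcongr
      refine lt_of_le_of_lt ?_ h2
      rw [mul_pow]
      gcongr
      exact_mod_cast Nat.le_self_pow hm n
  have h1 := hstrict _ _ j (by omega) hcon'
  rw [hi, ← pow_mul, ← zpow_natCast] at h1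
  have h2 := hmono _ _ h1
  have h3 := hstrict _ _ j (by omega) hlt
  have h4 : mk ((ofSeq σ ^ Δ) ^ j) = mk (ofSeq t ^ (i * Δ)) := by
    rw [← pow_mul, mul_comm, pow_mul, mk_pow, hi, ← mk_pow, zpow_mul, zpow_natCast]
  rw [h4, ← pow_mul, ← zpow_natCast] at h3
  have h5 := hmono _ _ h3
  push_cast [Nat.cast_sub (show 1 ≤ 2 * Δ by omega)] at h2 h5
  have h6 : i ≤ 2 * j - 1 := by omega
  have h7 : (j : ℤ) ≤ Δ := by exact_mod_cast hjΔ
  nlinarith [mul_le_mul_of_nonneg_right h6 (show (0 : ℤ) ≤ Δ by positivity)]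

end Hyperreal

section Arcs

open Polynomial
open Filter Topology

theorem not_frequently_deriv_le {g : ℝ → ℝ} (hg : AnalyticAt ℝ g 0) (hg0 : g 0 = 0) (C : ℝ) :
    ¬ ∃ᶠ s in 𝓝[≠] (0 : ℝ), g s ≠ 0 ∧ |deriv g s| ≤ C * |g s| := by
  intro hfreq
  have hne : ¬ ∀ᶠ s in 𝓝 (0 : ℝ), g s = 0 := by
    intro h
    obtain ⟨s, hs, h0⟩ := (hfreq.and_eventually (h.filter_mono nhdsWithin_le_nhds)).exists
    exact hs.1 h0
  obtain ⟨m, h, hh, hh0, hgh⟩ := hg.exists_eventuallyEq_pow_smul_nonzero_iff.2 hne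
  simp only [sub_zero, smul_eq_mul] at hgh
  have hm : m ≠ 0 := by
    rintro rfl
    have := hgh.self_of_nhds
    rw [hg0] at this
    simp at this
    exact hh0 this.symm
  have hfreq' : ∃ᶠ s in 𝓝[≠] (0 : ℝ), |m * h s + s * deriv h s| ≤ C * |s| * |h s| := by
    have h1 : ∀ᶠ s in 𝓝[≠] (0 : ℝ), s ≠ 0 ∧ g =ᶠ[𝓝 s] (fun s => s ^ m * h s) ∧
        AnalyticAt ℝ h s :=
      eventually_mem_nhdsWithin.and
        ((hgh.eventually_nhds.and hh.eventually_analyticAt).filter_mono nhdsWithin_le_nhds)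
    refine (hfreq.and_eventually h1).mono ?_
    rintro s ⟨⟨hs1, hs2⟩, hs0, hs3, hs4⟩
    rw [hs3.deriv_eq, hs3.self_of_nhds] at hs2
    have hd : deriv (fun s => s ^ m * h s) s = m * s ^ (m - 1) * h s + s ^ m * deriv h s := by
      simpa using ((hasDerivAt_pow m s).fun_mul hs4.differentiableAt.hasDerivAt).deriv
    have hpow : s ^ m = s ^ (m - 1) * s := by
      rw [← pow_succ]; congr 1; omega
    have heq : deriv (fun s => s ^ m * h s) s = s ^ (m - 1) * (m * h s + s * deriv h s) := by
      rw [hd, hpow]; ring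
    beta_reduce at hs2
    rw [heq, abs_mul, hpow, mul_assoc, abs_mul, abs_mul] at hs2
    refine le_of_mul_le_mul_left ?_ (abs_pos.2 (pow_ne_zero (m - 1) hs0))
    linarith
  have hlim1 : Tendsto (fun s => |m * h s + s * deriv h s|) (𝓝[≠] (0 : ℝ))
      (𝓝 |m * h 0 + 0 * deriv h 0|) := by
    refine Tendsto.mono_left ?_ nhdsWithin_le_nhds
    have hc1 : ContinuousAt h 0 := hh.continuousAt
    have hc2 : ContinuousAt (deriv h) 0 := hh.deriv.continuousAt
    exact ((continuousAt_const.mul hc1).add (continuousAt_id.mul hc2)).abs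
  have hlim2 : Tendsto (fun s => C * |s| * |h s|) (𝓝[≠] (0 : ℝ)) (𝓝 (C * |0| * |h 0|)) := by
    refine Tendsto.mono_left ?_ nhdsWithin_le_nhds
    have hc1 : ContinuousAt h 0 := hh.continuousAt
    exact (continuousAt_const.mul continuousAt_id.abs).mul hc1.abs
  have := le_of_tendsto_of_tendsto_of_frequently hlim1 hlim2 hfreq'
  simp only [zero_mul, add_zero, abs_zero, mul_zero] at this
  have h2 : 0 < |(m : ℝ) * h 0| := abs_pos.2 (mul_ne_zero (by exact_mod_cast hm) hh0)
  linarith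

/-- The curve with given polynomial coordinates. -/
noncomputable def polyCurve {n : ℕ} (p : Fin n → ℝ[X]) (s : ℝ) : EuclideanSpace ℝ (Fin n) :=
  WithLp.toLp 2 fun i => (p i).eval s

theorem analyticAt_polyCurve {n : ℕ} (p : Fin n → ℝ[X]) (s : ℝ) :
    AnalyticAt ℝ (polyCurve p) s := by
  have h1 : AnalyticAt ℝ (fun s i => (p i).eval s) s := by
    rw [analyticAt_pi_iff]
    intro i
    simpa using AnalyticAt.aeval_polynomial (analyticAt_id (𝕜 := ℝ) (z := s)) (p i)
  exact ((PiLp.continuousLinearEquiv 2 ℝ (fun _ : Fin n => ℝ)).symm.analyticAt _).comp h1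

theorem false_of_arc {n : ℕ} {f : EuclideanSpace ℝ (Fin n) → ℝ} {b : EuclideanSpace ℝ (Fin n)}
    (hf : AnalyticAt ℝ f b) {l : Filter ℕ} [l.NeBot] {t s : ℕ → ℝ}
    {z : ℕ → EuclideanSpace ℝ (Fin n)} {e : ℕ} {p : Fin n → ℝ[X]} {c C : ℝ} (hc : 0 < c)
    (hC : 0 < C)
    (hz : Tendsto z l (𝓝 b)) (ht : Tendsto t l (𝓝 0)) (hs : Tendsto s l (𝓝 0))
    (hs0 : ∀ᶠ k in l, s k ≠ 0)
    (hst : ∀ᶠ k in l, |s k| ^ e ≤ c * |t k|) (hts : ∀ᶠ k in l, |t k| ≤ c * |s k| ^ e)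
    (hzp : ∀ᶠ k in l, ‖z k - polyCurve p (s k)‖ ≤ c * |s k| ^ (e + 1))
    (hval : ∀ᶠ k in l, |f (z k) - t k| ≤ C * t k ^ 2)
    (hgrad : ∀ᶠ k in l, ‖fderiv ℝ f (z k)‖ ≤ C * |t k|) : False := by
  set γ := polyCurve p with hγdef
  have hγ : ∀ s, AnalyticAt ℝ γ s := analyticAt_polyCurve p
  have hγs : Tendsto (fun k => γ (s k)) l (𝓝 (γ 0)) := (hγ 0).continuousAt.tendsto.comp hs
  have habs : Tendsto (fun k => |s k|) l (𝓝 0) := by simpa using hs.abs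
  have hdiff : Tendsto (fun k => z k - γ (s k)) l (𝓝 0) := by
    refine squeeze_zero_norm' hzp ?_
    simpa using (habs.pow (e + 1)).const_mul c
  have hγ0 : γ 0 = b := by
    have h1 := hz.sub hdiff
    simp only [sub_sub_cancel, sub_zero] at h1
    exact tendsto_nhds_unique hγs h1
  have hfb : f b = 0 := by
    have h1 : Tendsto (fun k => f (z k)) l (𝓝 (f b)) := hf.continuousAt.tendsto.comp hz
    have h2 : Tendsto (fun k => f (z k) - t k) l (𝓝 0) := by
      refine squeeze_zero_norm' (by simpa using hval) ?_
      simpa using (ht.pow 2).const_mul C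
    have h3 := h2.add ht
    simp only [sub_add_cancel, add_zero] at h3
    exact tendsto_nhds_unique h1 h3
  obtain ⟨K1, V1, hV1, hL1⟩ := (hf.contDiffAt (n := 1)).exists_lipschitzOnWith
  obtain ⟨K2, V2, hV2, hL2⟩ := (hf.fderiv.contDiffAt (n := 1)).exists_lipschitzOnWith
  rw [hγ0] at hγs
  have hga : AnalyticAt ℝ (f ∘ γ) 0 := by
    refine AnalyticAt.comp ?_ (hγ 0)
    rwa [hγ0]
  set D := ‖deriv γ 0‖ + 1 with hD
  have hDev : ∀ᶠ k in l, ‖deriv γ (s k)‖ ≤ D := by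
    have h1 : Tendsto (fun k => ‖deriv γ (s k)‖) l (𝓝 ‖deriv γ 0‖) :=
      ((hγ 0).deriv.continuousAt.tendsto.comp hs).norm
    exact h1.eventually_le_const (by simp [hD])
  have hs_small : ∀ᶠ k in l, K1 * c * |s k| ≤ 1 / (4 * c) := by
    have h1 : Tendsto (fun k => K1 * c * |s k|) l (𝓝 0) := by
      simpa using habs.const_mul (K1 * c)
    exact h1.eventually_le_const (by positivity)
  have hs_one : ∀ᶠ k in l, |s k| ≤ 1 := habs.eventually_le_const (by norm_num)
  have ht_small : ∀ᶠ k in l, C * |t k| ≤ 1 / 2 := by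
    have h1 : Tendsto (fun k => C * |t k|) l (𝓝 0) := by simpa using ht.abs.const_mul C
    exact h1.eventually_le_const (by positivity)
  have hana : ∀ᶠ k in l, AnalyticAt ℝ f (γ (s k)) :=
    hγs.eventually hf.eventually_analyticAt
  set B := D * (C * c + K2 * c) with hB
  have hD0 : 0 < D := by positivity
  have hev : ∀ᶠ k in l, s k ≠ 0 ∧ (f ∘ γ) (s k) ≠ 0 ∧
      |deriv (f ∘ γ) (s k)| ≤ (B * (4 * c)) * |(f ∘ γ) (s k)| := by
    filter_upwards [hs0, hst, hts, hzp, hval, hgrad, hDev, hs_small, hs_one, ht_small, hana,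
      hz.eventually hV1, hz.eventually hV2, hγs.eventually hV1, hγs.eventually hV2]
      with k h0 h1 h2 h3 h4 h5 h6 h7 h8 h9 h10 h11 h12 h13 h14
    set r := |s k| ^ e with hr
    have hr0 : 0 < r := by positivity
    have hpow : |s k| ^ (e + 1) = r * |s k| := pow_succ _ _
    rw [hpow] at h3
    have e1 : |f (z k) - f (γ (s k))| ≤ K1 * (c * (r * |s k|)) := by
      have := hL1.dist_le_mul _ h11 _ h13
      rw [Real.dist_eq, dist_eq_norm] at this
      exact this.trans (by gcongr)
    have e2 : ‖fderiv ℝ f (z k) - fderiv ℝ f (γ (s k))‖ ≤ K2 * (c * (r * |s k|)) := by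
      have := hL2.dist_le_mul _ h12 _ h14
      rw [dist_eq_norm, dist_eq_norm] at this
      exact this.trans (by gcongr)
    have e3 : |t k| / 2 ≤ |f (z k)| := by
      have h20 : |t k| ≤ |f (z k)| + |f (z k) - t k| := by
        have := abs_sub (f (z k)) (f (z k) - t k)
        simpa using this
      have h21 : C * t k ^ 2 ≤ |t k| / 2 := by
        rw [← sq_abs]
        nlinarith [abs_nonneg (t k)]
      linarith
    have e4 : r / (4 * c) ≤ |(f ∘ γ) (s k)| := by
      have h20 : |f (z k)| ≤ |f (γ (s k))| + |f (z k) - f (γ (s k))| := by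
        have := abs_add_le (f (γ (s k))) (f (z k) - f (γ (s k)))
        simpa using this
      have h21 : K1 * (c * (r * |s k|)) ≤ r * (1 / (4 * c)) := by
        calc K1 * (c * (r * |s k|)) = r * (K1 * c * |s k|) := by ring
          _ ≤ _ := by gcongr
      have h22 : r / (2 * c) ≤ |t k| / 2 := by
        rw [div_le_div_iff₀ (by positivity) (by positivity)]
        nlinarith
      have h23 : r / (2 * c) = r / (4 * c) + r * (1 / (4 * c)) := by field_simp; norm_num
      simp only [Function.comp]
      linarith
    have e5 : |deriv (f ∘ γ) (s k)| ≤ B * r := by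
      have hd : deriv (f ∘ γ) (s k) = fderiv ℝ f (γ (s k)) (deriv γ (s k)) :=
        (h10.differentiableAt.hasFDerivAt.comp_hasDerivAt _
          (hγ (s k)).differentiableAt.hasDerivAt).deriv
      have h20 : ‖fderiv ℝ f (γ (s k))‖ ≤ C * c * r + K2 * c * r := by
        have h21 := norm_sub_norm_le (fderiv ℝ f (γ (s k))) (fderiv ℝ f (z k))
        rw [norm_sub_rev] at h21
        have h22 : K2 * (c * (r * |s k|)) ≤ K2 * c * r := by
          calc K2 * (c * (r * |s k|)) ≤ K2 * (c * (r * 1)) := by gcongr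
            _ = _ := by ring
        have h23 : C * |t k| ≤ C * c * r := by
          calc C * |t k| ≤ C * (c * r) := by gcongr
            _ = _ := by ring
        linarith
      rw [hd, ← Real.norm_eq_abs]
      refine (ContinuousLinearMap.le_opNorm _ _).trans ?_
      calc _ ≤ (C * c * r + K2 * c * r) * D := by gcongr
        _ = B * r := by rw [hB]; ring
    have hB0 : 0 ≤ B := by positivity
    refine ⟨h0, ?_, e5.trans ?_⟩
    · intro h
      rw [h, abs_zero] at e4
      have : 0 < r / (4 * c) := by positivity
      linarith
    · rw [div_le_iff₀ (by positivity)] at e4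
      calc B * r ≤ B * (|(f ∘ γ) (s k)| * (4 * c)) := by gcongr
        _ = _ := by ring
  refine not_frequently_deriv_le hga (by simp [hγ0, hfb]) (B * (4 * c)) ?_
  have hs' : Tendsto s l (𝓝[≠] 0) := tendsto_nhdsWithin_iff.2 ⟨hs, hs0⟩
  exact hs'.frequently (hev.mono fun k hk => hk.2).frequently

end Arcs

section Assembly

open Filter Metric Topology

theorem eventually_mul_pow_lt {l : Filter ℕ} {t σ g ε : ℕ → ℝ} {Δ : ℕ} {K : ℝ} (hΔ : Δ ≠ 0)
    (ht0 : ∀ k, t k ≠ 0) (ht : Tendsto t l (𝓝 0)) (hε : Tendsto ε l (𝓝 0))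
    (hg : ∀ k, 0 ≤ g k) (hgε : ∀ k, g k ≤ ε k * |t k| ^ (1 - 1 / (2 * Δ) : ℝ))
    (hσ0 : ∀ k, 0 ≤ σ k) (hσ : ∀ k, σ k ≤ g k ^ 2 + K * t k ^ 2) (N : ℕ) :
    ∀ᶠ k in l, N * |σ k| ^ Δ < |t k| ^ (2 * Δ - 1) := by
  have hΔ0 : (0 : ℝ) < Δ := by exact_mod_cast Nat.pos_of_ne_zero hΔ
  have hle : ∀ k, σ k ≤ (ε k ^ 2 + K * |t k| ^ (1 / Δ : ℝ)) * |t k| ^ (2 - 1 / Δ : ℝ) := by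
    intro k
    have hpos := abs_pos.2 (ht0 k)
    have e1 : (|t k| ^ (1 - 1 / (2 * Δ) : ℝ)) ^ 2 = |t k| ^ (2 - 1 / Δ : ℝ) := by
      rw [← Real.rpow_natCast, ← Real.rpow_mul hpos.le]
      congr 1
      push_cast
      field_simp
    have e2 : t k ^ 2 = |t k| ^ (1 / Δ : ℝ) * |t k| ^ (2 - 1 / Δ : ℝ) := by
      rw [← Real.rpow_add hpos, add_sub_cancel, Real.rpow_two, sq_abs]
    have e3 := pow_le_pow_left₀ (hg k) (hgε k) 2
    rw [mul_pow, e1] at e3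
    calc σ k ≤ g k ^ 2 + K * t k ^ 2 := hσ k
      _ ≤ _ := by rw [e2, add_mul, mul_assoc]; gcongr
  have hlim : Tendsto (fun k => N * (ε k ^ 2 + K * |t k| ^ (1 / Δ : ℝ)) ^ Δ) l (𝓝 0) := by
    have h1 : Tendsto (fun k => |t k| ^ (1 / Δ : ℝ)) l (𝓝 0) := by
      have := (ht.abs).rpow_const (p := (1 / Δ : ℝ)) (Or.inr (by positivity))
      rwa [abs_zero, Real.zero_rpow (by positivity)] at this
    have h2 := (((hε.pow 2).add (h1.const_mul K)).pow Δ).const_mul (N : ℝ)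
    simpa [hΔ] using h2
  filter_upwards [hlim.eventually_lt_const one_pos] with k hk
  have hpos := abs_pos.2 (ht0 k)
  have e1 : (|t k| ^ (2 - 1 / Δ : ℝ)) ^ Δ = |t k| ^ (2 * Δ - 1) := by
    rw [← Real.rpow_natCast, ← Real.rpow_mul hpos.le, ← Real.rpow_natCast,
      Nat.cast_sub (by omega)]
    congr 1
    push_cast
    field_simp
  rw [abs_of_nonneg (hσ0 k)]
  calc N * σ k ^ Δ ≤ N * ((ε k ^ 2 + K * |t k| ^ (1 / Δ : ℝ)) * |t k| ^ (2 - 1 / Δ : ℝ)) ^ Δ := by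
        have := hσ0 k
        gcongr
        exact hle k
    _ = (N * (ε k ^ 2 + K * |t k| ^ (1 / Δ : ℝ)) ^ Δ) * |t k| ^ (2 * Δ - 1) := by
        rw [mul_pow, e1, mul_assoc]
    _ < 1 * |t k| ^ (2 * Δ - 1) := by gcongr
    _ = _ := one_mul _

variable {n : ℕ} {f : EuclideanSpace ℝ (Fin n) → ℝ} {a : EuclideanSpace ℝ (Fin n)} {r : ℝ}

theorem bounds_of_penalty_le {t c : ℝ} {x : EuclideanSpace ℝ (Fin n)} (hc : 0 ≤ c) (ht : t ≠ 0)
    (hx : x ∈ ball a r) (h : penalty f a r t x ≤ c * t ^ 2) :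
    ‖fderiv ℝ f x‖ ≤ (c + 1) * |t| ∧ |f x - t| ≤ (c + 1) * t ^ 2 ∧
      1 ≤ c * (r ^ 2 - ‖x - a‖ ^ 2) := by
  have hρ := ball_sub_pos hx
  have ht2 : 0 < t ^ 2 := by positivity
  rw [penalty, sum_partialDeriv_sq] at h
  have h1 : 0 ≤ (f x - t) ^ 2 / t ^ 2 := by positivity
  have h2 : 0 ≤ t ^ 2 / (r ^ 2 - ‖x - a‖ ^ 2) := by positivity
  have h3 : 0 ≤ ‖fderiv ℝ f x‖ ^ 2 := by positivity
  have hcc : c ≤ (c + 1) ^ 2 := by nlinarith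
  refine ⟨?_, ?_, ?_⟩
  · refine abs_le_of_sq_le_sq' ?_ (by positivity) |>.2
    rw [mul_pow, sq_abs]
    nlinarith
  · refine abs_le_of_sq_le_sq ?_ (by positivity)
    have h4 : (f x - t) ^ 2 / t ^ 2 ≤ c * t ^ 2 := by linarith
    rw [div_le_iff₀ ht2] at h4
    nlinarith [mul_pos ht2 ht2]
  · have h4 : t ^ 2 / (r ^ 2 - ‖x - a‖ ^ 2) ≤ c * t ^ 2 := by linarith
    rw [div_le_iff₀ hρ] at h4
    nlinarith

theorem norm_sub_polyCurve_le {p : Fin n → Polynomial ℝ} {s M : ℝ} {z : EuclideanSpace ℝ (Fin n)}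
    (h : ∀ i, |z i - (p i).eval s| ≤ M) (hM : 0 ≤ M) : ‖z - polyCurve p s‖ ≤ (n + 1) * M := by
  refine abs_le_of_sq_le_sq' ?_ (by positivity) |>.2
  rw [EuclideanSpace.real_norm_sq_eq]
  calc ∑ i, (z - polyCurve p s) i ^ 2 ≤ ∑ _i : Fin n, M ^ 2 :=
        Finset.sum_le_sum fun i _ => sq_le_sq.2 ((h i).trans (le_abs_self M))
    _ = n * M ^ 2 := by simp
    _ ≤ ((n + 1) * M) ^ 2 := by nlinarith [sq_nonneg M, Nat.cast_nonneg (α := ℝ) n]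

open Polynomial in
theorem false_of_gradient_le (hr : 0 < r) (hf : AnalyticOnNhd ℝ f (ball a r))
    {P : MvPolynomial (Fin (n + 1)) ℝ} {d : ℕ} (hP : P ≠ 0) (hd : 2 ≤ d) (hPd : P.totalDegree ≤ d)
    (hPf : ∀ x ∈ ball a r, MvPolynomial.eval (graphPoint f x) P = 0)
    (hdense : ∀ x ∈ ball a r, x ∈ closure
        {x ∈ ball a r | MvPolynomial.eval (graphPoint f x) (MvPolynomial.pderiv (Fin.last n) P) ≠ 0})
    {x : ℕ → EuclideanSpace ℝ (Fin n)} (hx : ∀ k, x k ∈ ball a (r / 2)) (hx0 : ∀ k, f (x k) ≠ 0)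
    (hlim : Tendsto (fun k => f (x k)) atTop (𝓝 0)) {ε : ℕ → ℝ} (hε : Tendsto ε atTop (𝓝 0))
    (hgrad : ∀ k, ‖fderiv ℝ f (x k)‖ ≤
      ε k * |f (x k)| ^ (1 - 1 / (2 * ((2 * d - 1) ^ (3 * n + 1) : ℕ)) : ℝ)) : False := by
  have hxr : ∀ k, x k ∈ ball a r := fun k => ball_subset_ball (by linarith) (hx k)
  obtain ⟨A, hA, hAdeg, hArel⟩ := exists_penalty_relation hf hP hd hPd hPf hdense
    ((totalDegree_penaltyNum_le a r hPd).trans (by omega))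
    (fun t y hy => continuousAt_penalty hf t hy)
    (fun t ht y hy => graphEval_penaltyNum hf hPf ht hy)
  have hB (i : Fin n) := exists_penalty_relation hf hP hd hPd hPf hdense
    (M := MvPolynomial.X i.castSucc * penaltyDen P a r) (m := fun _ y => y i)
    ((totalDegree_mul_le_of_le (MvPolynomial.totalDegree_X _).le
      (totalDegree_penaltyDen_le a r hPd)).trans (by omega))
    (fun t y hy => by fun_prop)
    (fun t ht y hy => by rw [map_mul, graphEval_X_castSucc])
  choose B hB _ hBrel using hB
  obtain ⟨c₀, hc₀⟩ := exists_forall_eval_ne_zero (κ := Option (Fin n))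
    (φ := fun s : ℝ => (Polynomial.C (Polynomial.C s) : ℝ[X][X]))
    (Polynomial.C_injective.comp Polynomial.C_injective) (fun k => k.elim A B)
    (fun k => by cases k <;> simp [hA, hB])
  set c : EuclideanSpace ℝ (Fin n) := WithLp.toLp 2 c₀ with hc
  set t : ℕ → ℝ := fun k => f (x k) with ht
  choose z hz hzc hzmin using fun k => exists_critical_point hr hf (hx0 k) c
  have hzc' (k : ℕ) : (fun i => penaltyGradient f a r (f (x k)) i (z k)) = c₀ :=
    funext fun i => hzc k i
  have hlim' := hlim.mono_left Nat.hyperfilter_le_atTop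
  have hσ0 (k : ℕ) : 0 < penalty f a r (t k) (z k) := by
    have h1 : 0 < t k ^ 2 / (r ^ 2 - ‖z k - a‖ ^ 2) :=
      div_pos (show 0 < t k ^ 2 by have := hx0 k; positivity) (ball_sub_pos (hz k))
    exact add_pos_of_nonneg_of_pos (add_nonneg (Finset.sum_nonneg fun _ _ => sq_nonneg _)
      (by positivity)) h1
  have hσ (k : ℕ) : penalty f a r (t k) (z k) ≤
      ‖fderiv ℝ f (x k)‖ ^ 2 + (2 / r ^ 2 + ‖c‖ * (2 * r)) * t k ^ 2 := by
    have ht2 : 0 < t k ^ 2 := by have := hx0 k; positivity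
    have h1 := hzmin k (x k) (hxr k)
    have h2 : inner ℝ c (z k) - inner ℝ c (x k) ≤ ‖c‖ * (2 * r) := by
      rw [← inner_sub_right]
      refine (real_inner_le_norm _ _).trans ?_
      gcongr
      have e1 := mem_ball_iff_norm.1 (hz k)
      have e2 := mem_ball_iff_norm.1 (hxr k)
      have e3 := norm_sub_le (z k - a) (x k - a)
      rw [sub_sub_sub_cancel_right] at e3
      linarith
    have h3 : penalty f a r (t k) (x k) ≤ ‖fderiv ℝ f (x k)‖ ^ 2 + t k ^ 2 * (2 / r ^ 2) := by
      rw [penalty, sum_partialDeriv_sq]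
      have e2 := mem_ball_iff_norm.1 (hx k)
      have e3 : r ^ 2 / 2 ≤ r ^ 2 - ‖x k - a‖ ^ 2 := by nlinarith [norm_nonneg (x k - a)]
      have e4 : t k ^ 2 / (r ^ 2 - ‖x k - a‖ ^ 2) ≤ t k ^ 2 * (2 / r ^ 2) := by
        rw [show t k ^ 2 * (2 / r ^ 2) = t k ^ 2 / (r ^ 2 / 2) by field_simp]
        gcongr
      simp only [ht, sub_self] at e4 ⊢
      simpa using e4
    have h4 : penalty f a r (t k) (z k) / t k ^ 2 ≤
        penalty f a r (t k) (x k) / t k ^ 2 + ‖c‖ * (2 * r) := by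
      simp only [ht]
      linarith
    rw [div_add' _ _ _ ht2.ne', div_le_div_iff_of_pos_right ht2] at h4
    linarith
  obtain ⟨b, hb⟩ := le_mul_sq_of_relation (σ := fun k => penalty f a r (t k) (z k)) hx0
    (fun k => (hσ0 k).ne') hlim' (hc₀ none) (hAdeg _)
    (fun k => by rw [eval_evalEval_of_eval₂, ← hzc' k]; exact hArel _ (hx0 k) _ (hz k))
    (eventually_mul_pow_lt (pow_ne_zero _ (by omega)) hx0 hlim'
      (hε.mono_left Nat.hyperfilter_le_atTop) (fun k => norm_nonneg _) hgrad
      (fun k => (hσ0 k).le) hσ)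
  have hbd : ∀ᶠ k in hyperfilter ℕ, ‖fderiv ℝ f (z k)‖ ≤ (b + 1) * |t k| ∧
      |f (z k) - t k| ≤ (b + 1) * t k ^ 2 ∧ 1 ≤ b * (r ^ 2 - ‖z k - a‖ ^ 2) := by
    filter_upwards [hb] with k hk
    exact bounds_of_penalty_le (Nat.cast_nonneg b) (hx0 k) (hz k) ((le_abs_self _).trans hk)
  have hScl : IsClosed {y : EuclideanSpace ℝ (Fin n) | 1 ≤ b * (r ^ 2 - ‖y - a‖ ^ 2)} :=
    isClosed_le continuous_const (by fun_prop)
  have hSb : {y : EuclideanSpace ℝ (Fin n) | 1 ≤ b * (r ^ 2 - ‖y - a‖ ^ 2)} ⊆ ball a r := by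
    intro y (hy : 1 ≤ b * (r ^ 2 - ‖y - a‖ ^ 2))
    have h1 := pos_of_mul_pos_right (one_pos.trans_le hy) (Nat.cast_nonneg b)
    rw [mem_ball_iff_norm]
    refine lt_of_pow_lt_pow_left₀ 2 hr.le ?_
    linarith
  obtain ⟨w, hw, hzw⟩ := (isCompact_of_isClosed_isBounded hScl
    (isBounded_ball.subset hSb)).ultrafilter_le_nhds ((hyperfilter ℕ).map z)
    (by rw [le_principal_iff]; exact hbd.mono fun k hk => hk.2.2)
  obtain ⟨s, e, p, q, hs, -, hs0, hts, hst, hzp⟩ := exists_arc (z := fun i k => z k i) hx0 hlim'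
    (fun i => by
      obtain ⟨N, hN⟩ := exists_nat_ge (‖a‖ + r)
      refine ⟨N, .of_forall fun k => le_trans ?_ hN⟩
      have e1 := mem_ball_iff_norm.1 (hz k)
      have e2 := norm_le_norm_add_norm_sub' (z k) a
      have e3 : |z k i| ≤ ‖z k‖ := PiLp.norm_apply_le (z k) i
      linarith)
    (fun i => ⟨_, hc₀ (some i), fun k => by
      rw [eval_evalEval_of_eval₂, ← hzc' k]; exact hBrel i _ (hx0 k) _ (hz k)⟩)
  have hq : (q : ℝ) ≤ (n + 1) * (q + 1) := by
    have h1 : (0 : ℝ) ≤ n * (q + 1) := by positivity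
    linarith
  refine false_of_arc (l := hyperfilter ℕ) (hf w (hSb hw)) (c := (n + 1) * (q + 1)) (C := b + 1)
    (by positivity) (by positivity) hzw hlim' hs hs0 ?_ ?_ ?_ (hbd.mono fun k hk => hk.2.1)
    (hbd.mono fun k hk => hk.1) (p := p) (e := e)
  · exact hst.mono fun k hk => hk.trans (by gcongr)
  · exact hts.mono fun k hk => hk.trans (by gcongr)
  · filter_upwards [eventually_all.2 hzp] with k hk
    refine (norm_sub_polyCurve_le hk (by positivity)).trans ?_
    rw [mul_assoc]
    gcongr
    linarith

theorem eq_of_totalDegree_le_one (hr : 0 < r) (hf : AnalyticOnNhd ℝ f (ball a r))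
    {P : MvPolynomial (Fin (n + 1)) ℝ} (hPd : P.totalDegree ≤ 1)
    (hPf : ∀ x ∈ ball a r, MvPolynomial.eval (graphPoint f x) P = 0)
    (hdense : ∀ x ∈ ball a r, x ∈ closure
        {x ∈ ball a r | MvPolynomial.eval (graphPoint f x) (MvPolynomial.pderiv (Fin.last n) P) ≠ 0})
    (ha : fderiv ℝ f a = 0) {x : EuclideanSpace ℝ (Fin n)} (hx : x ∈ ball a r) : f x = f a := by
  have hconst (i : Fin (n + 1)) : ∃ c, MvPolynomial.pderiv i P = MvPolynomial.C c :=
    ⟨_, MvPolynomial.totalDegree_eq_zero_iff_eq_C.1 (by have := totalDegree_pderiv_le i P; omega)⟩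
  choose c hc using hconst
  have hrel (i : Fin n) (y) (hy : y ∈ ball a r) :
      c i.castSucc + c (Fin.last n) * partialDeriv i f y = 0 := by
    simpa [hc] using eval_pderiv_add_eq_zero hf hPf i hy
  have ha' : a ∈ ball a r := mem_ball_self hr
  have hlast : c (Fin.last n) ≠ 0 := by
    obtain ⟨y, hy⟩ := closure_nonempty_iff.1 ⟨a, hdense a ha'⟩
    simpa [hc] using hy.2
  have hzero (i : Fin n) : c i.castSucc = 0 := by
    simpa [partialDeriv, ha] using hrel i a ha'
  have hfderiv (y) (hy : y ∈ ball a r) : fderiv ℝ f y = 0 := by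
    rw [← norm_eq_zero, ← sq_eq_zero_iff, ← sum_partialDeriv_sq]
    refine Finset.sum_eq_zero fun i _ => ?_
    have := hrel i y hy
    rw [hzero, zero_add, mul_eq_zero, or_iff_right hlast] at this
    rw [this, zero_pow two_ne_zero]
  exact isOpen_ball.is_const_of_fderiv_eq_zero (convex_ball a r).isPreconnected
    hf.differentiableOn hfderiv hx ha'

end Assembly

open Filter Topology in
theorem stmt_4 (n : ℕ) (X : Set (EuclideanSpace ℝ (Fin n))) (hX : IsCompact X)
    (U : Set (EuclideanSpace ℝ (Fin n))) (hUopen : IsOpen U) (hXU : X ⊆ U)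
    (f : EuclideanSpace ℝ (Fin n) → ℝ) (hf : AnalyticOnNhd ℝ f U)
    (P : MvPolynomial (Fin (n + 1)) ℝ) (hP : P ≠ 0)
    (hPf : ∀ x ∈ U, MvPolynomial.eval (Fin.snoc (fun i => x i) (f x)) P = 0)
    (d : ℕ) (hd : d = P.totalDegree)
    (hcrit : ∀ x ∈ X, gradient f x = 0 → f x = 0) :
    ∃ C > 0, ∀ x ∈ X,
      ‖gradient f x‖ ≥ C * |f x| ^
        (1 - 1 / ((2 * (2 * d - 1) ^ (3 * n + 1) : ℕ) : ℝ)) := by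
  by_contra! hcon
  choose x hxX hx using fun k : ℕ => hcon (1 / ((k : ℝ) + 1)) Nat.one_div_pos_of_nat
  have hd0 : d ≠ 0 := by
    rintro rfl
    have h1 := MvPolynomial.totalDegree_eq_zero_iff_eq_C.1 hd.symm
    have h2 := hPf (x 0) (hXU (hxX 0))
    rw [h1, MvPolynomial.eval_C] at h2
    rw [h2, MvPolynomial.C_0] at h1
    exact hP h1
  set Δ : ℕ := (2 * d - 1) ^ (3 * n + 1) with hΔ
  have hΔ0 : 1 ≤ Δ := Nat.one_le_pow _ _ (by omega)
  have hθ : (0 : ℝ) < 1 - 1 / ((2 * Δ : ℕ) : ℝ) := by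
    have h1 : (2 : ℝ) ≤ (2 * Δ : ℕ) := by exact_mod_cast (by omega : 2 ≤ 2 * Δ)
    rw [sub_pos, div_lt_one (by linarith)]
    linarith
  have hfx (k : ℕ) : f (x k) ≠ 0 := by
    intro h0
    have h1 := hx k
    rw [h0, abs_zero, Real.zero_rpow hθ.ne', mul_zero] at h1
    exact absurd h1 (norm_nonneg _).not_gt
  obtain ⟨a, haX, φ, hφ, hxa⟩ := hX.tendsto_subseq hxX
  have haU := hXU haX
  have hε : Tendsto (fun k => 1 / ((φ k : ℝ) + 1)) atTop (𝓝 0) :=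
    tendsto_one_div_add_atTop_nhds_zero_nat.comp hφ.tendsto_atTop
  have hfa : Tendsto (fun k => f (x (φ k))) atTop (𝓝 (f a)) :=
    (hf a haU).continuousAt.tendsto.comp hxa
  have hle (k : ℕ) : ‖fderiv ℝ f (x k)‖ ≤
      1 / ((k : ℝ) + 1) * |f (x k)| ^ (1 - 1 / ((2 * Δ : ℕ) : ℝ)) := by
    rw [← norm_gradient_eq]
    exact (hx k).le
  have hderiv : fderiv ℝ f a = 0 := by
    have h1 : Tendsto (fun k => ‖fderiv ℝ f (x (φ k))‖) atTop (𝓝 ‖fderiv ℝ f a‖) :=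
      ((hf a haU).fderiv.continuousAt.tendsto.comp hxa).norm
    have h2 := hε.mul (hfa.abs.rpow_const (p := 1 - 1 / ((2 * Δ : ℕ) : ℝ)) (Or.inr hθ.le))
    rw [zero_mul] at h2
    have h3 := le_of_tendsto_of_tendsto' h1 h2 fun k => hle (φ k)
    exact norm_le_zero_iff.1 h3
  have hfa0 : f a = 0 := hcrit a haX (by rw [gradient, hderiv, map_zero])
  obtain ⟨r, hr, hball⟩ := Metric.isOpen_iff.1 hUopen a haU
  have hfr : AnalyticOnNhd ℝ f (Metric.ball a r) := hf.mono hball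
  obtain ⟨P', hP', hPd, hPf', hdense⟩ := exists_generic_polynomial hfr P hP
    fun y hy => hPf y (hball hy)
  rw [← hd] at hPd
  obtain ⟨N, hN⟩ := eventually_atTop.1
    (hxa.eventually (Metric.ball_mem_nhds a (half_pos hr)))
  have hxN (k : ℕ) : x (φ (k + N)) ∈ Metric.ball a (r / 2) := hN _ (Nat.le_add_left N k)
  rcases (show d = 1 ∨ 2 ≤ d by omega) with rfl | hd2
  · exact hfx _ ((eq_of_totalDegree_le_one hr hfr hPd hPf' hdense hderiv
      (Metric.ball_subset_ball (by linarith) (hxN 0))).trans hfa0)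
  · refine false_of_gradient_le hr hfr hP' hd2 hPd hPf' hdense hxN (fun k => hfx _)
      (hfa0 ▸ hfa.comp (tendsto_add_atTop_nat N)) (hε.comp (tendsto_add_atTop_nat N)) fun k => ?_
    have := hle (φ (k + N))
    rw [Nat.cast_mul, Nat.cast_ofNat] at this
    exact this
end

section
/- Let X ⊆ ℝⁿ, let U ⊇ X be open, and let f : U → ℝ be continuously differentiable. Let ϱ ∈ (0,1) and C > 0 be such that |∇f(x)| ≥ C·|f(x)|^ϱ for all x ∈ X. Then for every x ∈ X with f(x) ≠ 0, the function y ↦ |f(y)|^(1−ϱ) is differentiable at x and the Euclidean norm of its gradient at x is at least (1−ϱ)·C. -/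
/-- The gradient and the Fréchet derivative of a real function have the same norm. -/
theorem norm_gradient_eq_norm_fderiv {E : Type*} [NormedAddCommGroup E] [InnerProductSpace ℝ E]
    [CompleteSpace E] (g : E → ℝ) (x : E) : ‖gradient g x‖ = ‖fderiv ℝ g x‖ :=
  LinearIsometryEquiv.norm_map _ _

/-- The derivative of `t ↦ |t| ^ p` away from zero. -/
theorem hasDerivAt_abs_rpow_of_ne_zero {t : ℝ} (ht : t ≠ 0) (p : ℝ) :
    HasDerivAt (fun s : ℝ => |s| ^ p) ((SignType.sign t : ℝ) * p * |t| ^ (p - 1)) t :=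
  (hasDerivAt_abs ht).rpow_const (Or.inl (abs_ne_zero.mpr ht))

theorem stmt_6 (n : ℕ) (X U : Set (EuclideanSpace ℝ (Fin n)))
    (hUopen : IsOpen U) (hXU : X ⊆ U)
    (f : EuclideanSpace ℝ (Fin n) → ℝ) (hf : ContDiffOn ℝ 1 f U)
    (ϱ C : ℝ) (hϱ : ϱ ∈ Set.Ioo (0 : ℝ) 1) (hC : C > 0)
    (hLoj : ∀ x ∈ X, ‖gradient f x‖ ≥ C * |f x| ^ ϱ) :
    ∀ x ∈ X, f x ≠ 0 →
      DifferentiableAt ℝ (fun y => |f y| ^ (1 - ϱ)) x ∧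
      ‖gradient (fun y => |f y| ^ (1 - ϱ)) x‖ ≥ (1 - ϱ) * C := by
  intro x hx hfx
  have hfd : DifferentiableAt ℝ f x :=
    (hf.contDiffAt (hUopen.mem_nhds (hXU hx))).differentiableAt one_ne_zero
  have hd : HasFDerivAt (fun y => |f y| ^ (1 - ϱ)) _ x :=
    (hasDerivAt_abs_rpow_of_ne_zero hfx (1 - ϱ)).comp_hasFDerivAt x hfd.hasFDerivAt
  refine ⟨hd.differentiableAt, ?_⟩
  have hpos : 0 < |f x| := abs_pos.mpr hfx
  have hϱ' : 0 < 1 - ϱ := sub_pos.mpr hϱ.2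
  have hsign : |(SignType.sign (f x) : ℝ)| = 1 := by
    rcases hfx.lt_or_gt with h | h <;> simp [h]
  have hL := hLoj x hx
  rw [norm_gradient_eq_norm_fderiv] at hL ⊢
  rw [hd.fderiv, norm_smul, Real.norm_eq_abs, abs_mul, abs_mul, hsign, one_mul,
    abs_of_pos hϱ', abs_of_pos (Real.rpow_pos_of_pos hpos _), mul_assoc]
  refine mul_le_mul_of_nonneg_left ?_ hϱ'.le
  calc C = |f x| ^ (1 - ϱ - 1) * (C * |f x| ^ ϱ) := by
        rw [mul_left_comm, ← Real.rpow_add hpos]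
        simp
    _ ≤ |f x| ^ (1 - ϱ - 1) * ‖fderiv ℝ f x‖ := by gcongr
end

section
/- Let X ⊆ ℝⁿ be a compact set, let U ⊇ X be open, and let f : U → ℝ be a real-analytic function such that every x ∈ X with ∇f(x) = 0 satisfies f(x) = 0. Let V = {x ∈ X : f(x) = 0}, and assume that the closure of (interior X) \ V equals X. Let ϱ ∈ (0,1) and C > 0 satisfy |∇f(x)| ≥ C·|f(x)|^ϱ for all x ∈ X, and set U_{X,f} = {x ∈ interior X : (1/(C(1−ϱ)))·|f(x)|^(1−ϱ) < dist(x, ℝⁿ \ X)}. Let s ∈ (0,∞] and let γ : [0,s) → U_{X,f} \ V be a differentiable curve satisfying γ′(t) = −sign(f(γ(t)))·∇f(γ(t))/|∇f(γ(t))| for all t ∈ [0,s), and assume γ is maximal, i.e., there is no s̃ > s and curve γ̃ : [0,s̃) → U_{X,f} \ V satisfying the same differential equation with γ̃ restricted to [0,s) equal to γ. Then s is finite, the limit b = lim_{t→s⁻} γ(t) exists, b ∈ V, and dist(γ(0), V) ≤ s ≤ (1/((1−ϱ)C))·|f(γ(0))|^(1−ϱ). -/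
open scoped ENNReal
open Filter Set Topology

section DescentCurves

variable {E : Type*} [NormedAddCommGroup E] [InnerProductSpace ℝ E] [CompleteSpace E]

/-- The unit vector field `-sign f · ∇f / |∇f|`, along which `|f|` decreases. -/
noncomputable def descentField (f : E → ℝ) (x : E) : E :=
  (-Real.sign (f x) / ‖gradient f x‖) • gradient f x

theorem norm_descentField_le_one (f : E → ℝ) (x : E) : ‖descentField f x‖ ≤ 1 := by
  rw [descentField, norm_smul, norm_div, norm_norm, norm_neg]
  have hsign : ‖Real.sign (f x)‖ ≤ 1 := by
    rcases Real.sign_apply_eq (f x) with h | h | h <;> simp [h]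
  rw [div_mul_eq_mul_div, mul_div_assoc]
  exact mul_le_one₀ hsign (by positivity) (div_self_le_one _)

theorem contDiffAt_descentField {f : E → ℝ} {b : E} (hf : AnalyticAt ℝ f b) (hfb : f b ≠ 0)
    (hgrad : gradient f b ≠ 0) : ContDiffAt ℝ 1 (descentField f) b := by
  have hg : ContDiffAt ℝ 1 (gradient f) b :=
    ((InnerProductSpace.toDual ℝ E).symm.contDiff.contDiffAt).comp b hf.fderiv.contDiffAt
  have hsmooth : ContDiffAt ℝ 1
      (fun x => (-Real.sign (f b) / ‖gradient f x‖) • gradient f x) b :=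
    (contDiffAt_const.div (hg.norm ℝ hgrad) (norm_ne_zero_iff.mpr hgrad)).smul hg
  refine hsmooth.congr_of_eventuallyEq ?_
  have hsign : ∀ᶠ x in 𝓝 b, Real.sign (f x) = Real.sign (f b) := by
    rcases lt_or_gt_of_ne hfb with h | h
    · filter_upwards [hf.continuousAt.eventually_lt_const h] with x hx
      rw [Real.sign_of_neg hx, Real.sign_of_neg h]
    · filter_upwards [hf.continuousAt.eventually_const_lt h] with x hx
      rw [Real.sign_of_pos hx, Real.sign_of_pos h]
  filter_upwards [hsign] with x hx
  rw [descentField, hx]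

/-- Along an integral curve of the descent field, `|f|` decreases at rate `|∇f|`. -/
theorem hasDerivAt_abs_comp_of_descent {f : E → ℝ} {γ : ℝ → E} {t : ℝ}
    (hf : DifferentiableAt ℝ f (γ t)) (hft : f (γ t) ≠ 0)
    (hγ : HasDerivAt γ (descentField f (γ t)) t) :
    HasDerivAt (fun r => |f (γ r)|) (-‖gradient f (γ t)‖) t := by
  have hcomp := hf.hasGradientAt.hasFDerivAt.comp_hasDerivAt t hγ
  have habs := (hasDerivAt_abs hft).comp t hcomp
  refine habs.congr_deriv ?_
  rw [InnerProductSpace.toDual_apply_apply, descentField, real_inner_smul_right,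
    real_inner_self_eq_norm_sq]
  have hsq : (SignType.sign (f (γ t)) : ℝ) * Real.sign (f (γ t)) = 1 := by
    rcases lt_or_gt_of_ne hft with h | h
    · simp [sign_neg h, Real.sign_of_neg h]
    · simp [sign_pos h, Real.sign_of_pos h]
  by_cases hg : ‖gradient f (γ t)‖ = 0
  · simp [hg]
  · field_simp
    linear_combination -hsq

/-- Under a Łojasiewicz inequality, the potential `|f| ^ (1 - ϱ) / (C (1 - ϱ))` decreases at least
at unit speed along integral curves of the descent field. -/
theorem potential_add_le_of_descent {f : E → ℝ} {γ : ℝ → E} {ϱ C T : ℝ} (hϱ : ϱ < 1)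
    (hC : 0 < C) (hT : 0 ≤ T)
    (hf : ∀ t ∈ Icc 0 T, DifferentiableAt ℝ f (γ t)) (hne : ∀ t ∈ Icc 0 T, f (γ t) ≠ 0)
    (hγ : ∀ t ∈ Icc 0 T, HasDerivAt γ (descentField f (γ t)) t)
    (hLoj : ∀ t ∈ Icc 0 T, C * |f (γ t)| ^ ϱ ≤ ‖gradient f (γ t)‖) :
    1 / (C * (1 - ϱ)) * |f (γ T)| ^ (1 - ϱ) + T ≤
      1 / (C * (1 - ϱ)) * |f (γ 0)| ^ (1 - ϱ) := by
  have hϱ' : 0 < 1 - ϱ := sub_pos.mpr hϱ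
  have hder : ∀ t ∈ Icc 0 T, HasDerivAt
      (fun r => 1 / (C * (1 - ϱ)) * |f (γ r)| ^ (1 - ϱ) + r)
      (1 / (C * (1 - ϱ)) *
        (-‖gradient f (γ t)‖ * (1 - ϱ) * |f (γ t)| ^ (1 - ϱ - 1)) + 1) t := fun t ht =>
    (((hasDerivAt_abs_comp_of_descent (hf t ht) (hne t ht) (hγ t ht)).rpow_const
      (Or.inl (abs_ne_zero.mpr (hne t ht)))).const_mul _).add (hasDerivAt_id t)
  have hanti : AntitoneOn (fun r => 1 / (C * (1 - ϱ)) * |f (γ r)| ^ (1 - ϱ) + r) (Icc 0 T) := by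
    refine antitoneOn_of_hasDerivWithinAt_nonpos (convex_Icc 0 T)
      (fun t ht => (hder t ht).continuousAt.continuousWithinAt)
      (fun t ht => (hder t (interior_subset ht)).hasDerivWithinAt) fun t ht => ?_
    have hpos : 0 < |f (γ t)| := abs_pos.mpr (hne t (interior_subset ht))
    have hpow : |f (γ t)| ^ ϱ * |f (γ t)| ^ (1 - ϱ - 1) = 1 := by
      rw [← Real.rpow_add hpos]
      simp
    have hle : C ≤ ‖gradient f (γ t)‖ * |f (γ t)| ^ (1 - ϱ - 1) := by
      calc C = C * |f (γ t)| ^ ϱ * |f (γ t)| ^ (1 - ϱ - 1) := by rw [mul_assoc, hpow, mul_one]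
        _ ≤ _ := by
          gcongr
          exact hLoj t (interior_subset ht)
    have heq : 1 / (C * (1 - ϱ)) *
        (-‖gradient f (γ t)‖ * (1 - ϱ) * |f (γ t)| ^ (1 - ϱ - 1)) =
        -((‖gradient f (γ t)‖ * |f (γ t)| ^ (1 - ϱ - 1)) / C) := by
      field_simp
    rw [heq]
    have := (one_le_div hC).mpr hle
    linarith
  simpa using hanti (left_mem_Icc.mpr hT) (right_mem_Icc.mpr hT) hT

end DescentCurves

section ExtendingCurves

variable {E : Type*} [NormedAddCommGroup E] [NormedSpace ℝ E] [CompleteSpace E]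

/-- A curve of speed at most one on a bounded half-open interval has a limit at the endpoint. -/
theorem exists_tendsto_nhdsLT_of_norm_deriv_le_one {γ γ' : ℝ → E} {T : ℝ} (hT : 0 < T)
    (hγ : ∀ t ∈ Ico 0 T, HasDerivAt γ (γ' t) t) (hγ' : ∀ t ∈ Ico 0 T, ‖γ' t‖ ≤ 1) :
    ∃ b, Tendsto γ (𝓝[<] T) (𝓝 b) ∧ dist (γ 0) b ≤ T := by
  have hdist : ∀ x ∈ Ico 0 T, ∀ y ∈ Ico 0 T, dist (γ x) (γ y) ≤ dist x y := by
    intro x hx y hy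
    have := (convex_Ico 0 T).norm_image_sub_le_of_norm_hasDerivWithin_le
      (fun t ht => (hγ t ht).hasDerivWithinAt) hγ' hy hx
    rwa [one_mul, ← dist_eq_norm, ← dist_eq_norm] at this
  have hlip : LipschitzOnWith 1 γ (Ico 0 T) :=
    LipschitzOnWith.of_dist_le_mul fun x hx y hy => by simpa using hdist x hx y hy
  have hmem : Ico 0 T ∈ 𝓝[<] T := Ico_mem_nhdsLT hT
  have hcauchy : Cauchy (map γ (𝓝[<] T)) :=
    (cauchy_nhds.mono nhdsWithin_le_nhds).map_of_le hlip.uniformContinuousOn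
      (le_principal_iff.mpr hmem)
  obtain ⟨b, hb⟩ := CompleteSpace.complete hcauchy
  refine ⟨b, hb, le_of_tendsto (tendsto_const_nhds.dist hb) ?_⟩
  filter_upwards [hmem] with t ht
  refine (hdist 0 ⟨le_rfl, hT⟩ t ht).trans ?_
  rw [Real.dist_eq, zero_sub, abs_neg, abs_of_nonneg ht.1]
  exact ht.2.le

/-- An integral curve on `[0, T)` converging at `T` to a point where the vector field is `C¹`
extends beyond `T`, with the extension staying in any prescribed neighbourhood of that point. -/
theorem exists_extension_of_tendsto_nhdsLT {F : E → E} {γ : ℝ → E} {T : ℝ} {b : E} {W : Set E}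
    (hT : 0 < T) (hF : ContDiffAt ℝ 1 F b) (hγ : ∀ t ∈ Ico 0 T, HasDerivAt γ (F (γ t)) t)
    (hb : Tendsto γ (𝓝[<] T) (𝓝 b)) (hW : W ∈ 𝓝 b) :
    ∃ ε > 0, ∃ δ : ℝ → E, (∀ t < T, δ t = γ t) ∧ (∀ t ∈ Ico T (T + ε), δ t ∈ W) ∧
      ∀ t ∈ Ico 0 (T + ε), HasDerivAt δ (F (δ t)) t := by
  obtain ⟨α, hα0, ε₁, hε₁, hα⟩ :=
    hF.exists_forall_mem_closedBall_exists_eq_forall_mem_Ioo_hasDerivAt₀ T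
  have hαT : HasDerivAt α (F b) T := hα0 ▸ hα T ⟨by linarith, by linarith⟩
  have hαW : ∀ᶠ t in 𝓝 T, α t ∈ W := hαT.continuousAt (hα0.symm ▸ hW)
  obtain ⟨ε₂, hε₂, hball⟩ := Metric.eventually_nhds_iff.mp hαW
  let δ : ℝ → E := fun t => if t < T then γ t else α t
  have hδγ : ∀ t < T, δ t = γ t := fun t ht => if_pos ht
  have hδα : ∀ t, T ≤ t → δ t = α t := fun t ht => if_neg ht.not_gt
  have hδT : δ T = b := (hδα T le_rfl).trans hα0
  have hlt : ∀ t ∈ Ico 0 T, HasDerivAt δ (F (δ t)) t := by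
    intro t ht
    rw [hδγ t ht.2]
    refine (hγ t ht).congr_of_eventuallyEq ?_
    filter_upwards [eventually_lt_nhds ht.2] with r hr using hδγ r hr
  have hδlim : Tendsto δ (𝓝[<] T) (𝓝 b) :=
    hb.congr' (by filter_upwards [self_mem_nhdsWithin] with r hr using (hδγ r hr).symm)
  have hmem : Ioo 0 T ∈ 𝓝[<] T := Ioo_mem_nhdsLT hT
  have hleft : HasDerivWithinAt δ (F b) (Iic T) T := by
    refine hasDerivWithinAt_Iic_of_tendsto_deriv (s := Ioo 0 T)
      (fun t ht => (hlt t ⟨ht.1.le, ht.2⟩).differentiableAt.differentiableWithinAt) ?_ hmem ?_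
    · rw [ContinuousWithinAt, hδT]
      exact hδlim.mono_left (nhdsWithin_mono _ Ioo_subset_Iio_self)
    · refine (hF.continuousAt.tendsto.comp hδlim).congr' ?_
      filter_upwards [hmem] with t ht using (hlt t ⟨ht.1.le, ht.2⟩).deriv.symm
  have hright : HasDerivWithinAt δ (F b) (Ici T) T :=
    hαT.hasDerivWithinAt.congr (fun t ht => hδα t ht) (hδα T le_rfl)
  refine ⟨min ε₁ ε₂, lt_min hε₁ hε₂, δ, hδγ, fun t ht => ?_, fun t ht => ?_⟩
  · rw [hδα t ht.1]
    apply hball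
    rw [Real.dist_eq, abs_of_nonneg (sub_nonneg.mpr ht.1)]
    linarith [ht.2, min_le_right ε₁ ε₂]
  · rcases lt_trichotomy t T with h | rfl | h
    · exact hlt t ⟨ht.1, h⟩
    · rw [hδT, ← hasDerivWithinAt_univ, ← Iic_union_Ici]
      exact hleft.union hright
    · rw [hδα t h.le]
      refine (hα t ⟨by linarith, by linarith [ht.2, min_le_left ε₁ ε₂]⟩).congr_of_eventuallyEq ?_
      filter_upwards [eventually_gt_nhds h] with r hr using hδα r hr.le

end ExtendingCurves



theorem stmt_7 (n : ℕ) (X : Set (EuclideanSpace ℝ (Fin n))) (hX : IsCompact X)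
    (U : Set (EuclideanSpace ℝ (Fin n))) (hUopen : IsOpen U) (hXU : X ⊆ U)
    (f : EuclideanSpace ℝ (Fin n) → ℝ) (hf : AnalyticOnNhd ℝ f U)
    (hcrit : ∀ x ∈ X, gradient f x = 0 → f x = 0)
    (V : Set (EuclideanSpace ℝ (Fin n))) (hV : V = {x ∈ X | f x = 0})
    (hdense : closure (interior X \ V) = X)
    (ϱ C : ℝ) (hϱ : ϱ ∈ Set.Ioo (0 : ℝ) 1) (hC : C > 0)
    (hLoj : ∀ x ∈ X, ‖gradient f x‖ ≥ C * |f x| ^ ϱ)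
    (UXf : Set (EuclideanSpace ℝ (Fin n)))
    (hUXf : UXf = {x ∈ interior X |
      (1 / (C * (1 - ϱ))) * |f x| ^ (1 - ϱ) < Metric.infDist x Xᶜ})
    (s : ℝ≥0∞) (hs : 0 < s) (γ : ℝ → EuclideanSpace ℝ (Fin n))
    (hγmem : ∀ t : ℝ, 0 ≤ t → ENNReal.ofReal t < s → γ t ∈ UXf \ V)
    (hγode : ∀ t : ℝ, 0 ≤ t → ENNReal.ofReal t < s →
      HasDerivAt γ ((-Real.sign (f (γ t)) / ‖gradient f (γ t)‖) • gradient f (γ t)) t)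
    (hmax : ¬ ∃ s' : ℝ≥0∞, s < s' ∧ ∃ γ' : ℝ → EuclideanSpace ℝ (Fin n),
      (∀ t : ℝ, 0 ≤ t → ENNReal.ofReal t < s' → γ' t ∈ UXf \ V) ∧
      (∀ t : ℝ, 0 ≤ t → ENNReal.ofReal t < s' →
        HasDerivAt γ' ((-Real.sign (f (γ' t)) / ‖gradient f (γ' t)‖) • gradient f (γ' t)) t) ∧
      (∀ t : ℝ, 0 ≤ t → ENNReal.ofReal t < s → γ' t = γ t)) :
    s ≠ ⊤ ∧ ∃ b : EuclideanSpace ℝ (Fin n),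
      Filter.Tendsto γ (nhdsWithin s.toReal (Set.Iio s.toReal)) (nhds b) ∧ b ∈ V ∧
      Metric.infDist (γ 0) V ≤ s.toReal ∧
      s.toReal ≤ (1 / ((1 - ϱ) * C)) * |f (γ 0)| ^ (1 - ϱ) := by
  have hϱ' : 0 < 1 - ϱ := sub_pos.mpr hϱ.2
  set κ : ℝ := 1 / (C * (1 - ϱ)) with hκ
  have hκ0 : 0 < κ := by positivity
  have hmemX : ∀ t : ℝ, 0 ≤ t → ENNReal.ofReal t < s → γ t ∈ X := fun t h0 ht =>
    interior_subset (hUXf ▸ (hγmem t h0 ht).1 : γ t ∈ {x ∈ interior X | _}).1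
  have hne : ∀ t : ℝ, 0 ≤ t → ENNReal.ofReal t < s → f (γ t) ≠ 0 := fun t h0 ht h =>
    (hγmem t h0 ht).2 (hV ▸ ⟨hmemX t h0 ht, h⟩)
  have hdecay : ∀ t : ℝ, 0 ≤ t → ENNReal.ofReal t < s →
      κ * |f (γ t)| ^ (1 - ϱ) + t ≤ κ * |f (γ 0)| ^ (1 - ϱ) := by
    intro t h0 ht
    have hlt : ∀ r ∈ Icc 0 t, ENNReal.ofReal r < s := fun r hr =>
      (ENNReal.ofReal_le_ofReal hr.2).trans_lt ht
    exact potential_add_le_of_descent hϱ.2 hC h0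
      (fun r hr => (hf _ (hXU (hmemX r hr.1 (hlt r hr)))).differentiableAt)
      (fun r hr => hne r hr.1 (hlt r hr)) (fun r hr => hγode r hr.1 (hlt r hr))
      (fun r hr => hLoj _ (hmemX r hr.1 (hlt r hr)))
  have hpot0 : 0 ≤ κ * |f (γ 0)| ^ (1 - ϱ) := by positivity
  have hs_le : s ≤ ENNReal.ofReal (κ * |f (γ 0)| ^ (1 - ϱ)) := by
    by_contra! h
    have h1 := hdecay _ hpot0 h
    have h2 : 0 < κ * |f (γ (κ * |f (γ 0)| ^ (1 - ϱ)))| ^ (1 - ϱ) :=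
      mul_pos hκ0 (Real.rpow_pos_of_pos (abs_pos.mpr (hne _ hpot0 h)) _)
    linarith
  have hs_top : s ≠ ⊤ := ne_top_of_le_ne_top ENNReal.ofReal_ne_top hs_le
  obtain ⟨T, hT⟩ : ∃ T, T = s.toReal := ⟨_, rfl⟩
  have hsT : s = ENNReal.ofReal T := by rw [hT, ENNReal.ofReal_toReal hs_top]
  have hT0 : 0 < T := hT ▸ ENNReal.toReal_pos hs.ne' hs_top
  have hlt_iff : ∀ t : ℝ, ENNReal.ofReal t < s ↔ t < T := fun t => by
    rw [hsT, ENNReal.ofReal_lt_ofReal_iff hT0]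
  simp only [hlt_iff] at hγmem hγode hmemX hne hdecay hmax
  rw [← hT]
  obtain ⟨b, hb, hdist⟩ := exists_tendsto_nhdsLT_of_norm_deriv_le_one hT0
    (fun t ht => hγode t ht.1 ht.2) (fun t _ => norm_descentField_le_one f (γ t))
  have hmem : Ico 0 T ∈ 𝓝[<] T := Ico_mem_nhdsLT hT0
  have hbX : b ∈ X := hX.isClosed.mem_of_tendsto hb <| by
    filter_upwards [hmem] with t ht using hmemX t ht.1 ht.2
  have hpot_cont : ∀ x ∈ X, ContinuousAt (fun x => κ * |f x| ^ (1 - ϱ)) x := fun x hx =>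
    ((hf x (hXU hx)).continuousAt.abs.rpow_const (Or.inr hϱ'.le)).const_mul κ
  have hpotb : κ * |f b| ^ (1 - ϱ) + T ≤ κ * |f (γ 0)| ^ (1 - ϱ) := by
    refine le_of_tendsto (((hpot_cont b hbX).tendsto.comp hb).add
      (tendsto_id.mono_left nhdsWithin_le_nhds)) ?_
    filter_upwards [hmem] with t ht using hdecay t ht.1 ht.2
  have hpotb0 : 0 ≤ κ * |f b| ^ (1 - ϱ) := by positivity
  have hbdist : κ * |f b| ^ (1 - ϱ) < Metric.infDist b Xᶜ := by
    have h0 := (hUXf ▸ (hγmem 0 le_rfl hT0).1 : γ 0 ∈ {x ∈ interior X | _}).2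
    have h1 := Metric.infDist_le_infDist_add_dist (s := Xᶜ) (x := γ 0) (y := b)
    linarith
  have hbint : b ∈ interior X := by
    rw [← compl_compl X, interior_compl, mem_compl_iff]
    intro h
    rw [← Metric.infDist_closure, Metric.infDist_zero_of_mem h] at hbdist
    linarith
  have hbV : b ∈ V := by
    by_contra hbV
    have hfb : f b ≠ 0 := fun h => hbV (hV ▸ ⟨hbX, h⟩)
    have hW : UXf \ V ∈ 𝓝 b := by
      filter_upwards [isOpen_interior.mem_nhds hbint,
        (hpot_cont b hbX).eventually_lt
          (Metric.continuous_infDist_pt Xᶜ).continuousAt hbdist,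
        (hf b (hXU hbX)).continuousAt.eventually_ne hfb] with x hx1 hx2 hx3
      rw [hUXf, hV]
      exact ⟨⟨hx1, hx2⟩, fun h => hx3 h.2⟩
    obtain ⟨ε, hε, δ, hδγ, hδW, hδ⟩ := exists_extension_of_tendsto_nhdsLT hT0
      (contDiffAt_descentField (hf b (hXU hbX)) hfb fun h => hfb (hcrit b hbX h))
      (fun t ht => hγode t ht.1 ht.2) hb hW
    have hlt_iff' : ∀ t : ℝ, ENNReal.ofReal t < ENNReal.ofReal (T + ε) ↔ t < T + ε := fun t =>
      ENNReal.ofReal_lt_ofReal_iff (by linarith)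
    refine hmax ⟨ENNReal.ofReal (T + ε), hsT ▸ (hlt_iff' T).mpr (by linarith), δ,
      fun t h0 ht => ?_, fun t h0 ht => hδ t ⟨h0, (hlt_iff' t).mp ht⟩, fun t _ ht => hδγ t ht⟩
    rcases lt_or_ge t T with h | h
    · rw [hδγ t h]
      exact hγmem t h0 h
    · exact hδW t ⟨h, (hlt_iff' t).mp ht⟩
  refine ⟨hs_top, b, hb, hbV, (Metric.infDist_le_dist_of_mem hbV).trans hdist, ?_⟩
  rw [mul_comm (1 - ϱ) C]
  linarith
end

section
/- Let X ⊆ ℝⁿ be a compact set, let U ⊇ X be open, and let f : U → ℝ be a real-analytic function such that every x ∈ X with ∇f(x) = 0 satisfies f(x) = 0. Let V = {x ∈ X : f(x) = 0}, and assume that the closure of (interior X) \ V equals X. Let ϱ ∈ (0,1) and C > 0 satisfy |∇f(x)| ≥ C·|f(x)|^ϱ for all x ∈ X, and set U_{X,f} = {x ∈ interior X : (1/(C(1−ϱ)))·|f(x)|^(1−ϱ) < dist(x, ℝⁿ \ X)}. Then for every x ∈ U_{X,f}: |f(x)| ≥ (C(1−ϱ))^(1/(1−ϱ))·dist(x, V)^(1/(1−ϱ))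 and |∇f(x)| ≥ C·(C(1−ϱ))^(ϱ/(1−ϱ))·dist(x, V)^(ϱ/(1−ϱ)). -/
/-- If `g y - l * ‖z - y‖` bounds `g z` from below near `y`, then the derivative of `g` at `y` has
norm at most `l`. -/
theorem HasFDerivAt.norm_le_of_eventually_sub_mul_norm_le {E : Type*} [NormedAddCommGroup E]
    [NormedSpace ℝ E] {g : E → ℝ} {g' : E →L[ℝ] ℝ} {y : E} {l : ℝ} (hg : HasFDerivAt g g' y)
    (hl : 0 ≤ l) (h : ∀ᶠ z in nhds y, g y - l * ‖z - y‖ ≤ g z) : ‖g'‖ ≤ l := by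
  have key : ∀ v, -(l * ‖v‖) ≤ g' v := by
    intro v
    have hd : HasDerivAt (fun t : ℝ => g (y + t • v)) (g' v) 0 := hg.hasLineDerivAt v
    refine ge_of_tendsto hd.tendsto_slope_zero_right ?_
    have ht : Filter.Tendsto (fun t : ℝ => y + t • v) (nhdsWithin 0 (Set.Ioi 0)) (nhds y) := by
      have hc : Continuous (fun t : ℝ => y + t • v) := by fun_prop
      have := hc.tendsto 0
      simp only [zero_smul, add_zero] at this
      exact this.mono_left nhdsWithin_le_nhds
    filter_upwards [ht.eventually h, self_mem_nhdsWithin] with t h1 h2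
    have h2 : 0 < t := h2
    simp only [add_sub_cancel_left, norm_smul, Real.norm_eq_abs, _root_.abs_of_pos h2] at h1
    simp only [zero_add, zero_smul, add_zero, smul_eq_mul]
    rw [inv_mul_eq_div, le_div_iff₀ h2]
    linarith
  refine g'.opNorm_le_bound hl fun v => ?_
  rw [Real.norm_eq_abs, abs_le]
  have := key (-v)
  rw [norm_neg, map_neg] at this
  exact ⟨key v, by linarith⟩

/-- Under the Łojasiewicz gradient inequality, `|f| ^ (1 - r) / (C * (1 - r))` has derivative of
norm at least one away from the zeros of `f`. -/
theorem exists_hasFDerivAt_rpow_of_lojasiewicz {E : Type*} [NormedAddCommGroup E]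
    [NormedSpace ℝ E] {f : E → ℝ} {f' : E →L[ℝ] ℝ} {y : E} {r C : ℝ} (hr : r < 1) (hC : 0 < C)
    (hf : HasFDerivAt f f' y) (hy : f y ≠ 0) (hL : C * |f y| ^ r ≤ ‖f'‖) :
    ∃ g' : E →L[ℝ] ℝ,
      HasFDerivAt (fun z => (1 / (C * (1 - r))) * |f z| ^ (1 - r)) g' y ∧ 1 ≤ ‖g'‖ := by
  have hpos : 0 < |f y| := abs_pos.2 hy
  have hr' : 0 < 1 - r := sub_pos.2 hr
  refine ⟨_, ((hf.abs hy).rpow_const (p := 1 - r) (Or.inl hpos.ne')).const_mul _, ?_⟩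
  have hs : ‖((SignType.sign (f y) : SignType) : ℝ)‖ = 1 := by
    rcases lt_or_gt_of_ne hy with h | h <;> simp [h]
  simp only [norm_smul, hs, one_mul]
  have he : 1 - r - 1 = -r := by ring
  rw [he, Real.rpow_neg hpos.le, Real.norm_of_nonneg (by positivity),
    Real.norm_of_nonneg (by positivity)]
  have hp : 0 < |f y| ^ r := Real.rpow_pos_of_pos hpos r
  calc (1 : ℝ) = 1 / (C * (1 - r)) * ((1 - r) * (|f y| ^ r)⁻¹ * (C * |f y| ^ r)) := by
        field_simp
    _ ≤ _ := by gcongr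

/-- If a nonnegative continuous function on a closed ball has derivatives of norm at least one at
every interior point, then its value at the centre is at least the radius. -/
theorem le_of_one_le_norm_fderiv {E : Type*} [NormedAddCommGroup E] [NormedSpace ℝ E]
    [ProperSpace E] {g : E → ℝ} {x : E} {R : ℝ} (hR : 0 ≤ R)
    (hcont : ContinuousOn g (Metric.closedBall x R))
    (hnonneg : ∀ y ∈ Metric.closedBall x R, 0 ≤ g y)
    (hderiv : ∀ y ∈ Metric.ball x R, ∃ g' : E →L[ℝ] ℝ, HasFDerivAt g g' y ∧ 1 ≤ ‖g'‖) :
    R ≤ g x := by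
  by_contra! hlt
  have h0 : 0 ≤ g x := hnonneg x (Metric.mem_closedBall_self hR)
  have hRpos : 0 < R := h0.trans_lt hlt
  obtain ⟨l, hl1, hl2⟩ := exists_between ((div_lt_one hRpos).2 hlt)
  have hl0 : 0 ≤ l := (div_nonneg h0 hRpos.le).trans hl1.le
  rw [div_lt_iff₀ hRpos] at hl1
  obtain ⟨y, hy, hmin⟩ := (isCompact_closedBall x R).exists_isMinOn
    ⟨x, Metric.mem_closedBall_self hR⟩
    (f := fun z => g z + l * dist z x) (hcont.add (by fun_prop))
  have hyx : g y + l * dist y x ≤ g x := by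
    simpa using hmin (Metric.mem_closedBall_self hR)
  have hyb : y ∈ Metric.ball x R := by
    rw [Metric.mem_ball]
    by_contra! hge
    have := hnonneg y hy
    have := mul_le_mul_of_nonneg_left hge hl0
    linarith
  obtain ⟨g', hg', h1⟩ := hderiv y hyb
  have hle : ‖g'‖ ≤ l := by
    refine hg'.norm_le_of_eventually_sub_mul_norm_le hl0 ?_
    filter_upwards [Metric.isOpen_ball.mem_nhds hyb] with z hz
    have h2 : g y + l * dist y x ≤ g z + l * dist z x := hmin (Metric.ball_subset_closedBall hz)
    have h3 := mul_le_mul_of_nonneg_left (dist_triangle z y x) hl0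
    rw [← dist_eq_norm]
    linarith
  linarith


theorem stmt_8 (n : ℕ) (X : Set (EuclideanSpace ℝ (Fin n))) (hX : IsCompact X)
    (U : Set (EuclideanSpace ℝ (Fin n))) (hUopen : IsOpen U) (hXU : X ⊆ U)
    (f : EuclideanSpace ℝ (Fin n) → ℝ) (hf : AnalyticOnNhd ℝ f U)
    (hcrit : ∀ x ∈ X, gradient f x = 0 → f x = 0)
    (V : Set (EuclideanSpace ℝ (Fin n))) (hV : V = {x ∈ X | f x = 0})
    (hdense : closure (interior X \ V) = X)
    (ϱ C : ℝ) (hϱ : ϱ ∈ Set.Ioo (0 : ℝ) 1) (hC : C > 0)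
    (hLoj : ∀ x ∈ X, ‖gradient f x‖ ≥ C * |f x| ^ ϱ)
    (UXf : Set (EuclideanSpace ℝ (Fin n)))
    (hUXf : UXf = {x ∈ interior X |
      (1 / (C * (1 - ϱ))) * |f x| ^ (1 - ϱ) < Metric.infDist x Xᶜ}) :
    ∀ x ∈ UXf,
      |f x| ≥ (C * (1 - ϱ)) ^ (1 / (1 - ϱ)) * Metric.infDist x V ^ (1 / (1 - ϱ)) ∧
      ‖gradient f x‖ ≥
        C * (C * (1 - ϱ)) ^ (ϱ / (1 - ϱ)) * Metric.infDist x V ^ (ϱ / (1 - ϱ)) := by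
  subst hV hUXf
  rintro x ⟨hxi, hx⟩
  have hxX : x ∈ X := interior_subset hxi
  have hr : 0 < 1 - ϱ := sub_pos.2 hϱ.2
  have hCr : 0 < C * (1 - ϱ) := mul_pos hC hr
  have hg0 : ∀ z, 0 ≤ (1 / (C * (1 - ϱ))) * |f z| ^ (1 - ϱ) := fun z => by positivity
  have hdist : Metric.infDist x {x ∈ X | f x = 0} ≤ (1 / (C * (1 - ϱ))) * |f x| ^ (1 - ϱ) := by
    by_contra! hlt
    obtain ⟨R, hR1, hR2⟩ := exists_between (lt_min hx hlt)
    rw [lt_min_iff] at hR2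
    have hsub : Metric.closedBall x R ⊆ X := by
      intro y hy
      by_contra hyX
      have := Metric.infDist_le_dist_of_mem (x := x) (show y ∈ Xᶜ from hyX)
      rw [Metric.mem_closedBall'] at hy
      linarith
    have hne : ∀ y ∈ Metric.closedBall x R, f y ≠ 0 := by
      intro y hy h0
      have := Metric.infDist_le_dist_of_mem (x := x) (s := {x ∈ X | f x = 0}) ⟨hsub hy, h0⟩
      rw [Metric.mem_closedBall'] at hy
      linarith
    have hder : ∀ y ∈ Metric.closedBall x R, ∃ g' : EuclideanSpace ℝ (Fin n) →L[ℝ] ℝ,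
        HasFDerivAt (fun z => (1 / (C * (1 - ϱ))) * |f z| ^ (1 - ϱ)) g' y ∧ 1 ≤ ‖g'‖ := by
      intro y hy
      refine exists_hasFDerivAt_rpow_of_lojasiewicz hϱ.2 hC
        (hf y (hXU (hsub hy))).differentiableAt.hasFDerivAt (hne y hy) ?_
      have := hLoj y (hsub hy)
      rwa [gradient, LinearIsometryEquiv.norm_map] at this
    refine hR1.not_ge (le_of_one_le_norm_fderiv
      (g := fun z => (1 / (C * (1 - ϱ))) * |f z| ^ (1 - ϱ)) ((hg0 x).trans hR1.le) (fun y hy => ?_)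
      (fun y _ => hg0 y) (fun y hy => hder y (Metric.ball_subset_closedBall hy)))
    obtain ⟨g', hg', -⟩ := hder y hy
    exact hg'.continuousAt.continuousWithinAt
  have hd0 : 0 ≤ Metric.infDist x {x ∈ X | f x = 0} := Metric.infDist_nonneg
  generalize Metric.infDist x {x ∈ X | f x = 0} = d at hdist hd0
  have hmul : C * (1 - ϱ) * d ≤ |f x| ^ (1 - ϱ) := by
    rwa [one_div, inv_mul_eq_div, le_div_iff₀' hCr] at hdist
  have hfx : (C * (1 - ϱ)) ^ (1 / (1 - ϱ)) * d ^ (1 / (1 - ϱ)) ≤ |f x| := by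
    rw [← Real.mul_rpow hCr.le hd0, one_div]
    exact (Real.rpow_inv_le_iff_of_pos (by positivity) (abs_nonneg _) hr).2 hmul
  refine ⟨hfx, ?_⟩
  calc C * (C * (1 - ϱ)) ^ (ϱ / (1 - ϱ)) * d ^ (ϱ / (1 - ϱ))
      = C * ((C * (1 - ϱ)) ^ (1 / (1 - ϱ)) * d ^ (1 / (1 - ϱ))) ^ ϱ := by
        rw [Real.mul_rpow (Real.rpow_nonneg hCr.le _) (Real.rpow_nonneg hd0 _), ← Real.rpow_mul hCr.le,
          ← Real.rpow_mul hd0, one_div_mul_eq_div, mul_assoc]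
    _ ≤ C * |f x| ^ ϱ := by
        have := hϱ.1
        gcongr
    _ ≤ ‖gradient f x‖ := hLoj x hxX
end

section
/- Let X, Y ⊆ ℝⁿ be compact sets with X ⊆ interior Y, let U ⊇ Y be open, and let f : U → ℝ be a real-analytic function such that every x ∈ Y with ∇f(x) = 0 satisfies f(x) = 0. Let ϱ ∈ (0,1) and C > 0 satisfy |∇f(x)| ≥ C·|f(x)|^ϱ for all x ∈ Y, and let V = {x ∈ Y : f(x) = 0}. Then there exists a constant C′ > 0 such that |f(x)| ≥ C′·dist(x, V)^(1/(1−ϱ)) for all x ∈ X. -/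
/-- If `g` decreases at rate at most `K` away from `y`, its derivative at `y` has norm
at most `K`. -/
theorem HasFDerivAt.norm_le_of_eventually_le_add {E : Type*} [NormedAddCommGroup E]
    [NormedSpace ℝ E] {g : E → ℝ} {G : E →L[ℝ] ℝ} {y : E} {K : ℝ} (hK : 0 ≤ K)
    (hg : HasFDerivAt g G y) (h : ∀ᶠ z in nhds y, g y ≤ g z + K * ‖z - y‖) : ‖G‖ ≤ K := by
  have key : ∀ v : E, -(K * ‖v‖) ≤ G v := by
    intro v
    have hline : HasDerivAt (fun t : ℝ => y + t • v) v 0 := by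
      simpa using ((hasDerivAt_id (0 : ℝ)).smul_const v).const_add y
    have hcomp : HasDerivAt (fun t : ℝ => g (y + t • v)) (G v) 0 := by
      have hg' : HasFDerivAt g G (y + (0 : ℝ) • v) := by simpa using hg
      exact hg'.comp_hasDerivAt (0 : ℝ) hline
    have hlim := hcomp.tendsto_slope_zero_right
    have hc : Filter.Tendsto (fun t : ℝ => y + t • v) (nhdsWithin 0 (Set.Ioi 0)) (nhds y) := by
      have := hline.continuousAt.tendsto
      simp only [zero_smul, add_zero] at this
      exact this.mono_left nhdsWithin_le_nhds
    refine ge_of_tendsto hlim ?_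
    filter_upwards [hc.eventually h, self_mem_nhdsWithin] with t ht htpos
    have htpos : 0 < t := htpos
    simp only [add_sub_cancel_left, norm_smul, Real.norm_eq_abs, _root_.abs_of_pos htpos] at ht
    simp only [zero_add, zero_smul, add_zero, smul_eq_mul]
    rw [inv_mul_eq_div, le_div_iff₀ htpos]
    linarith
  refine G.opNorm_le_bound hK fun v => ?_
  have h1 := key v
  have h2 := key (-v)
  rw [norm_neg, map_neg] at h2
  rw [Real.norm_eq_abs, abs_le]
  constructor <;> linarith

/-- The norm of the derivative of `|f| ^ s` at a point where `f` does not vanish. -/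
theorem HasFDerivAt.exists_abs_rpow_const {E : Type*} [NormedAddCommGroup E]
    [NormedSpace ℝ E] {f : E → ℝ} {F : E →L[ℝ] ℝ} {y : E} {s : ℝ} (hs : 0 ≤ s)
    (hf : HasFDerivAt f F y) (hy : f y ≠ 0) :
    ∃ G : E →L[ℝ] ℝ, HasFDerivAt (fun z => |f z| ^ s) G y ∧
      ‖G‖ = s * |f y| ^ (s - 1) * ‖F‖ := by
  have habs := (hasDerivAt_abs hy).comp_hasFDerivAt y hf
  have hpow := (Real.hasDerivAt_rpow_const (p := s)
    (Or.inl (abs_ne_zero.mpr hy))).comp_hasFDerivAt y habs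
  refine ⟨_, hpow, ?_⟩
  have hsign : ‖((SignType.sign (f y) : SignType) : ℝ)‖ = 1 := by
    rcases lt_or_gt_of_ne hy with h | h <;> simp [h]
  rw [norm_smul, norm_smul, hsign, one_mul, Real.norm_eq_abs,
    abs_of_nonneg (mul_nonneg hs (Real.rpow_nonneg (abs_nonneg _) _))]

/-- If the derivative of `g ≥ 0` has norm greater than `K` at every interior point of the compact
set `Y` where `g` does not vanish, then `g x` bounds `K` times the distance from `x` to the zeros
of `g` in `Y`, or to the complement of the interior of `Y`. -/
theorem IsCompact.exists_mul_dist_le_of_lt_norm_fderiv {E : Type*} [NormedAddCommGroup E]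
    [NormedSpace ℝ E] {Y : Set E} (hY : IsCompact Y) {g : E → ℝ} (hg : ContinuousOn g Y)
    (hg0 : ∀ y ∈ Y, 0 ≤ g y) {K : ℝ} (hK : 0 ≤ K)
    (hder : ∀ y ∈ interior Y, g y ≠ 0 → ∃ G : E →L[ℝ] ℝ, HasFDerivAt g G y ∧ K < ‖G‖)
    {x : E} (hx : x ∈ Y) :
    ∃ y ∈ Y, K * dist y x ≤ g x ∧ (g y = 0 ∨ y ∉ interior Y) := by
  obtain ⟨y, hyY, hmin⟩ := hY.exists_isMinOn ⟨x, hx⟩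
    (hg.add (f := g) (g := fun z => K * dist z x) (by fun_prop))
  rw [isMinOn_iff] at hmin
  refine ⟨y, hyY, ?_, ?_⟩
  · have := hmin x hx
    simp only [Pi.add_apply, dist_self, mul_zero, add_zero] at this
    linarith [hg0 y hyY]
  · by_contra! hcon
    obtain ⟨G, hG, hKG⟩ := hder y hcon.2 hcon.1
    refine hKG.not_ge (hG.norm_le_of_eventually_le_add hK ?_)
    filter_upwards [mem_interior_iff_mem_nhds.mp hcon.2] with z hz
    have h1 := hmin z hz
    have h2 := mul_le_mul_of_nonneg_left (dist_triangle z y x) hK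
    rw [← dist_eq_norm]
    simp only [Pi.add_apply] at h1
    linarith

theorem stmt_11 (n : ℕ) (X Y : Set (EuclideanSpace ℝ (Fin n)))
    (hX : IsCompact X) (hY : IsCompact Y) (hXY : X ⊆ interior Y)
    (U : Set (EuclideanSpace ℝ (Fin n))) (hUopen : IsOpen U) (hYU : Y ⊆ U)
    (f : EuclideanSpace ℝ (Fin n) → ℝ) (hf : AnalyticOnNhd ℝ f U)
    (hcrit : ∀ x ∈ Y, gradient f x = 0 → f x = 0)
    (ϱ C : ℝ) (hϱ : ϱ ∈ Set.Ioo (0 : ℝ) 1) (hC : C > 0)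
    (hLoj : ∀ x ∈ Y, ‖gradient f x‖ ≥ C * |f x| ^ ϱ)
    (V : Set (EuclideanSpace ℝ (Fin n))) (hV : V = {x ∈ Y | f x = 0}) :
    ∃ C' > 0, ∀ x ∈ X, |f x| ≥ C' * Metric.infDist x V ^ (1 / (1 - ϱ)) := by
  obtain ⟨hϱ0, hϱ1⟩ := hϱ
  have hs : 0 < 1 - ϱ := by linarith
  have hp : 0 < 1 / (1 - ϱ) := by positivity
  rcases V.eq_empty_or_nonempty with hVe | ⟨v, hv⟩
  · refine ⟨1, one_pos, fun x _ => ?_⟩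
    rw [hVe, Metric.infDist_empty, Real.zero_rpow hp.ne', mul_zero]
    exact abs_nonneg _
  have hvY : v ∈ Y := by rw [hV] at hv; exact hv.1
  obtain ⟨δ, hδ, hδX⟩ := hX.exists_thickening_subset_open isOpen_interior hXY
  set D := Metric.diam Y + 1 with hD
  have hDpos : 0 < D := by have := Metric.diam_nonneg (s := Y); linarith
  set K := (1 - ϱ) * C / 2 with hKdef
  have hK : 0 < K := by positivity
  have hgc : ContinuousOn (fun z => |f z| ^ (1 - ϱ)) Y :=
    (hf.continuousOn.mono hYU).abs.rpow_const fun _ _ => Or.inr hs.le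
  have hder : ∀ y ∈ interior Y, |f y| ^ (1 - ϱ) ≠ 0 →
      ∃ G : EuclideanSpace ℝ (Fin n) →L[ℝ] ℝ,
        HasFDerivAt (fun z => |f z| ^ (1 - ϱ)) G y ∧ K < ‖G‖ := by
    intro y hy hne
    have hyY := interior_subset hy
    have hfy : f y ≠ 0 := by
      intro h0
      simp [h0, Real.zero_rpow hs.ne'] at hne
    obtain ⟨G, hG, hGn⟩ :=
      (hf y (hYU hyY)).differentiableAt.hasFDerivAt.exists_abs_rpow_const hs.le hfy
    refine ⟨G, hG, ?_⟩
    have hL := hLoj y hyY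
    rw [gradient, LinearIsometryEquiv.norm_map] at hL
    have hpos : 0 < |f y| := abs_pos.mpr hfy
    have hinv : |f y| ^ (1 - ϱ - 1) * |f y| ^ ϱ = 1 := by
      rw [← Real.rpow_add hpos]; simp
    calc K < (1 - ϱ) * C := by have : 0 < (1 - ϱ) * C := by positivity
                               linarith
      _ = (1 - ϱ) * |f y| ^ (1 - ϱ - 1) * (C * |f y| ^ ϱ) := by
          linear_combination (-(1 - ϱ) * C) * hinv
      _ ≤ ‖G‖ := by
          rw [hGn]
          gcongr
  set m := min 1 (δ / D) with hm
  have hmpos : 0 < m := by positivity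
  refine ⟨(K * m) ^ (1 / (1 - ϱ)), by positivity, fun x hx => ?_⟩
  have hxY := interior_subset (hXY hx)
  have hd0 : 0 ≤ Metric.infDist x V := Metric.infDist_nonneg
  have hdD : Metric.infDist x V ≤ D := by
    have h1 := Metric.infDist_le_dist_of_mem (x := x) hv
    have h2 := Metric.dist_le_diam_of_mem hY.isBounded hxY hvY
    linarith
  have hmain : K * m * Metric.infDist x V ≤ |f x| ^ (1 - ϱ) := by
    obtain ⟨y, hyY, hle, hy⟩ := hY.exists_mul_dist_le_of_lt_norm_fderiv hgc
      (fun _ _ => by positivity) hK.le hder hxY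
    refine le_trans ?_ hle
    rw [mul_assoc]
    refine mul_le_mul_of_nonneg_left ?_ hK.le
    rcases hy with hy | hy
    · have hyV : y ∈ V := by
        rw [hV]
        exact ⟨hyY, abs_eq_zero.mp ((Real.rpow_eq_zero (abs_nonneg _) hs.ne').mp hy)⟩
      rw [dist_comm]
      exact (mul_le_of_le_one_left hd0 (min_le_left _ _)).trans
        (Metric.infDist_le_dist_of_mem hyV)
    · have hδy : δ ≤ dist y x := by
        by_contra! hlt
        exact hy (hδX (Metric.mem_thickening_iff.mpr ⟨x, hx, hlt⟩))
      calc m * Metric.infDist x V ≤ δ / D * D := by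
            gcongr
            exact min_le_right _ _
        _ = δ := div_mul_cancel₀ _ hDpos.ne'
        _ ≤ _ := hδy
  calc (K * m) ^ (1 / (1 - ϱ)) * Metric.infDist x V ^ (1 / (1 - ϱ))
      = (K * m * Metric.infDist x V) ^ (1 / (1 - ϱ)) :=
        (Real.mul_rpow (by positivity) hd0).symm
    _ ≤ (|f x| ^ (1 - ϱ)) ^ (1 / (1 - ϱ)) :=
        Real.rpow_le_rpow (by positivity) hmain hp.le
    _ = |f x| := by
        rw [← Real.rpow_mul (abs_nonneg _), mul_one_div_cancel hs.ne', Real.rpow_one]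
end

section
/- Let U ⊆ ℝⁿ be open and connected, let f : U → ℝ be a real-analytic function, not identically zero, for which there exists a nonzero polynomial P ∈ ℝ[x₁,…,xₙ,y] with P(x, f(x)) = 0 for all x ∈ U. Let Ω ⊆ U be a closed Euclidean ball. Then the set of critical values {f(x) : x ∈ Ω, ∇f(x) = 0} is finite; in particular, there exists ε > 0 such that every x ∈ Ω with ∇f(x) = 0 satisfies either f(x) = 0 or |f(x)| ≥ ε. -/
section

open Polynomial Filter Topology

theorem Algebra.FormallySmooth.of_charZero (K L : Type*) [Field K] [CharZero K] [Field L]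
    [Algebra K L] : Algebra.FormallySmooth K L := by
  obtain ⟨s, hs⟩ := exists_isTranscendenceBasis K L
  have := hs.isAlgebraic_field
  exact Algebra.FormallySmooth.of_algebraicIndependent_of_isSeparable hs.1

/-- A surjection of `k`-algebras with nilpotent kernel onto a field extension `L` of a field `k` of
characteristic zero has a section sending a given transcendental element to any prescribed lift. -/
theorem Transcendental.exists_algHom_section {k L B : Type*} [Field k] [CharZero k] [Field L]
    [Algebra k L] [CommRing B] [Algebra k B] {τ : L} (hτ : Transcendental k τ) (g : B →ₐ[k] L)
    (hg : Function.Surjective g) (hnil : IsNilpotent (RingHom.ker (g : B →+* L)))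
    {b : B} (hb : g b = τ) : ∃ φ : L →ₐ[k] B, φ τ = b ∧ ∀ a, g (φ a) = a := by
  let fL : k[X] →ₐ[k] L := Polynomial.aeval τ
  let fB : k[X] →ₐ[k] B := Polynomial.aeval b
  algebraize [fL.toRingHom, fB.toRingHom]
  have hinj : Function.Injective (algebraMap k[X] L) := transcendental_iff_injective.1 hτ
  have : FaithfulSMul k[X] L := (faithfulSMul_iff_algebraMap_injective _ _).2 hinj
  have : IsScalarTower k k[X] L := .of_algebraMap_eq fun x => (fL.commutes x).symm
  have : IsScalarTower k k[X] B := .of_algebraMap_eq fun x => (fB.commutes x).symm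
  let _ := FractionRing.liftAlgebra k[X] L
  have : CharZero (FractionRing k[X]) :=
    charZero_of_injective_algebraMap (IsFractionRing.injective k[X] (FractionRing k[X]))
  have : Algebra.FormallySmooth (FractionRing k[X]) L := .of_charZero _ _
  have : Algebra.FormallySmooth k[X] (FractionRing k[X]) :=
    .of_isLocalization (nonZeroDivisors _)
  have : Algebra.FormallySmooth k[X] L := .comp _ (FractionRing k[X]) _
  let g' : B →ₐ[k[X]] L := { (g : B →+* L) with
    commutes' := fun p => by
      change g (Polynomial.aeval b p) = Polynomial.aeval τ p
      rw [← hb, Polynomial.aeval_algHom_apply] }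
  let φ := Algebra.FormallySmooth.liftOfSurjective (AlgHom.id k[X] L) g' hg hnil
  refine ⟨φ.restrictScalars k, ?_,
    Algebra.FormallySmooth.liftOfSurjective_apply (AlgHom.id k[X] L) g' hg hnil⟩
  have h1 : algebraMap k[X] L X = τ := Polynomial.aeval_X _
  have h2 : algebraMap k[X] B X = b := Polynomial.aeval_X _
  rw [← h2, ← φ.commutes X, h1]
  rfl

theorem Transcendental.exists_algHom_quotient_X_pow {k L : Type*} [Field k] [CharZero k] [Field L]
    [Algebra k L] {τ : L} (hτ : Transcendental k τ) {M : ℕ} (hM : M ≠ 0) :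
    ∃ φ : L →ₐ[k] L[X] ⧸ Ideal.span {(X : L[X]) ^ M},
      φ τ = Ideal.Quotient.mk _ (C τ + X) ∧
      ∀ a, ∃ p : L[X], Ideal.Quotient.mk _ p = φ a ∧ p.eval 0 = a := by
  set I : Ideal L[X] := Ideal.span {(X : L[X]) ^ M} with hI
  let ev : L[X] ⧸ I →ₐ[k] L := Ideal.Quotient.liftₐ I
    ((Polynomial.aeval (0 : L)).restrictScalars k) (by
    intro a ha
    obtain ⟨b, rfl⟩ := Ideal.mem_span_singleton.1 ha
    simp [hM])
  have hev : ∀ p : L[X], ev (Ideal.Quotient.mk I p) = p.eval 0 := fun p => by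
    rw [← coe_aeval_eq_eval]; rfl
  have hnil : IsNilpotent (RingHom.ker (ev : L[X] ⧸ I →+* L)) := by
    refine ⟨M, ?_⟩
    have : RingHom.ker (ev : L[X] ⧸ I →+* L) ≤ Ideal.span {Ideal.Quotient.mk I X} := by
      intro b hb
      obtain ⟨p, rfl⟩ := Ideal.Quotient.mk_surjective b
      have : p.eval 0 = 0 := (hev p).symm.trans hb
      rw [Ideal.mem_span_singleton]
      exact map_dvd _ (X_dvd_iff.2 (by rwa [coeff_zero_eq_eval_zero]))
    refine le_bot_iff.1 ((Ideal.pow_right_mono this M).trans ?_)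
    rw [Ideal.span_singleton_pow, ← map_pow, Ideal.Quotient.eq_zero_iff_mem.2
      (Ideal.mem_span_singleton_self _)]
    simp
  obtain ⟨φ, hφτ, hφ⟩ := hτ.exists_algHom_section ev
    (fun a => ⟨Ideal.Quotient.mk I (C a), by simp [hev]⟩) hnil
    (b := Ideal.Quotient.mk I (C τ + X)) (by simp [hev])
  refine ⟨φ, hφτ, fun a => ?_⟩
  obtain ⟨p, hp⟩ := Ideal.Quotient.mk_surjective (φ a)
  exact ⟨p, hp, by rw [← hev, hp, hφ]⟩

theorem Polynomial.exists_map_eq_map_of_section {L B : Type*} [CommRing L] [CommRing B]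
    (φ : L →+* B) (π : L[X] →+* B) (h : ∀ a, ∃ p : L[X], π p = φ a ∧ p.eval 0 = a) (r : L[X]) :
    ∃ q : L[X][X], q.map π = r.map φ ∧ q.map (evalRingHom 0) = r := by
  induction r using Polynomial.induction_on' with
  | add p q hp hq =>
    obtain ⟨p', hp, hp0⟩ := hp
    obtain ⟨q', hq, hq0⟩ := hq
    exact ⟨p' + q', by simp [hp, hq], by simp [hp0, hq0]⟩
  | monomial n a =>
    obtain ⟨p, hp, hp0⟩ := h a
    exact ⟨monomial n p, by simp [hp], by simp [hp0]⟩

theorem exists_jet_relation_of_lift {k L B : Type*} [Field k] [Field L] [Algebra k L]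
    [CommRing B] [Algebra k B] {n : ℕ} {P : MvPolynomial (Fin (n + 1)) k} {x : Fin n → L}
    {w : Fin n → k} {τ : L} {m e : ℕ} {q : L[X][X]} {r : L[X]} {g : Fin (n + 1) → L[X][X]}
    (hg_def : g = Fin.snoc
      (fun i => C (C (x i)) * (1 - X) + X * C (C (algebraMap k L (w i)))) (C X))
    (hg : MvPolynomial.aeval g P = X ^ m * q) (hr : q.coeff 0 = (X - C τ) ^ e * r)
    (hr0 : r.eval τ ≠ 0) (π : L[X] →ₐ[k] B) (hπ : Function.Surjective π)
    (hker : ∀ p, π p = 0 → X ^ ((e + 1) * m + (e + 1)) ∣ p) (φ : L →ₐ[k] B)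
    (hφτ : φ τ = π (C τ + X)) (hφ : ∀ a, ∃ p : L[X], π p = φ a ∧ p.eval 0 = a) :
    ∃ (ξ : Fin n → L[X]) (a e : ℕ) (R S : L[X][X]), (∀ i, (ξ i).eval 0 = x i) ∧
      R.evalEval 0 τ ≠ 0 ∧
      MvPolynomial.aeval (Fin.snoc (fun i => C (ξ i)) X : Fin (n + 1) → L[X][X]) P =
        C (X ^ a) * ((X - C (C τ + X)) ^ e * R + C (X ^ (e + 1)) * S) := by
  obtain ⟨R, hR, hR0⟩ := exists_map_eq_map_of_section (φ : L →+* B) (π : L[X] →+* B) hφ r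
  choose ψ hψ hψ0 using hφ
  let Ψ : L[X][X] →ₐ[k] B[X] :=
    Polynomial.eval₂AlgHom (mapAlgHom φ) (C (π (X ^ (e + 1)))) fun a => Commute.all (mapAlgHom φ a) _
  have hΨC : ∀ p, Ψ (C p) = p.map (φ : L →+* B) := fun p => by simp [Ψ]
  have hΨX : Ψ X = C (π (X ^ (e + 1))) := by simp [Ψ]
  let Φ : L[X][X] →ₐ[k] B[X] := mapAlgHom π
  have hΦ : ∀ p, Φ p = p.map (π : L[X] →+* B) := fun p => rfl
  obtain ⟨S, hS⟩ := map_surjective (f := (π : L[X] →+* B)) hπ (Ψ q.divX)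
  let ξ : Fin n → L[X] := fun i =>
    ψ (x i) * (1 - X ^ (e + 1)) + X ^ (e + 1) * C (algebraMap k L (w i))
  let h : Fin (n + 1) → L[X][X] := Fin.snoc (fun i => C (ξ i)) X
  have key : Φ (MvPolynomial.aeval h P) = Ψ (MvPolynomial.aeval g P) := by
    have hcomp : ∀ (Θ : L[X][X] →ₐ[k] B[X]) (v : Fin (n + 1) → L[X][X]),
        Θ (MvPolynomial.aeval v P) = MvPolynomial.aeval (fun i => Θ (v i)) P :=
      fun Θ v => MvPolynomial.comp_aeval_apply (f := v) Θ P
    rw [hcomp, hcomp]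
    congr 2
    ext1 i
    refine Fin.lastCases ?_ (fun i => ?_) i
    · simp [h, hg_def, hΦ, hΨC]
    · have : φ (algebraMap k L (w i)) = π (C (algebraMap k L (w i))) := by
        exact (φ.commutes _).trans (π.commutes _).symm
      simp [h, hg_def, hΦ, hΨC, hΨX, ξ, hψ, this]
  rw [hg, ← divX_mul_X_add q, hr] at key
  simp only [map_mul, map_add, map_pow, hΨX, hΨC,
    Polynomial.map_sub, map_X, map_C, ← hR, ← hS, RingHom.coe_coe, hφτ] at key
  have hdvd : C (X ^ ((e + 1) * m + (e + 1))) ∣ MvPolynomial.aeval h P -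
      C (X ^ ((e + 1) * m)) * ((X - C (C τ + X)) ^ e * R + C (X ^ (e + 1)) * S) := by
    rw [C_dvd_iff_dvd_coeff]
    intro i
    refine hker _ ?_
    rw [← RingHom.coe_coe π, ← coeff_map, ← hΦ, map_sub, key]
    simp only [hΦ, Polynomial.map_mul, Polynomial.map_pow, Polynomial.map_sub, Polynomial.map_add,
      map_X, map_C, map_pow, map_add, RingHom.coe_coe]
    rw [← coeff_zero i]
    congr 1
    ring
  obtain ⟨T, hT⟩ := hdvd
  refine ⟨ξ, (e + 1) * m, e, R, S + T, fun i => by simp [ξ, hψ0], ?_, ?_⟩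
  · rwa [← map_evalRingHom_eval, hR0]
  · rw [sub_eq_iff_eq_add.1 hT]
    simp only [map_pow]
    ring

/-- If `(x, τ)` has coordinates in a field extension of `k` and `τ` is transcendental over `k`, there
is a polynomial arc `ξ` through `x` along which `P(ξ(s), y)` has, up to a power of `s`, the root
`y = τ + s` modulo a power of `s` exceeding its multiplicity. -/
theorem Transcendental.exists_jet_relation {k L : Type*} [Field k] [CharZero k] [Field L]
    [Algebra k L] {n : ℕ} {P : MvPolynomial (Fin (n + 1)) k} (hP : P ≠ 0) (x : Fin n → L)
    {τ : L} (hτ : Transcendental k τ) :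
    ∃ (ξ : Fin n → L[X]) (a e : ℕ) (R S : L[X][X]), (∀ i, (ξ i).eval 0 = x i) ∧
      R.evalEval 0 τ ≠ 0 ∧
      MvPolynomial.aeval (Fin.snoc (fun i => C (ξ i)) X : Fin (n + 1) → L[X][X]) P =
        C (X ^ a) * ((X - C (C τ + X)) ^ e * R + C (X ^ (e + 1)) * S) := by
  obtain ⟨w, hw⟩ : ∃ w, MvPolynomial.eval w P ≠ 0 := by
    by_contra! h
    exact hP (MvPolynomial.funext fun w => by simpa using h w)
  let g : Fin (n + 1) → L[X][X] :=
    Fin.snoc (fun i => C (C (x i)) * (1 - X) + X * C (C (algebraMap k L (w i.castSucc)))) (C X)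
  have hQ : MvPolynomial.aeval g P ≠ 0 := by
    intro h
    let v : L[X][X] →+* L :=
      (evalRingHom (algebraMap k L (w (Fin.last n)))).comp (evalRingHom 1)
    have hv : v (MvPolynomial.aeval g P) = algebraMap k L (MvPolynomial.eval w P) := by
      rw [MvPolynomial.aeval_def, MvPolynomial.hom_eval₂, ← MvPolynomial.eval₂_id,
        MvPolynomial.hom_eval₂]
      congr 1
      · ext a
        simp [v, Polynomial.algebraMap_apply]
      · ext i
        refine Fin.lastCases ?_ (fun i => ?_) i <;> simp [v, g]
    rw [h, map_zero] at hv
    exact hw ((map_eq_zero_iff _ (algebraMap k L).injective).1 hv.symm)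
  obtain ⟨q, hq, hq0⟩ := exists_eq_pow_rootMultiplicity_mul_and_not_dvd _ hQ 0
  generalize rootMultiplicity 0 (MvPolynomial.aeval g P) = m at hq
  rw [C_0, sub_zero] at hq hq0
  rw [X_dvd_iff] at hq0
  obtain ⟨r, hr, hr0⟩ := exists_eq_pow_rootMultiplicity_mul_and_not_dvd _ hq0 τ
  generalize rootMultiplicity τ (q.coeff 0) = e at hr
  rw [dvd_iff_isRoot, IsRoot.def] at hr0
  obtain ⟨φ, hφτ, hφ⟩ := hτ.exists_algHom_quotient_X_pow (M := (e + 1) * m + (e + 1)) (by omega)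
  exact exists_jet_relation_of_lift (w := fun i => w i.castSucc) rfl hq hr hr0
    (Ideal.Quotient.mkₐ k _) (Ideal.Quotient.mkₐ_surjective k _)
    (fun p hp => Ideal.mem_span_singleton.1 (Ideal.Quotient.eq_zero_iff_mem.1 hp)) φ hφτ hφ

theorem Polynomial.continuous_evalEval (R : ℝ[X][X]) :
    Continuous fun p : ℝ × ℝ => R.evalEval p.1 p.2 := by
  induction R using Polynomial.induction_on' with
  | add p q hp hq => simpa only [evalEval_add, Pi.add_def] using hp.add hq
  | monomial n a => simp [evalEval, eval_monomial]; fun_prop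

/-- A function with vanishing derivative at `0` cannot satisfy a relation having `y = t + s` as a root
modulo a power of `s` exceeding its multiplicity. -/
theorem not_jet_relation {F : ℝ → ℝ} {t : ℝ} (h0 : F 0 = t) (hF : HasDerivAt F 0 0)
    (a e : ℕ) (R S : ℝ[X][X]) (hR : R.evalEval 0 t ≠ 0)
    (h : ∀ᶠ s in 𝓝 0, s ^ a * ((F s - t - s) ^ e * R.evalEval s (F s)
      + s ^ (e + 1) * S.evalEval s (F s)) = 0) : False := by
  have hc : ∀ R : ℝ[X][X], Tendsto (fun s => R.evalEval s (F s)) (𝓝[≠] 0) (𝓝 (R.evalEval 0 t)) := by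
    intro R
    have h1 : Tendsto (fun s => (s, F s)) (𝓝[≠] 0) (𝓝 ((0 : ℝ), t)) :=
      (tendsto_id.mono_left nhdsWithin_le_nhds).prodMk_nhds
        (h0 ▸ hF.continuousAt.tendsto.mono_left nhdsWithin_le_nhds)
    exact ((continuous_evalEval R).tendsto _).comp h1
  have hs : Tendsto (fun s => (s⁻¹ * (F s - t) - 1)) (𝓝[≠] 0) (𝓝 (0 - 1)) := by
    have := hasDerivAt_iff_tendsto_slope_zero.1 hF
    simp only [zero_add, h0, smul_eq_mul] at this
    exact this.sub_const 1
  have hid : Tendsto (fun s : ℝ => s) (𝓝[≠] 0) (𝓝 0) := tendsto_id.mono_left nhdsWithin_le_nhds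
  have hlim := ((hs.pow e).mul (hc R)).add (hid.mul (hc S))
  have hz : (fun s => (s⁻¹ * (F s - t) - 1) ^ e * R.evalEval s (F s) + s * S.evalEval s (F s))
      =ᶠ[𝓝[≠] 0] fun _ => 0 := by
    filter_upwards [h.filter_mono nhdsWithin_le_nhds, self_mem_nhdsWithin] with s hs hs0
    have hs0 : s ≠ 0 := hs0
    have h2 := (mul_eq_zero.1 hs).resolve_left (pow_ne_zero _ hs0)
    have h3 : F s - t - s = s * (s⁻¹ * (F s - t) - 1) := by field_simp
    rw [h3, mul_pow, pow_succ, mul_assoc, mul_assoc, ← mul_add] at h2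
    exact (mul_eq_zero.1 h2).resolve_left (pow_ne_zero _ hs0)
  have := tendsto_nhds_unique (hlim.congr' hz) tendsto_const_nhds
  simp [hR] at this

theorem Polynomial.eventually_map_eq_zero {ι A B : Type*} {D : ι → Type*} [Semiring A] [Semiring B]
    [∀ k, Semiring (D k)] {l : Filter ι} {ρ : A →+* B} {ev : ∀ k, A →+* D k}
    (h : ∀ a, ρ a = 0 → ∀ᶠ k in l, ev k a = 0) (p : A[X]) (hp : mapRingHom ρ p = 0) :
    ∀ᶠ k in l, mapRingHom (ev k) p = 0 := by
  have : ∀ᶠ k in l, ∀ i ∈ p.support, ev k (p.coeff i) = 0 :=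
    (Filter.eventually_all_finset _).2 fun i _ => h _ (by
      rw [← coeff_map, ← coe_mapRingHom, hp, coeff_zero])
  filter_upwards [this] with k hk
  ext i
  rw [coe_mapRingHom, coeff_map, coeff_zero]
  by_cases hi : i ∈ p.support
  · exact hk i hi
  · rw [notMem_support_iff.1 hi, map_zero]

theorem Polynomial.evalEval_mapAlgHom {k A B : Type*} [CommRing k] [CommRing A] [CommRing B]
    [Algebra k A] [Algebra k B] (σ : A →ₐ[k] B) (t : A) (R : A[X][X]) :
    (mapAlgHom (mapAlgHom σ) R).evalEval 0 (σ t) = σ (R.evalEval 0 t) := by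
  have := map_mapRingHom_evalEval (σ : A →+* B) R 0 t
  rw [map_zero] at this
  exact this

/-- The defect of the identity `P(ξ(s), y) = s ^ a * ((y - t - s) ^ e * R + s ^ (e + 1) * S)` of
polynomials in `s` (inner variable) and `y` (outer variable). -/
noncomputable def jetDefect {k A : Type*} [CommRing k] [CommRing A] [Algebra k A] {n : ℕ}
    (P : MvPolynomial (Fin (n + 1)) k) (ξ : Fin n → A[X]) (t : A) (a e : ℕ) (R S : A[X][X]) :
    A[X][X] :=
  MvPolynomial.aeval (Fin.snoc (fun i => C (ξ i)) X : Fin (n + 1) → A[X][X]) P -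
    C (X ^ a) * ((X - C (C t + X)) ^ e * R + C (X ^ (e + 1)) * S)

theorem mapAlgHom_jetDefect {k A B : Type*} [CommRing k] [CommRing A] [CommRing B]
    [Algebra k A] [Algebra k B] (σ : A →ₐ[k] B) {n : ℕ} (P : MvPolynomial (Fin (n + 1)) k)
    (ξ : Fin n → A[X]) (t : A) (a e : ℕ) (R S : A[X][X]) :
    mapAlgHom (mapAlgHom σ) (jetDefect P ξ t a e R S) =
      jetDefect P (fun i => mapAlgHom σ (ξ i)) (σ t) a e (mapAlgHom (mapAlgHom σ) R)
        (mapAlgHom (mapAlgHom σ) S) := by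
  simp only [jetDefect]
  rw [map_sub, MvPolynomial.comp_aeval_apply]
  congr 1
  · congr 2
    ext1 i
    refine Fin.lastCases ?_ (fun i => ?_) i <;> simp
  · simp

theorem exists_real_jet_relation {ι L : Type*} {l : Filter ι} [Field L] [Algebra ℝ L]
    (ρ : (ι → ℝ) →ₐ[ℝ] L) (hρ : Function.Surjective ρ)
    (hker : ∀ a, ρ a = 0 ↔ ∀ᶠ k in l, a k = 0) {n : ℕ} {P : MvPolynomial (Fin (n + 1)) ℝ}
    (hP : P ≠ 0) (x : ι → Fin n → ℝ) {t : ι → ℝ} (ht : Transcendental ℝ (ρ t)) :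
    ∃ (k : ι) (ξ : Fin n → ℝ[X]) (a e : ℕ) (R S : ℝ[X][X]), (∀ i, (ξ i).eval 0 = x k i) ∧
      R.evalEval 0 (t k) ≠ 0 ∧ jetDefect P ξ (t k) a e R S = 0 := by
  obtain ⟨ξ, a, e, R, S, hξ, hR, hrel⟩ := ht.exists_jet_relation hP fun i => ρ fun k => x k i
  have hμ : Function.Surjective (mapAlgHom ρ) := map_surjective (ρ : (ι → ℝ) →+* L) hρ
  have hν : Function.Surjective (mapAlgHom (mapAlgHom ρ)) :=
    map_surjective (mapAlgHom ρ : (ι → ℝ)[X] →+* L[X]) hμ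
  obtain ⟨R, rfl⟩ := hν R
  obtain ⟨S, rfl⟩ := hν S
  choose ξ' hξ' using fun i => hμ (ξ i)
  obtain rfl : (fun i => mapAlgHom ρ (ξ' i)) = ξ := funext hξ'
  have h1 : ∀ᶠ k in l, ∀ i, (ξ' i).eval 0 k = x k i := by
    rw [eventually_all]
    intro i
    have h0 : (mapAlgHom ρ (ξ' i)).eval 0 = ρ ((ξ' i).eval 0) := by
      rw [← coeff_zero_eq_eval_zero, ← coeff_zero_eq_eval_zero]
      exact coeff_map _ _
    have := hξ i
    rw [h0, ← sub_eq_zero, ← map_sub, hker] at this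
    filter_upwards [this] with k hk using sub_eq_zero.1 hk
  have h2 : ∃ᶠ k in l, R.evalEval 0 t k ≠ 0 := by
    rw [evalEval_mapAlgHom, ne_eq, hker] at hR
    simpa only [Filter.Frequently, ne_eq, not_not] using hR
  have h3 := eventually_map_eq_zero (ev := fun k => mapRingHom (Pi.evalRingHom (fun _ : ι => ℝ) k))
    (eventually_map_eq_zero (ρ := (ρ : (ι → ℝ) →+* L)) fun a ha => (hker a).1 ha)
    (jetDefect P ξ' t a e R S)
    ((mapAlgHom_jetDefect ρ P ξ' t a e R S).trans (sub_eq_zero.2 hrel))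
  obtain ⟨k, ⟨hk2, hk1⟩, hk3⟩ := ((h2.and_eventually h1).and_eventually h3).exists
  let σ : (ι → ℝ) →ₐ[ℝ] ℝ := Pi.evalAlgHom ℝ _ k
  refine ⟨k, fun i => mapAlgHom σ (ξ' i), a, e, mapAlgHom (mapAlgHom σ) R,
    mapAlgHom (mapAlgHom σ) S, fun i => ?_, ?_, ?_⟩
  · rw [← hk1, ← coeff_zero_eq_eval_zero, ← coeff_zero_eq_eval_zero]
    exact coeff_map _ _
  · exact (evalEval_mapAlgHom σ t R).trans_ne hk2
  · exact (mapAlgHom_jetDefect σ P ξ' t a e R S).symm.trans hk3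

theorem exists_ultraproduct_field :
    ∃ (L : Type) (_ : Field L) (_ : Algebra ℝ L) (ρ : (ℕ → ℝ) →ₐ[ℝ] L), Function.Surjective ρ ∧
      ∀ a, ρ a = 0 ↔ ∀ᶠ k in (hyperfilter ℕ : Filter ℕ), a k = 0 := by
  let ρ := Germ.coeRingHom (R := ℝ) (hyperfilter ℕ : Filter ℕ)
  let alg := (ρ.comp (algebraMap ℝ (ℕ → ℝ))).toAlgebra
  refine ⟨_, inferInstance, alg, { ρ with commutes' := fun r => rfl }, ?_, fun a => ?_⟩
  · intro y
    induction y using Germ.inductionOn with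
    | h a => exact ⟨a, rfl⟩
  · exact Germ.coe_eq

theorem transcendental_of_injective {L : Type*} [Field L] [Algebra ℝ L] (ρ : (ℕ → ℝ) →ₐ[ℝ] L)
    (hker : ∀ a, ρ a = 0 → ∀ᶠ k in (hyperfilter ℕ : Filter ℕ), a k = 0) {t : ℕ → ℝ}
    (ht : Function.Injective t) : Transcendental ℝ (ρ t) := by
  rw [transcendental_iff]
  intro p hp
  rw [aeval_algHom_apply] at hp
  have hev : ∀ k, aeval t p k = p.eval (t k) := fun k => by
    simp
  refine eq_zero_of_infinite_isRoot p (Set.Infinite.mono (s := t '' {k | p.eval (t k) = 0}) ?_ ?_)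
  · rintro _ ⟨k, hk, rfl⟩
    exact hk
  · refine Set.Infinite.image ht.injOn fun hfin => ?_
    refine notMem_hyperfilter_of_finite hfin ?_
    filter_upwards [hker _ hp] with k hk
    rw [← hev, hk]

/-- A differentiable function satisfying a nontrivial polynomial equation over an open set has finitely
many critical values there. -/
theorem finite_setOf_critical_value {n : ℕ} {U : Set (EuclideanSpace ℝ (Fin n))} (hU : IsOpen U)
    {f : EuclideanSpace ℝ (Fin n) → ℝ} (hf : ∀ x ∈ U, DifferentiableAt ℝ f x)
    {P : MvPolynomial (Fin (n + 1)) ℝ} (hP : P ≠ 0)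
    (hPf : ∀ x ∈ U, MvPolynomial.eval (Fin.snoc (fun i => x i) (f x)) P = 0) :
    {y : ℝ | ∃ x ∈ U, gradient f x = 0 ∧ f x = y}.Finite := by
  by_contra hinf
  let t := Set.Infinite.natEmbedding _ hinf
  choose x hxU hx0 hxt using fun k => (t k).2
  obtain ⟨L, _, _, ρ, hρ, hker⟩ := exists_ultraproduct_field
  obtain ⟨k, ξ, a, e, R, S, hξ, hR, hrel⟩ := exists_real_jet_relation ρ hρ hker hP
    (fun k i => x k i) (t := fun k => (t k : ℝ))
    (transcendental_of_injective ρ (fun a => (hker a).1) (Subtype.val_injective.comp t.injective))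
  let γ : ℝ → EuclideanSpace ℝ (Fin n) := fun s => WithLp.toLp 2 fun i => (ξ i).eval s
  have hγ0 : γ 0 = x k := by
    ext i
    exact hξ i
  have hγ : DifferentiableAt ℝ γ 0 := by
    rw [differentiableAt_euclidean]
    exact fun i => (ξ i).differentiable.differentiableAt
  have hfd : HasFDerivAt f (0 : EuclideanSpace ℝ (Fin n) →L[ℝ] ℝ) (γ 0) := by
    have := (hf _ (hxU k)).hasGradientAt.hasFDerivAt
    rwa [hx0, map_zero, ← hγ0] at this
  refine not_jet_relation (F := f ∘ γ) (by simp [hγ0, hxt]) ?_ a e R S hR ?_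
  · exact hfd.comp_hasDerivAt 0 hγ.hasDerivAt
  · have hmem : ∀ᶠ s in 𝓝 0, γ s ∈ U :=
      hγ.continuousAt.eventually_mem (hU.mem_nhds (hγ0 ▸ hxU k))
    filter_upwards [hmem] with s hs
    have h := congrArg (evalEval s (f (γ s))) (sub_eq_zero.1 hrel)
    have hP0 := hPf _ hs
    have : evalEval s (f (γ s)) (MvPolynomial.aeval
        (Fin.snoc (fun i => C (ξ i)) X : Fin (n + 1) → ℝ[X][X]) P) = 0 := by
      rw [← hP0, ← coe_evalEvalRingHom, MvPolynomial.aeval_def, MvPolynomial.hom_eval₂,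
        ← MvPolynomial.eval₂_id]
      congr 1
      · ext a
        simp
      · ext i
        refine Fin.lastCases ?_ (fun i => ?_) i <;> simp [γ]
    rw [this] at h
    simpa [sub_sub, evalEval_C] using h.symm

end


theorem stmt_12 (n : ℕ) (U : Set (EuclideanSpace ℝ (Fin n))) (hUopen : IsOpen U)
    (hUconn : IsConnected U)
    (f : EuclideanSpace ℝ (Fin n) → ℝ) (hf : AnalyticOnNhd ℝ f U)
    (hfne : ∃ x ∈ U, f x ≠ 0)
    (P : MvPolynomial (Fin (n + 1)) ℝ) (hP : P ≠ 0)
    (hPf : ∀ x ∈ U, MvPolynomial.eval (Fin.snoc (fun i => x i) (f x)) P = 0)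
    (c : EuclideanSpace ℝ (Fin n)) (r : ℝ) (hr : 0 < r)
    (Ω : Set (EuclideanSpace ℝ (Fin n))) (hΩ : Ω = Metric.closedBall c r)
    (hΩU : Ω ⊆ U) :
    {y : ℝ | ∃ x ∈ Ω, gradient f x = 0 ∧ f x = y}.Finite ∧
    ∃ ε > 0, ∀ x ∈ Ω, gradient f x = 0 → f x = 0 ∨ |f x| ≥ ε := by
  
  have hfin : {y : ℝ | ∃ x ∈ Ω, gradient f x = 0 ∧ f x = y}.Finite := by
    refine (finite_setOf_critical_value hUopen (fun x hx => (hf x hx).differentiableAt)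
      hP hPf).subset ?_
    rintro y ⟨x, hx, h⟩
    exact ⟨x, hΩU hx, h⟩
  refine ⟨hfin, ?_⟩
  obtain ⟨ε, hε, hball⟩ := Metric.isOpen_iff.1
    (hfin.subset (Set.sdiff_subset (t := {0}))).isClosed.isOpen_compl 0 (by simp)
  refine ⟨ε, hε, fun x hx hgrad => or_iff_not_imp_left.2 fun hfx => ?_⟩
  by_contra! hlt
  exact hball (by simpa using hlt) ⟨⟨x, hx, hgrad, rfl⟩, hfx⟩
end
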